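/- arXiv:0910.2063 — 4 statements merged into one kernel-verified Lean document; each statement's English description precedes it below -/
import Mathlib

section
/- Let n ≥ 2 and l ≥ 2 be integers, let Ω ⊂ ℝ^n be a bounded connected open set with smooth boundary, and for k ≥ 1 let Λ_k denote the k-th eigenvalue of the buckling problem of order l on Ω (defined variationally as in the context). Then for every k ≥ 1, Σ_{i=1}^k (Λ_{k+1} − Λ_i)² ≤ (4(2l² + (n−4)l + 2 − n)/n²)·Σ_{i=1}^k (Λ_{k+1} − Λ_i)Λ_i. -/
open MeasureTheory

/-- The Euclidean Laplacian of a function on `ℝⁿ`. -/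
noncomputable def lap {n : ℕ} (f : EuclideanSpace ℝ (Fin n) → ℝ) : EuclideanSpace ℝ (Fin n) → ℝ :=
  fun x => ∑ i : Fin n,
    fderiv ℝ (fun y => fderiv ℝ f y (EuclideanSpace.single i 1)) x (EuclideanSpace.single i 1)

/-- The negative Euclidean Laplacian. -/
noncomputable def negLap {n : ℕ} (f : EuclideanSpace ℝ (Fin n) → ℝ) :
    EuclideanSpace ℝ (Fin n) → ℝ :=
  fun x => -(lap f x)

/-- The `k`-th eigenvalue of the buckling problem of order `l` on `Ω ⊆ ℝⁿ`, defined via the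
Courant min–max principle: the infimum over `k`-dimensional subspaces `V` of smooth functions
compactly supported in `Ω` of the supremum of the Rayleigh quotient
`(∫ φ (−Δ)^l φ) / (∫ |∇φ|²)` over nonzero `φ ∈ V`. -/
noncomputable def bucklingEigenvalue (n l : ℕ) (Ω : Set (EuclideanSpace ℝ (Fin n))) (k : ℕ) :
    ℝ :=
  sInf { r : ℝ | ∃ V : Submodule ℝ (EuclideanSpace ℝ (Fin n) → ℝ),
    Module.finrank ℝ V = k ∧
    (∀ f ∈ V, ContDiff ℝ (⊤ : ℕ∞) f ∧ HasCompactSupport f ∧ tsupport f ⊆ Ω) ∧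
    r = sSup { s : ℝ | ∃ φ ∈ V, φ ≠ 0 ∧
      s = (∫ x, φ x * (negLap^[l] φ) x) / (∫ x, ‖gradient φ x‖ ^ 2) } }

section MinMax

variable {E : Type*} [NormedAddCommGroup E] [InnerProductSpace ℝ E]

open scoped InnerProductSpace

/-- The min-max values of a symmetric operator on a real inner product space. -/
noncomputable def minMax (T : E →ₗ[ℝ] E) (m : ℕ) : ℝ :=
  sInf {r : ℝ | ∃ V : Submodule ℝ E, Module.finrank ℝ V = m ∧
    r = sSup {s : ℝ | ∃ φ ∈ V, φ ≠ 0 ∧ s = ⟪φ, T φ⟫_ℝ / ‖φ‖ ^ 2}}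

/-- `e` is an orthonormal family in which `T` is diagonal with increasing Ritz values `ν`. -/
structure IsRitz (T : E →ₗ[ℝ] E) {N : ℕ} (e : Fin N → E) (ν : Fin N → ℝ) : Prop where
  orthonormal : Orthonormal ℝ e
  diag : ∀ i j, ⟪e i, T (e j)⟫_ℝ = if i = j then ν i else 0
  mono : Monotone ν

lemma exists_isRitz (T : E →ₗ[ℝ] E) (hT : T.IsSymmetric) (W : Submodule ℝ E)
    [FiniteDimensional ℝ W] {N : ℕ} (hN : Module.finrank ℝ W = N) :
    ∃ (e : Fin N → E) (ν : Fin N → ℝ), IsRitz T e ν ∧ Submodule.span ℝ (Set.range e) = W := by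
  let S : W →ₗ[ℝ] W := W.orthogonalProjectionOnto.toLinearMap ∘ₗ T ∘ₗ W.subtype
  have hS : ∀ v w : W, ⟪v, S w⟫_ℝ = ⟪(v : E), T w⟫_ℝ := by
    intro v w
    simp [S]
  have hSs : S.IsSymmetric := by
    intro v w
    rw [real_inner_comm, hS, hS, ← hT, real_inner_comm]
  let b := (hSs.eigenvectorBasis hN).reindex Fin.revPerm
  let ν : Fin N → ℝ := fun i => hSs.eigenvalues hN i.rev
  have hb : ∀ i, S (b i) = ν i • b i := by
    intro i
    simp [b, ν, hSs.apply_eigenvectorBasis hN i.rev]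
  refine ⟨fun i => (b i : E), ν, ⟨?_, ?_, ?_⟩, ?_⟩
  · exact b.orthonormal.comp_linearIsometry W.subtypeₗᵢ
  · intro i j
    rw [← hS, hb, inner_smul_right]
    have := orthonormal_iff_ite.1 b.orthonormal i j
    rw [this]
    split_ifs with h
    · simp [h]
    · simp
  · intro i j hij
    exact hSs.eigenvalues_antitone hN (Fin.rev_le_rev.2 hij)
  · have h1 : Submodule.span ℝ (Set.range b) = ⊤ := by
      simpa using b.toBasis.span_eq
    have h2 : Set.range (fun i => (b i : E)) = W.subtype '' Set.range b := by
      rw [← Set.range_comp]; rfl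
    rw [h2, ← Submodule.map_span, h1, Submodule.map_top, Submodule.range_subtype]

lemma IsRitz.inner_sum {T : E →ₗ[ℝ] E} {N : ℕ} {e : Fin N → E} {ν : Fin N → ℝ}
    (h : IsRitz T e ν) (c : Fin N → ℝ) :
    ⟪∑ i, c i • e i, T (∑ i, c i • e i)⟫_ℝ = ∑ i, ν i * c i ^ 2 := by
  rw [map_sum, sum_inner]
  refine Finset.sum_congr rfl fun i _ => ?_
  simp only [_root_.inner_sum, map_smul, inner_smul_left, inner_smul_right, h.diag,
    mul_ite, mul_zero, Finset.sum_ite_eq, Finset.mem_univ, if_true]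
  simp; ring

lemma Orthonormal.norm_sq_sum {N : ℕ} {e : Fin N → E} (h : Orthonormal ℝ e) (c : Fin N → ℝ) :
    ‖∑ i, c i • e i‖ ^ 2 = ∑ i, c i ^ 2 := by
  rw [← real_inner_self_eq_norm_sq, h.inner_sum]
  simp [sq]

lemma rayleigh_nonneg {T : E →ₗ[ℝ] E} (hpos : ∀ x, 0 ≤ ⟪x, T x⟫_ℝ) (V : Submodule ℝ E) :
    0 ≤ sSup {s : ℝ | ∃ φ ∈ V, φ ≠ 0 ∧ s = ⟪φ, T φ⟫_ℝ / ‖φ‖ ^ 2} := by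
  apply Real.sSup_nonneg
  rintro s ⟨φ, -, -, rfl⟩
  exact div_nonneg (hpos φ) (sq_nonneg _)

lemma minMax_bddBelow {T : E →ₗ[ℝ] E} (hpos : ∀ x, 0 ≤ ⟪x, T x⟫_ℝ) (m : ℕ) :
    BddBelow {r : ℝ | ∃ V : Submodule ℝ E, Module.finrank ℝ V = m ∧
      r = sSup {s : ℝ | ∃ φ ∈ V, φ ≠ 0 ∧ s = ⟪φ, T φ⟫_ℝ / ‖φ‖ ^ 2}} := by
  refine ⟨0, ?_⟩
  rintro r ⟨V, -, rfl⟩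
  exact rayleigh_nonneg hpos V

/-- A finite dimensional subspace on which the Rayleigh quotient is bounded bounds the min-max
value. -/
lemma minMax_le {T : E →ₗ[ℝ] E} (hpos : ∀ x, 0 ≤ ⟪x, T x⟫_ℝ) {m : ℕ} {e : Fin m → E}
    {ν : Fin m → ℝ} (h : IsRitz T e ν) {c : ℝ} (hc : 0 ≤ c) (hν : ∀ i, ν i ≤ c) :
    minMax T m ≤ c := by
  refine (csInf_le (minMax_bddBelow hpos m)
    ⟨Submodule.span ℝ (Set.range e), ?_, rfl⟩).trans ?_
  · rw [finrank_span_eq_card h.orthonormal.linearIndependent, Fintype.card_fin]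
  · apply Real.sSup_le _ hc
    rintro s ⟨φ, hφ, hφ0, rfl⟩
    obtain ⟨a, rfl⟩ := (Submodule.mem_span_range_iff_exists_fun ℝ).1 hφ
    rw [div_le_iff₀ (by positivity), h.inner_sum, h.orthonormal.norm_sq_sum, Finset.mul_sum]
    exact Finset.sum_le_sum fun i _ => mul_le_mul_of_nonneg_right (hν i) (sq_nonneg _)

lemma IsRitz.castLE {T : E →ₗ[ℝ] E} {N m : ℕ} {e : Fin N → E} {ν : Fin N → ℝ}
    (h : IsRitz T e ν) (hm : m ≤ N) : IsRitz T (e ∘ Fin.castLE hm) (ν ∘ Fin.castLE hm) := by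
  refine ⟨h.orthonormal.comp _ (Fin.castLE_injective hm), fun i j => ?_, fun i j hij => ?_⟩
  · simp [h.diag]
  · exact h.mono (by simpa using hij)

lemma IsRitz.nonneg {T : E →ₗ[ℝ] E} (hpos : ∀ x, 0 ≤ ⟪x, T x⟫_ℝ) {N : ℕ} {e : Fin N → E}
    {ν : Fin N → ℝ} (h : IsRitz T e ν) (i : Fin N) : 0 ≤ ν i := by
  simpa [h.diag] using hpos (e i)

lemma IsRitz.minMax_le {T : E →ₗ[ℝ] E} (hpos : ∀ x, 0 ≤ ⟪x, T x⟫_ℝ) {N : ℕ} {e : Fin N → E}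
    {ν : Fin N → ℝ} (h : IsRitz T e ν) (i : Fin N) : minMax T (i + 1) ≤ ν i := by
  refine _root_.minMax_le hpos (h.castLE (show (i : ℕ) + 1 ≤ N from i.2)) (h.nonneg hpos i) ?_
  intro j
  exact h.mono (by rw [Fin.le_def]; simpa using Nat.lt_succ_iff.1 j.2)

/-- The Rayleigh quotient on a finite dimensional space is bounded by its supremum. -/
lemma inner_le_sSup {T : E →ₗ[ℝ] E} (hT : T.IsSymmetric)
    (V : Submodule ℝ E) [FiniteDimensional ℝ V] {φ : E} (hφ : φ ∈ V) :
    ⟪φ, T φ⟫_ℝ ≤ sSup {s : ℝ | ∃ φ ∈ V, φ ≠ 0 ∧ s = ⟪φ, T φ⟫_ℝ / ‖φ‖ ^ 2} * ‖φ‖ ^ 2 := by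
  rcases eq_or_ne φ 0 with rfl | h0
  · simp
  rw [← div_le_iff₀ (by positivity)]
  refine le_csSup ?_ ⟨φ, hφ, h0, rfl⟩
  obtain ⟨e, ν, h, hs⟩ := exists_isRitz T hT V rfl
  refine ⟨∑ i, |ν i|, ?_⟩
  rintro s ⟨ψ, hψ, hψ0, rfl⟩
  rw [← hs] at hψ
  obtain ⟨a, rfl⟩ := (Submodule.mem_span_range_iff_exists_fun ℝ).1 hψ
  rw [div_le_iff₀ (by positivity), h.inner_sum, h.orthonormal.norm_sq_sum, Finset.mul_sum]
  refine Finset.sum_le_sum fun i _ => mul_le_mul_of_nonneg_right ?_ (sq_nonneg _)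
  exact (le_abs_self _).trans
    (Finset.single_le_sum (f := fun i => |ν i|) (fun _ _ => abs_nonneg _) (Finset.mem_univ i))

lemma IsRitz.sum_le_of_orthonormal {T : E →ₗ[ℝ] E} (hT : T.IsSymmetric)
    (hpos : ∀ x, 0 ≤ ⟪x, T x⟫_ℝ) {m : ℕ} {e : Fin m → E} (he : Orthonormal ℝ e) :
    ∑ i : Fin m, minMax T (i + 1) ≤ ∑ i, ⟪e i, T (e i)⟫_ℝ := by
  have hfin : Module.finrank ℝ (Submodule.span ℝ (Set.range e)) = m := by
    rw [finrank_span_eq_card he.linearIndependent, Fintype.card_fin]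
  have hfd : FiniteDimensional ℝ (Submodule.span ℝ (Set.range e)) :=
    FiniteDimensional.span_of_finite _ (Set.finite_range _)
  obtain ⟨f, ν, h, hs⟩ := exists_isRitz T hT _ hfin
  have key : ∀ {g f : Fin m → E}, Orthonormal ℝ f →
      Submodule.span ℝ (Set.range f) = Submodule.span ℝ (Set.range g) → ∀ i,
      g i = ∑ j, ⟪f j, g i⟫_ℝ • f j := by
    intro g f hf hfg i
    have : g i ∈ Submodule.span ℝ (Set.range f) := by
      rw [hfg]; exact Submodule.subset_span ⟨i, rfl⟩
    obtain ⟨a, ha⟩ := (Submodule.mem_span_range_iff_exists_fun ℝ).1 this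
    have hj : ∀ j, ⟪f j, g i⟫_ℝ = a j := by
      intro j
      rw [← ha, hf.inner_right_fintype]
    simp only [hj, ha]
  have h1 : ∀ i, ⟪e i, T (e i)⟫_ℝ = ∑ j, ν j * ⟪f j, e i⟫_ℝ ^ 2 := by
    intro i
    rw [← h.inner_sum, ← key h.orthonormal hs]
  have h2 : ∀ j, ∑ i, ⟪f j, e i⟫_ℝ ^ 2 = 1 := by
    intro j
    simp only [real_inner_comm]
    rw [← he.norm_sq_sum, ← key he hs.symm, h.orthonormal.1 j, one_pow]
  simp only [h1]
  rw [Finset.sum_comm]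
  simp only [← Finset.mul_sum, h2, mul_one]
  exact Finset.sum_le_sum fun i _ => h.minMax_le hpos i

lemma exists_ritz_le {T : E →ₗ[ℝ] E} (hT : T.IsSymmetric)
    (hinf : ¬ FiniteDimensional ℝ E) (k : ℕ) {ε : ℝ} (hε : 0 < ε) :
    ∃ (u : Fin k → E) (ν : Fin k → ℝ), IsRitz T u ν ∧ ∀ i : Fin k, ν i ≤ minMax T (i + 1) + ε := by
  have hV : ∀ i : Fin k, ∃ V : Submodule ℝ E, Module.finrank ℝ V = (i : ℕ) + 1 ∧
      sSup {s : ℝ | ∃ φ ∈ V, φ ≠ 0 ∧ s = ⟪φ, T φ⟫_ℝ / ‖φ‖ ^ 2} < minMax T (i + 1) + ε := by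
    intro i
    have hne : {r : ℝ | ∃ V : Submodule ℝ E, Module.finrank ℝ V = (i : ℕ) + 1 ∧
        r = sSup {s : ℝ | ∃ φ ∈ V, φ ≠ 0 ∧ s = ⟪φ, T φ⟫_ℝ / ‖φ‖ ^ 2}}.Nonempty := by
      have : ∃ V : Submodule ℝ E, Module.finrank ℝ V = (i : ℕ) + 1 := by
        have hr : ((((i : ℕ) + 1 : ℕ)) : Cardinal) ≤ Module.rank ℝ E := by
          refine (Cardinal.natCast_lt_aleph0).le.trans ?_
          by_contra hlt
          exact hinf (Module.rank_lt_aleph0_iff.1 (not_le.1 hlt))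
        obtain ⟨s, hs, hli⟩ := le_rank_iff_exists_linearIndependent_finset.1 hr
        refine ⟨Submodule.span ℝ (s : Set E), ?_⟩
        rw [finrank_span_finset_eq_card hli, hs]
      obtain ⟨V, hV⟩ := this
      exact ⟨_, V, hV, rfl⟩
    obtain ⟨r, ⟨V, hV, rfl⟩, hr⟩ := exists_lt_of_csInf_lt hne
      (show sInf _ < minMax T (i + 1) + ε from lt_add_of_pos_right _ hε)
    exact ⟨V, hV, hr⟩
  choose V hV1 hV2 using hV
  have hVf : ∀ i, FiniteDimensional ℝ (V i) := fun i =>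
    Module.finite_of_finrank_pos (by rw [hV1]; omega)
  obtain ⟨N, hN⟩ : ∃ N, Module.finrank ℝ (⨆ i, V i : Submodule ℝ E) = N := ⟨_, rfl⟩
  obtain ⟨e, ν, h, hs⟩ := exists_isRitz T hT (⨆ i, V i) hN
  have hle : ∀ i, V i ≤ ⨆ i, V i := le_iSup V
  have hkN : k ≤ N := by
    rcases Nat.eq_zero_or_pos k with hk | hk
    · omega
    · have := Submodule.finrank_mono (hle ⟨k - 1, by omega⟩)
      rw [hV1] at this
      simp only at this
      omega
  refine ⟨_, _, h.castLE hkN, fun i => ?_⟩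
  -- the span of the high Ritz vectors meets `V i`
  let U := Submodule.span ℝ (Set.range fun j : {j : Fin N // (i : ℕ) ≤ (j : ℕ)} => e j)
  have hU : Module.finrank ℝ U = N - i := by
    have hli := h.orthonormal.linearIndependent.comp
      (Subtype.val : {j : Fin N // (i : ℕ) ≤ (j : ℕ)} → Fin N)
      Subtype.val_injective
    rw [show Module.finrank ℝ U = _ from finrank_span_eq_card hli]
    have : Fintype.card {j : Fin N // ¬ (j : ℕ) < i} = Fintype.card (Fin N) - Fintype.card
      {j : Fin N // (j : ℕ) < i} := Fintype.card_subtype_compl _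
    simp only [not_lt] at this
    rw [this, Fintype.card_fin]
    congr 1
    rw [Fintype.card_subtype, Fin.card_filter_val_lt]
    omega
  have hUle : U ≤ ⨆ i, V i := by
    rw [← hs]
    exact Submodule.span_mono (by rintro _ ⟨j, rfl⟩; exact ⟨_, rfl⟩)
  have hUf : FiniteDimensional ℝ U := FiniteDimensional.span_of_finite _ (Set.finite_range _)
  have hne : V i ⊓ U ≠ ⊥ := by
    intro hbot
    have h1 := Submodule.finrank_sup_add_finrank_inf_eq (V i) U
    rw [hbot, finrank_bot, hV1, hU] at h1
    have h2 := Submodule.finrank_mono (sup_le (hle i) hUle)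
    have := i.2
    omega
  obtain ⟨φ, hφ, hφ0⟩ := Submodule.exists_mem_ne_zero_of_ne_bot hne
  have h1 := inner_le_sSup hT (V i) hφ.1
  have h2 : ν (Fin.castLE hkN i) * ‖φ‖ ^ 2 ≤ ⟪φ, T φ⟫_ℝ := by
    obtain ⟨a, ha⟩ := (Submodule.mem_span_range_iff_exists_fun ℝ).1 hφ.2
    let c : Fin N → ℝ := fun j => if hj : (i : ℕ) ≤ j then a ⟨j, hj⟩ else 0
    have hc : φ = ∑ j, c j • e j := by
      rw [← ha, ← Finset.sum_filter_add_sum_filter_not Finset.univ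
        (fun j : Fin N => (i : ℕ) ≤ (j : ℕ)) (fun j => c j • e j)]
      have : ∑ j ∈ Finset.univ.filter (fun j : Fin N => ¬ (i : ℕ) ≤ (j : ℕ)), c j • e j = 0 :=
        Finset.sum_eq_zero fun j hj => by
          simp only [Finset.mem_filter, Finset.mem_univ, true_and] at hj
          simp [c, hj]
      rw [this, add_zero, ← Finset.sum_subtype_eq_sum_filter]
      simp only [Finset.subtype_univ]
      exact Finset.sum_congr rfl fun j _ => by simp [c, j.2]
    rw [hc, h.inner_sum, h.orthonormal.norm_sq_sum, Finset.mul_sum]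
    refine Finset.sum_le_sum fun j _ => ?_
    by_cases hj : (i : ℕ) ≤ j
    · exact mul_le_mul_of_nonneg_right (h.mono (by rw [Fin.le_def]; simpa using hj)) (sq_nonneg _)
    · simp [c, hj]
  have hφp : 0 < ‖φ‖ ^ 2 := by positivity
  exact (le_of_mul_le_mul_right (h2.trans h1) hφp).trans (hV2 i).le

/-- Approximate eigenvectors for the min-max values. -/
lemma exists_approx_eigen {T : E →ₗ[ℝ] E} (hT : T.IsSymmetric) (hpos : ∀ x, 0 ≤ ⟪x, T x⟫_ℝ)
    (hinf : ¬ FiniteDimensional ℝ E) (k : ℕ) {ε : ℝ} (hε : 0 < ε) :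
    ∃ (u : Fin k → E) (ν : Fin k → ℝ), IsRitz T u ν ∧
      (∀ i : Fin k, minMax T (i + 1) ≤ ν i ∧ ν i ≤ minMax T (i + 1) + ε) ∧
      ∀ ψ, (∀ i, ⟪u i, ψ⟫_ℝ = 0) → (minMax T (k + 1) - ε) * ‖ψ‖ ^ 2 ≤ ⟪ψ, T ψ⟫_ℝ ∧
        ∀ i, 2 * |⟪u i, T ψ⟫_ℝ| ≤ √ε * (⟪ψ, T ψ⟫_ℝ + ε * ‖ψ‖ ^ 2 + 1) := by
  obtain ⟨u, ν, h, hν⟩ := exists_ritz_le hT hinf k (ε := ε / (k + 1)) (by positivity)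
  have hkε : ε / (k + 1) ≤ ε := div_le_self hε.le (by linarith [(Nat.cast_nonneg k : (0:ℝ) ≤ k)])
  have htot : ∑ i, ν i ≤ ∑ i : Fin k, minMax T (i + 1) + ε := by
    refine (Finset.sum_le_sum fun i _ => hν i).trans ?_
    rw [Finset.sum_add_distrib]
    simp only [Finset.sum_const, Finset.card_univ, Fintype.card_fin, nsmul_eq_mul]
    have : (k : ℝ) * (ε / (k + 1)) ≤ ε := by
      rw [← mul_div_assoc, div_le_iff₀ (by positivity)]; nlinarith
    linarith
  have hdiag : ∀ i, ⟪u i, T (u i)⟫_ℝ = ν i := fun i => by simp [h.diag]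
  refine ⟨u, ν, h, fun i => ⟨h.minMax_le hpos i, (hν i).trans (by linarith)⟩, fun ψ hψ => ⟨?_, ?_⟩⟩
  · rcases eq_or_ne ψ 0 with rfl | h0
    · simp
    have hn : ‖ψ‖ ≠ 0 := norm_ne_zero_iff.2 h0
    let e : Fin (k + 1) → E := Fin.snoc u (‖ψ‖⁻¹ • ψ)
    have he : Orthonormal ℝ e := by
      rw [orthonormal_iff_ite]
      have hu := orthonormal_iff_ite.1 h.orthonormal
      intro i j
      refine Fin.lastCases ?_ (fun i => ?_) i <;> refine Fin.lastCases ?_ (fun j => ?_) j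
      · simp only [e, Fin.snoc_last, inner_smul_left, inner_smul_right,
          real_inner_self_eq_norm_sq, if_true]
        simp; field_simp
      · simp only [e, Fin.snoc_last, Fin.snoc_castSucc, inner_smul_left]
        rw [real_inner_comm, hψ, if_neg (Fin.castSucc_lt_last j).ne', mul_zero]
      · simp only [e, Fin.snoc_last, Fin.snoc_castSucc, inner_smul_right]
        rw [hψ, if_neg (Fin.castSucc_lt_last i).ne, mul_zero]
      · simp [e, hu]
    have := IsRitz.sum_le_of_orthonormal hT hpos he
    rw [Fin.sum_univ_castSucc, Fin.sum_univ_castSucc] at this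
    simp only [e, Fin.snoc_last, Fin.snoc_castSucc, hdiag, Fin.val_castSucc, Fin.val_last,
      map_smul, inner_smul_left, inner_smul_right] at this
    have h2 : minMax T (k + 1) - ε ≤ ⟪ψ, T ψ⟫_ℝ / ‖ψ‖ ^ 2 := by
      have e1 : ‖ψ‖⁻¹ * ((starRingEnd ℝ) ‖ψ‖⁻¹ * ⟪ψ, T ψ⟫_ℝ) = ⟪ψ, T ψ⟫_ℝ / ‖ψ‖ ^ 2 := by
        simp; field_simp
      rw [e1] at this
      linarith
    rwa [le_div_iff₀ (by positivity)] at h2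
  · intro i
    have key : ∀ s : ℝ, 0 ≤ 2 * s * ⟪u i, T ψ⟫_ℝ + s ^ 2 * (⟪ψ, T ψ⟫_ℝ + ε * ‖ψ‖ ^ 2) + ε := by
      intro s
      set w := u i + s • ψ with hw
      have hun : ‖u i‖ = 1 := h.orthonormal.1 i
      have hwn : ‖w‖ ^ 2 = 1 + s ^ 2 * ‖ψ‖ ^ 2 := by
        rw [← real_inner_self_eq_norm_sq, hw]
        simp only [inner_add_left, inner_add_right, inner_smul_left, inner_smul_right,
          real_inner_comm (u i) ψ, hψ i, real_inner_self_eq_norm_sq, hun]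
        simp; ring
      have hw0 : 0 < ‖w‖ ^ 2 := by rw [hwn]; positivity
      have hwn0 : ‖w‖ ≠ 0 := by intro h0; rw [h0] at hw0; simp at hw0
      let e : Fin k → E := Function.update u i (‖w‖⁻¹ • w)
      have huo := orthonormal_iff_ite.1 h.orthonormal
      have huw : ∀ j, j ≠ i → ⟪u j, w⟫_ℝ = 0 := by
        intro j hj
        rw [hw, inner_add_right, inner_smul_right, hψ, huo, if_neg hj]; simp
      have he : Orthonormal ℝ e := by
        rw [orthonormal_iff_ite]
        intro a b
        by_cases ha : a = i <;> by_cases hb : b = i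
        · subst ha hb
          simp only [e, Function.update_self, inner_smul_left, inner_smul_right,
            real_inner_self_eq_norm_sq, if_true]
          simp; field_simp
        · subst ha
          simp only [e, Function.update_self, Function.update_of_ne hb, inner_smul_left]
          rw [real_inner_comm, huw b hb, if_neg (Ne.symm hb), mul_zero]
        · subst hb
          simp only [e, Function.update_self, Function.update_of_ne ha, inner_smul_right]
          rw [huw a ha, if_neg ha, mul_zero]
        · simp only [e, Function.update_of_ne ha, Function.update_of_ne hb, huo]
      have := IsRitz.sum_le_of_orthonormal hT hpos he
      rw [← Finset.add_sum_erase _ (fun i => ⟪e i, T (e i)⟫_ℝ) (Finset.mem_univ i)] at this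
      have e2 : ∑ j ∈ Finset.univ.erase i, ⟪e j, T (e j)⟫_ℝ = ∑ j, ν j - ν i := by
        rw [← Finset.add_sum_erase _ ν (Finset.mem_univ i), add_sub_cancel_left]
        refine Finset.sum_congr rfl fun j hj => ?_
        simp only [e, Function.update_of_ne (Finset.ne_of_mem_erase hj), hdiag]
      have e3 : ⟪e i, T (e i)⟫_ℝ = ⟪w, T w⟫_ℝ / ‖w‖ ^ 2 := by
        simp only [e, Function.update_self, map_smul, inner_smul_left, inner_smul_right]
        simp; field_simp
      have e4 : ⟪w, T w⟫_ℝ = ν i + 2 * s * ⟪u i, T ψ⟫_ℝ + s ^ 2 * ⟪ψ, T ψ⟫_ℝ := by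
        have : ⟪ψ, T (u i)⟫_ℝ = ⟪u i, T ψ⟫_ℝ := by rw [← hT, real_inner_comm]
        simp only [hw, map_add, map_smul, inner_add_left, inner_add_right, inner_smul_left,
          inner_smul_right, hdiag, this]
        simp; ring
      rw [e2, e3] at this
      have h5 : ν i - ε ≤ ⟪w, T w⟫_ℝ / ‖w‖ ^ 2 := by linarith
      rw [le_div_iff₀ hw0, hwn, e4] at h5
      have h6 : 0 ≤ ν i * (s ^ 2 * ‖ψ‖ ^ 2) :=
        mul_nonneg (h.nonneg hpos i) (by positivity)
      nlinarith
    have hs : √ε ^ 2 = ε := Real.sq_sqrt hε.le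
    have hsp : 0 < √ε := Real.sqrt_pos.2 hε
    have k1 := key (√ε)
    have k2 := key (-√ε)
    rw [neg_sq] at k2
    have h0 := hpos ψ
    rw [← abs_two, ← abs_mul, abs_le]
    constructor <;> refine le_of_mul_le_mul_left ?_ hsp <;> nlinarith

end MinMax

section Form

variable {E : Type*} [AddCommGroup E] [Module ℝ E]

/-- The min-max values of an operator with respect to a bilinear form. -/
noncomputable def formMinMax (B : E →ₗ[ℝ] E →ₗ[ℝ] ℝ) (T : E →ₗ[ℝ] E) (m : ℕ) : ℝ :=
  sInf {r : ℝ | ∃ V : Submodule ℝ E, Module.finrank ℝ V = m ∧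
    r = sSup {s : ℝ | ∃ φ ∈ V, φ ≠ 0 ∧ s = B φ (T φ) / B φ φ}}

/-- Approximate eigenvectors for the min-max values of an operator with respect to a positive
definite form. -/
lemma exists_approx_eigen_form {B : E →ₗ[ℝ] E →ₗ[ℝ] ℝ} {T : E →ₗ[ℝ] E}
    (hsymm : ∀ x y, B x y = B y x) (hB : ∀ x, 0 ≤ B x x) (hdef : ∀ x, B x x = 0 → x = 0)
    (hT : ∀ x y, B (T x) y = B x (T y)) (hpos : ∀ x, 0 ≤ B x (T x))
    (hinf : ¬ FiniteDimensional ℝ E) (k : ℕ) {ε : ℝ} (hε : 0 < ε) :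
    ∃ (u : Fin k → E) (ν : Fin k → ℝ),
      Monotone ν ∧ (∀ i j, B (u i) (u j) = if i = j then 1 else 0) ∧
      (∀ i j, B (u i) (T (u j)) = if i = j then ν i else 0) ∧
      (∀ i : Fin k, formMinMax B T (i + 1) ≤ ν i ∧ ν i ≤ formMinMax B T (i + 1) + ε) ∧
      ∀ ψ, (∀ i, B (u i) ψ = 0) → (formMinMax B T (k + 1) - ε) * B ψ ψ ≤ B ψ (T ψ) ∧
        ∀ i, 2 * |B (u i) (T ψ)| ≤ √ε * (B ψ (T ψ) + ε * B ψ ψ + 1) := by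
  let core : InnerProductSpace.Core ℝ E :=
    { inner := fun x y => B x y
      conj_inner_symm := fun x y => by simpa using hsymm y x
      re_inner_nonneg := fun x => by simpa using hB x
      add_left := fun x y z => by simp
      smul_left := fun x y r => by simp
      definite := fun x hx => hdef x hx }
  let _ : NormedAddCommGroup E := core.toNormedAddCommGroup
  let _ : InnerProductSpace ℝ E := InnerProductSpace.ofCore core.toCore
  have hin : ∀ x y : E, inner ℝ x y = B x y := fun _ _ => rfl
  have hno : ∀ x : E, ‖x‖ ^ 2 = B x x := fun x => by
    rw [← real_inner_self_eq_norm_sq, hin]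
  have hmm : ∀ m, minMax T m = formMinMax B T m := fun m => by
    simp only [minMax, formMinMax, hno, hin]
  obtain ⟨u, ν, h1, h2, h3⟩ := exists_approx_eigen (T := T)
    (fun x y => by simp only [hin]; exact hT x y) (fun x => by rw [hin]; exact hpos x) hinf k hε
  simp only [hin, hno, hmm] at h2 h3
  refine ⟨u, ν, h1.mono, fun i j => ?_, fun i j => ?_, h2, h3⟩
  · rw [← hin]; exact orthonormal_iff_ite.1 h1.orthonormal i j
  · rw [← hin]; exact h1.diag i j

lemma formMinMax_mono {B : E →ₗ[ℝ] E →ₗ[ℝ] ℝ} {T : E →ₗ[ℝ] E}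
    (hsymm : ∀ x y, B x y = B y x) (hB : ∀ x, 0 ≤ B x x) (hdef : ∀ x, B x x = 0 → x = 0)
    (hT : ∀ x y, B (T x) y = B x (T y)) (hpos : ∀ x, 0 ≤ B x (T x))
    (hinf : ¬ FiniteDimensional ℝ E) {i j : ℕ} (hij : i ≤ j) :
    formMinMax B T (i + 1) ≤ formMinMax B T (j + 1) := by
  refine le_of_forall_pos_le_add fun ε hε => ?_
  obtain ⟨u, ν, hm, -, -, h, -⟩ := exists_approx_eigen_form hsymm hB hdef hT hpos hinf (j + 1) hε
  exact ((h ⟨i, by omega⟩).1.trans (hm (show (⟨i, by omega⟩ : Fin (j + 1)) ≤ ⟨j, by omega⟩ from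
    hij))).trans (h ⟨j, by omega⟩).2

end Form

section Weyl

variable {E : Type*} [AddCommGroup E] [Module ℝ E] {n : ℕ}

/-- A positive definite form together with skew-symmetric commuting derivations `D p` and bounded
symmetric operators `X p` satisfying the canonical commutation relations. -/
structure IsWeyl (I : E →ₗ[ℝ] E →ₗ[ℝ] ℝ) (D X : Fin n → E →ₗ[ℝ] E) (R : ℝ) : Prop where
  symm : ∀ f g, I f g = I g f
  nonneg : ∀ f, 0 ≤ I f f
  definite : ∀ f, I f f = 0 → f = 0
  D_skew : ∀ p f g, I (D p f) g = -I f (D p g)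
  X_symm : ∀ p f g, I (X p f) g = I f (X p g)
  comm : ∀ p q f, D p (X q f) = X q (D p f) + if p = q then f else 0
  D_comm : ∀ p q f, D p (D q f) = D q (D p f)
  X_bdd : ∀ p f, I (X p f) (X p f) ≤ R * I f f

/-- The operator `-∑ D p ^ 2`. -/
def weylLap (D : Fin n → E →ₗ[ℝ] E) : E →ₗ[ℝ] E := -∑ p, D p ∘ₗ D p

variable {I : E →ₗ[ℝ] E →ₗ[ℝ] ℝ} {D X : Fin n → E →ₗ[ℝ] E} {R : ℝ}

local notation "L" => weylLap D

lemma weylLap_apply (f : E) : L f = -∑ p, D p (D p f) := by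
  simp [weylLap]

namespace IsWeyl

lemma inner_lap (h : IsWeyl I D X R) (f g : E) : I f (L g) = ∑ p, I (D p f) (D p g) := by
  simp [weylLap_apply, h.D_skew, map_sum]

lemma lap_symm (h : IsWeyl I D X R) (f g : E) : I (L f) g = I f (L g) := by
  rw [h.symm, h.inner_lap, h.inner_lap]
  exact Finset.sum_congr rfl fun p _ => h.symm _ _

lemma pow_symm (h : IsWeyl I D X R) (s : ℕ) (f g : E) : I ((L ^ s) f) g = I f ((L ^ s) g) := by
  induction s generalizing f g with
  | zero => simp
  | succ s ih =>
    rw [pow_succ, Module.End.mul_apply, ih, h.lap_symm, ← Module.End.mul_apply, ← pow_succ,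
      ← pow_succ']

lemma D_lap (h : IsWeyl I D X R) (p : Fin n) (f : E) : D p (L f) = L (D p f) := by
  simp only [weylLap_apply, map_neg, map_sum]
  simp only [h.D_comm p]

lemma D_pow (h : IsWeyl I D X R) (p : Fin n) (s : ℕ) (f : E) :
    D p ((L ^ s) f) = (L ^ s) (D p f) := by
  induction s generalizing f with
  | zero => simp
  | succ s ih =>
    rw [pow_succ, Module.End.mul_apply, ih, h.D_lap, ← Module.End.mul_apply, ← pow_succ]

lemma lap_X (h : IsWeyl I D X R) (p : Fin n) (f : E) :
    L (X p f) = X p (L f) - (2 : ℝ) • D p f := by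
  have : ∀ q, D q (D q (X p f)) = X p (D q (D q f)) + if q = p then (2 : ℝ) • D q f else 0 := by
    intro q
    rw [h.comm, map_add, h.comm]
    split_ifs with hq
    · rw [two_smul, add_assoc]
    · simp
  simp only [weylLap_apply, this, Finset.sum_add_distrib, Finset.sum_ite_eq', Finset.mem_univ,
    if_true, map_neg, map_sum]
  abel

lemma pow_X (h : IsWeyl I D X R) (p : Fin n) (s : ℕ) (f : E) :
    (L ^ (s + 1)) (X p f) = X p ((L ^ (s + 1)) f) - (2 * (s + 1) : ℝ) • D p ((L ^ s) f) := by
  induction s with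
  | zero => simp [h.lap_X]
  | succ s ih =>
    have e : ∀ s g, L ((L ^ s) g) = (L ^ (s + 1)) g := fun s g => by
      rw [pow_succ', Module.End.mul_apply]
    rw [← e, ih, map_sub, h.lap_X, map_smul, ← h.D_lap, e, e]
    push_cast
    module

lemma pow_nonneg (h : IsWeyl I D X R) (s : ℕ) (f : E) : 0 ≤ I f ((L ^ s) f) := by
  induction s generalizing f with
  | zero => simpa using h.nonneg f
  | succ s ih =>
    rw [pow_succ', Module.End.mul_apply, h.inner_lap]
    exact Finset.sum_nonneg fun p _ => by rw [h.D_pow]; exact ih _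

lemma pow_succ_eq (h : IsWeyl I D X R) (s : ℕ) (f : E) :
    I f ((L ^ (s + 1)) f) = ∑ p, I (D p f) ((L ^ s) (D p f)) := by
  rw [pow_succ', Module.End.mul_apply, h.inner_lap]
  simp only [h.D_pow]

lemma convex (h : IsWeyl I D X R) (s : ℕ) (ρ : ℝ) (f : E) :
    0 ≤ I f ((L ^ (s + 2)) f) - 2 * ρ * I f ((L ^ (s + 1)) f) + ρ ^ 2 * I f ((L ^ s) f) := by
  have h1 := h.pow_nonneg s (L f - ρ • f)
  have e1 : (L ^ s) (L f) = (L ^ (s + 1)) f := by rw [pow_succ, Module.End.mul_apply]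
  have e2 : I (L f) ((L ^ (s + 1)) f) = I f ((L ^ (s + 2)) f) := by
    rw [h.lap_symm, ← Module.End.mul_apply, ← pow_succ']
  have e3 : I (L f) ((L ^ s) f) = I f ((L ^ (s + 1)) f) := by
    rw [h.lap_symm, ← Module.End.mul_apply, ← pow_succ']
  simp only [map_sub, map_smul, LinearMap.sub_apply, LinearMap.smul_apply, smul_eq_mul, e1, e2,
    e3] at h1
  linarith

/-- Poincaré inequality. -/
lemma poincare (h : IsWeyl I D X R) (p : Fin n) (f : E) : I f f ≤ 4 * R * I (D p f) (D p f) := by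
  rcases eq_or_ne f 0 with rfl | h0
  · simp
  have hpos : 0 < I f f := lt_of_le_of_ne (h.nonneg f) fun h1 => h0 (h.definite f h1.symm)
  have e1 : I f f = -2 * I (D p f) (X p f) := by
    have h1 := h.D_skew p (X p f) f
    rw [h.comm, if_pos rfl, map_add, LinearMap.add_apply, h.X_symm, h.symm (X p f)] at h1
    linarith
  have e2 := h.nonneg (X p f + (2 * R) • D p f)
  have e3 := h.X_bdd p f
  simp only [map_add, map_smul, LinearMap.add_apply, LinearMap.smul_apply, smul_eq_mul,
    h.symm (X p f) (D p f)] at e2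
  have hR : 0 ≤ R := by
    by_contra hR
    have := h.nonneg (X p f)
    nlinarith
  have hR' : 0 < R := by
    rcases hR.lt_or_eq with h1 | h1
    · exact h1
    · exfalso
      subst h1
      have h2 : X p f = 0 := h.definite _ (le_antisymm (by linarith) (h.nonneg _))
      rw [h2] at e1
      simp at e1
      linarith
  nlinarith

lemma le_lap (h : IsWeyl I D X R) (hR : 0 ≤ R) (hn : 0 < n) (f : E) :
    I f f ≤ 4 * R * I f (L f) := by
  refine (h.poincare ⟨0, hn⟩ f).trans (mul_le_mul_of_nonneg_left ?_ (by linarith))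
  rw [h.inner_lap]
  exact Finset.single_le_sum (f := fun p => I (D p f) (D p f)) (fun p _ => h.nonneg _)
    (Finset.mem_univ _)

lemma infinite (h : IsWeyl I D X R) (hn : 0 < n) [Nontrivial E] : ¬ FiniteDimensional ℝ E := by
  intro hfd
  have h1 : D ⟨0, hn⟩ * X ⟨0, hn⟩ = X ⟨0, hn⟩ * D ⟨0, hn⟩ + 1 := by
    ext f
    simp [h.comm]
  have h2 := congrArg (LinearMap.trace ℝ E) h1
  rw [map_add, LinearMap.trace_mul_comm, LinearMap.trace_one] at h2
  have h3 : (0 : ℝ) < Module.finrank ℝ E := by exact_mod_cast Module.finrank_pos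
  linarith

lemma pow_add_le (h : IsWeyl I D X R) (s : ℕ) (f g : E) :
    I (f + g) ((L ^ s) (f + g)) ≤ 2 * I f ((L ^ s) f) + 2 * I g ((L ^ s) g) := by
  have h1 := h.pow_nonneg s (f - g)
  simp only [map_add, map_sub, LinearMap.add_apply, LinearMap.sub_apply] at h1 ⊢
  linarith

lemma exists_pow_X_le (h : IsWeyl I D X R) (hR : 0 ≤ R) (s : ℕ) :
    ∃ C : ℝ, 0 ≤ C ∧ ∀ p f, I (X p f) ((L ^ s) (X p f)) ≤
      C * ∑ t ∈ Finset.range (s + 1), I f ((L ^ t) f) := by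
  induction s with
  | zero => exact ⟨R, hR, fun p f => by simpa using h.X_bdd p f⟩
  | succ s ih =>
    obtain ⟨C, hC, ih⟩ := ih
    refine ⟨2 * C + 2, by linarith, fun p f => ?_⟩
    have e1 : ∀ q, I (D q (X p f)) ((L ^ s) (D q (X p f))) ≤
        2 * (C * ∑ t ∈ Finset.range (s + 1), I (D q f) ((L ^ t) (D q f))) +
          if q = p then 2 * I f ((L ^ s) f) else 0 := by
      intro q
      rw [h.comm]
      refine (h.pow_add_le _ _ _).trans
        (add_le_add (mul_le_mul_of_nonneg_left (ih p _) (by simp)) ?_)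
      split_ifs <;> simp
    have e2 : ∑ t ∈ Finset.range (s + 1), I f ((L ^ (t + 1)) f) ≤
        ∑ t ∈ Finset.range (s + 1 + 1), I f ((L ^ t) f) := by
      rw [Finset.sum_range_succ' _ (s + 1)]
      exact le_add_of_nonneg_right (h.pow_nonneg 0 f)
    have e3 : I f ((L ^ s) f) ≤ ∑ t ∈ Finset.range (s + 1 + 1), I f ((L ^ t) f) :=
      Finset.single_le_sum (f := fun t => I f ((L ^ t) f)) (fun t _ => h.pow_nonneg t f)
        (Finset.mem_range.2 (by omega))
    have e4 : ∑ q, ∑ t ∈ Finset.range (s + 1), I (D q f) ((L ^ t) (D q f)) =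
        ∑ t ∈ Finset.range (s + 1), I f ((L ^ (t + 1)) f) := by
      rw [Finset.sum_comm]
      exact Finset.sum_congr rfl fun t _ => (h.pow_succ_eq t f).symm
    calc I (X p f) ((L ^ (s + 1)) (X p f))
        = ∑ q, I (D q (X p f)) ((L ^ s) (D q (X p f))) := h.pow_succ_eq s _
      _ ≤ ∑ q, (2 * (C * ∑ t ∈ Finset.range (s + 1), I (D q f) ((L ^ t) (D q f))) +
          if q = p then 2 * I f ((L ^ s) f) else 0) := Finset.sum_le_sum fun q _ => e1 q
      _ = 2 * C * ∑ t ∈ Finset.range (s + 1), I f ((L ^ (t + 1)) f) + 2 * I f ((L ^ s) f) := by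
        rw [Finset.sum_add_distrib, ← Finset.mul_sum, ← Finset.mul_sum, e4,
          Finset.sum_ite_eq' Finset.univ p, if_pos (Finset.mem_univ p)]
        ring
      _ ≤ _ := by
        have := mul_le_mul_of_nonneg_left e2 hC
        linarith

lemma sum_X_D (h : IsWeyl I D X R) (s : ℕ) (f : E) :
    ∑ p, I (X p f) (D p ((L ^ s) f)) = -((n + 2 * s) / 2) * I f ((L ^ s) f) := by
  have key : ∀ p, I (X p f) (D p ((L ^ s) f)) = -I f ((L ^ s) f) - I (X p f) (D p ((L ^ s) f)) -
      2 * s * I f (-D p (D p ((L ^ (s - 1)) f))) := by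
    intro p
    have e1 : I (X p f) (D p ((L ^ s) f)) = -I (D p (X p f)) ((L ^ s) f) := by
      rw [h.D_skew]; simp
    have e2 : I (X p (D p f)) ((L ^ s) f) = I ((L ^ s) (X p (D p f))) f := by
      rw [h.symm, h.symm _ f, h.pow_symm]
    have e3 : I (X p ((L ^ s) (D p f))) f = I (X p f) (D p ((L ^ s) f)) := by
      rw [h.symm, ← h.X_symm, h.D_pow]
    rcases s with _ | s
    · rw [e1, h.comm, if_pos rfl]
      simp only [map_add, LinearMap.add_apply]
      simp only [pow_zero, Module.End.one_apply] at e1 e2 e3 ⊢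
      have := h.D_skew p (X p f) f
      rw [h.comm, if_pos rfl] at this
      simp only [map_add, LinearMap.add_apply] at this
      simp
      linarith
    · rw [h.pow_X] at e2
      rw [Nat.add_sub_cancel]
      simp only [map_sub, map_smul, LinearMap.sub_apply, LinearMap.smul_apply, smul_eq_mul,
        e3] at e2
      rw [h.comm, if_pos rfl] at e1
      simp only [map_add, LinearMap.add_apply] at e1
      rw [← h.D_pow, h.symm _ f] at e2
      push_cast
      simp only [map_neg]
      linarith
  have h2 := Finset.sum_congr rfl fun p (_ : p ∈ Finset.univ) => key p
  rw [Finset.sum_sub_distrib, Finset.sum_sub_distrib, ← Finset.mul_sum, ← map_sum,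
    Finset.sum_neg_distrib, Finset.sum_neg_distrib, ← weylLap_apply] at h2
  have h3 : (s : ℝ) * I f (L ((L ^ (s - 1)) f)) = s * I f ((L ^ s) f) := by
    rcases s with _ | s
    · simp
    · rw [Nat.add_sub_cancel, ← Module.End.mul_apply, ← pow_succ']
  simp only [Finset.sum_const, Finset.card_univ, Fintype.card_fin, nsmul_eq_mul] at h2
  linarith

lemma X_pow_X (h : IsWeyl I D X R) (s : ℕ) (f : E) :
    ∑ p, I (X p f) ((L ^ (s + 1)) (X p f)) = (s + 1) * (n + 2 * s) * I f ((L ^ s) f) +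
      ∑ p, I (X p (X p f)) ((L ^ (s + 1)) f) := by
  have : ∀ p, I (X p f) ((L ^ (s + 1)) (X p f)) = I (X p (X p f)) ((L ^ (s + 1)) f) -
      2 * (s + 1) * I (X p f) (D p ((L ^ s) f)) := by
    intro p
    rw [h.pow_X, h.X_symm p (X p f), map_sub, map_smul, smul_eq_mul]
  rw [Finset.sum_congr rfl fun p _ => this p, Finset.sum_sub_distrib, ← Finset.mul_sum, h.sum_X_D]
  ring

/-- The divergence inequality. -/
lemma two_mul_sum_le (h : IsWeyl I D X R) (f : E) (ψ : Fin n → E) :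
    2 * ∑ p, I f (D p (ψ p)) ≤ I f f + ∑ p, I (ψ p) (L (ψ p)) := by
  have h1 := h.nonneg (f - ∑ p, D p (ψ p))
  have h2 : I (∑ p, D p (ψ p)) (∑ p, D p (ψ p)) ≤ ∑ p, I (ψ p) (L (ψ p)) := by
    have e1 : ∀ p q, I (D p (ψ p)) (D q (ψ q)) ≤
        (I (D q (ψ p)) (D q (ψ p)) + I (D p (ψ q)) (D p (ψ q))) / 2 := by
      intro p q
      have e2 : I (D p (ψ p)) (D q (ψ q)) = I (D q (ψ p)) (D p (ψ q)) := by
        rw [h.D_skew, h.D_comm, h.D_skew q]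
      have e3 := h.nonneg (D q (ψ p) - D p (ψ q))
      simp only [map_sub, LinearMap.sub_apply, h.symm (D p (ψ q)) (D q (ψ p))] at e3
      linarith
    simp only [map_sum, LinearMap.sum_apply, h.inner_lap]
    refine (Finset.sum_le_sum fun p _ => Finset.sum_le_sum fun q _ => e1 q p).trans ?_
    simp only [← Finset.sum_div, Finset.sum_add_distrib]
    rw [Finset.sum_comm (f := fun p q => I (D p (ψ q)) (D p (ψ q)))]
    linarith
  have h3 := h.symm (∑ p, D p (ψ p)) f
  simp only [map_sub, LinearMap.sub_apply, h3] at h1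
  simp only [← map_sum]
  linarith

end IsWeyl

end Weyl

section Moments

/-- Moment sequences of a positive operator, normalized at order `1` and with value `μ` at order
`l`. -/
structure IsMoment (l : ℕ) (μ : ℝ) (M : ℕ → ℝ) : Prop where
  nonneg : ∀ s, 0 ≤ M s
  one : M 1 = 1
  top : M l = μ
  convex : ∀ (s : ℕ) (ρ : ℝ), 0 ≤ M (s + 2) - 2 * ρ * M (s + 1) + ρ ^ 2 * M s

/-- A convex sequence lies below its chords. -/
lemma convex_seq_le {f : ℕ → ℝ} (hf : ∀ s, 0 ≤ f (s + 2) - 2 * f (s + 1) + f s) {t N : ℕ}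
    (htN : t ≤ N) : (N : ℝ) * f t ≤ (N - t) * f 0 + t * f N := by
  have hd : Monotone fun s => f (s + 1) - f s := monotone_nat_of_le_succ fun s => by
    have := hf s; linarith
  have h1 : ∀ j, j ≤ t → f j ≤ f 0 + j * (f (t + 1) - f t) := by
    intro j
    induction j with
    | zero => simp
    | succ j ih =>
      intro hj
      have := ih (by omega)
      have h2 : f (j + 1) - f j ≤ f (t + 1) - f t := hd (by omega)
      push_cast; linarith
  have h2 : ∀ j, f t + j * (f (t + 1) - f t) ≤ f (t + j) := by
    intro j
    induction j with
    | zero => simp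
    | succ j ih =>
      have h2 : f (t + 1) - f t ≤ f (t + j + 1) - f (t + j) := hd (by omega : t ≤ t + j)
      rw [← add_assoc]
      push_cast; linarith
  have h3 := h1 t le_rfl
  have h4 := h2 (N - t)
  rw [Nat.add_sub_cancel' htN, Nat.cast_sub htN] at h4
  have h5 : (0 : ℝ) ≤ N - t := by simpa using (Nat.cast_le (α := ℝ)).2 htN
  have h6 := mul_le_mul_of_nonneg_left h3 h5
  have h7 := mul_le_mul_of_nonneg_left h4 (Nat.cast_nonneg (α := ℝ) t)
  linarith

end Moments

section Weights

/-- Weights for the combination of trial-function inequalities. -/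
structure Weights where
  /-- weight of the Rayleigh quotient inequality -/
  k : ℝ
  /-- weight of the mixed product of coordinate multiples and derivatives -/
  g : ℝ
  /-- weight of the energy of the derivatives -/
  p : ℝ
  /-- weight of the pairing with derivatives -/
  q : ℝ
  /-- weight of the pairing with coordinate multiples -/
  h : ℝ
  /-- weight of the divergence inequality -/
  s : ℝ

/-- The quadratic form attached to a set of weights. -/
def Weights.form (w : Weights) (τ a d c : ℝ) : ℝ :=
  w.k * τ * a ^ 2 + 2 * w.g * a * d + w.p * d ^ 2 + w.q * d * c + w.h * a * c + w.s * c ^ 2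

/-- The value of the weighted combination in terms of moments. -/
noncomputable def Weights.total (w : Weights) (n l : ℕ) (β μ : ℝ) (M : ℕ → ℝ) : ℝ :=
  w.k * (l * (2 * l + n - 2) * M (l - 1) - n * μ * M 0) - w.g * ((n + 2) + (n + 4) * β * M 2) +
    w.p * (M 2 + 2 * β * M 3 + β ^ 2 * M 4) - w.q * (1 + β * M 2) + n / 2 * w.h * M 0 + w.s * M 0

end Weights

section Weyl

variable {E : Type*} [AddCommGroup E] [Module ℝ E] {n : ℕ} {I : E →ₗ[ℝ] E →ₗ[ℝ] ℝ}
  {D X : Fin n → E →ₗ[ℝ] E} {R : ℝ}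

local notation "L" => weylLap D

namespace IsWeyl

lemma exists_sum_X_le (h : IsWeyl I D X R) (hR : 0 ≤ R) (N : ℕ) :
    ∃ C : ℝ, 0 ≤ C ∧ ∀ p f, ∑ t ∈ Finset.range N, I (X p f) ((L ^ t) (X p f)) ≤
      C * ∑ t ∈ Finset.range N, I f ((L ^ t) f) := by
  choose C hC hX using h.exists_pow_X_le hR
  refine ⟨∑ t ∈ Finset.range N, C t, Finset.sum_nonneg fun t _ => hC t, fun p f => ?_⟩
  rw [Finset.sum_mul]
  refine Finset.sum_le_sum fun t ht => (hX t p f).trans (mul_le_mul_of_nonneg_left ?_ (hC t))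
  exact Finset.sum_le_sum_of_subset_of_nonneg
    (Finset.range_mono (Finset.mem_range.1 ht)) fun s _ _ => h.pow_nonneg s f

lemma inner_decomp (h : IsWeyl I D X R) {k : ℕ} {u : Fin k → E}
    (hu : ∀ i j, I (u i) (L (u j)) = if i = j then 1 else 0) (a b : Fin k → ℝ) {φ χ : E}
    (hφ : ∀ j, I (u j) (L φ) = 0) (hχ : ∀ j, I (u j) (L χ) = 0) :
    I (∑ j, a j • u j + φ) (L (∑ j, b j • u j + χ)) = ∑ j, a j * b j + I φ (L χ) := by
  have hφ' : ∀ j, I φ (L (u j)) = 0 := fun j => by rw [← h.lap_symm, h.symm, hφ]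
  simp only [map_add, map_sum, map_smul, LinearMap.add_apply, LinearMap.sum_apply,
    LinearMap.smul_apply, smul_eq_mul, hu, hφ', hχ, mul_zero, Finset.sum_const_zero, mul_ite,
    mul_one]
  simp [mul_comm, add_comm]

lemma inner_sub_proj (h : IsWeyl I D X R) {k : ℕ} {u : Fin k → E}
    (hu : ∀ i j, I (u i) (L (u j)) = if i = j then 1 else 0) (f : E) (i : Fin k) :
    I (u i) (L (f - ∑ j, I f (L (u j)) • u j)) = 0 := by
  simp only [map_sub, map_sum, map_smul, smul_eq_mul, hu, mul_ite, mul_one, mul_zero,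
    Finset.sum_ite_eq, Finset.mem_univ, if_true]
  rw [← h.lap_symm, h.symm, sub_self]

/-- If a quadratic form in three variables is nonnegative then so is its reduced form on vectors. -/
lemma form_vector_nonneg (h : IsWeyl I D X R) {w : Weights} {x : ℝ} (hs : 0 < w.s)
    (hrem : ∀ α d c, 0 ≤ w.form x α d c) (φ τ : E) :
    0 ≤ w.k * x * I φ (L φ) + 2 * w.g * I φ (L τ) + w.p * I τ (L τ) -
      (w.q ^ 2 * I τ (L τ) + 2 * w.q * w.h * I φ (L τ) + w.h ^ 2 * I φ (L φ)) / (4 * w.s) := by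
  have hB : ∀ f, 0 ≤ I f (L f) := fun f => by simpa using h.pow_nonneg 1 f
  have hsymm : I τ (L φ) = I φ (L τ) := by rw [← h.lap_symm, h.symm]
  set a := w.k * x - w.h ^ 2 / (4 * w.s)
  set b := w.g - w.q * w.h / (4 * w.s)
  set c := w.p - w.q ^ 2 / (4 * w.s)
  have key : ∀ α d, 0 ≤ a * α ^ 2 + 2 * b * α * d + c * d ^ 2 := by
    intro α d
    have h1 := hrem α d (-(w.q * d + w.h * α) / (2 * w.s))
    have h2 : w.form x α d (-(w.q * d + w.h * α) / (2 * w.s)) =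
        a * α ^ 2 + 2 * b * α * d + c * d ^ 2 := by
      simp only [Weights.form, a, b, c]
      field_simp
      ring
    rwa [h2] at h1
  have ha : 0 ≤ a := by simpa using key 1 0
  have hc : 0 ≤ c := by simpa using key 0 1
  have hbac : b ^ 2 ≤ a * c := by
    have := discrim_le_zero (a := a) (b := 2 * b) (c := c) fun α => by
      have := key α 1
      nlinarith
    rw [discrim] at this
    nlinarith
  have goal : 0 ≤ a * I φ (L φ) + 2 * b * I φ (L τ) + c * I τ (L τ) := by
    rcases ha.lt_or_eq with ha | ha
    · have h1 := hB (a • φ + b • τ)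
      simp only [map_add, map_smul, LinearMap.add_apply, LinearMap.smul_apply, smul_eq_mul,
        hsymm] at h1
      have h2 := mul_nonneg (sub_nonneg.2 hbac) (hB τ)
      refine nonneg_of_mul_nonneg_right (b := a * I φ (L φ) + 2 * b * I φ (L τ) + c * I τ (L τ))
        ?_ ha
      nlinarith
    · rw [← ha, zero_mul] at hbac
      have hb : b = 0 := by nlinarith
      rw [← ha, hb]
      have := mul_nonneg hc (hB τ)
      linarith
  refine goal.trans_eq ?_
  simp only [a, b, c]
  field_simp
  ring

/-- The combination of all trial function inequalities for a single function. -/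
lemma total_ge (h : IsWeyl I D X R) {k : ℕ} {u : Fin k → E} {ν : Fin k → ℝ}
    (hu : ∀ i j, I (u i) (L (u j)) = if i = j then 1 else 0) {w : Weights} {x β err : ℝ} {m : ℕ}
    (hk : 0 ≤ w.k) (hs : 0 < w.s) (hrem : ∀ α d c, 0 ≤ w.form x α d c) (i : Fin k)
    (henergy : ∑ p, (∑ j, (ν j - ν i) * I (X p (u i)) (L (u j)) ^ 2 +
      x * I (X p (u i) - ∑ j, I (X p (u i)) (L (u j)) • u j)
        (L (X p (u i) - ∑ j, I (X p (u i)) (L (u j)) • u j))) - err ≤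
      (m + 1) * (n + 2 * m) * I (u i) ((L ^ m) (u i)) - n * ν i * I (u i) (u i)) :
    ∑ p, ∑ j, w.form (ν j - ν i) (I (X p (u i)) (L (u j)))
      (I (D p (u i + β • L (u i))) (L (u j))) (I (u i) (D p (u j))) - w.k * err ≤
      w.total n (m + 1) β (ν i) fun s => I (u i) ((L ^ s) (u i)) := by
  set f := u i with hf
  set M : ℕ → ℝ := fun s => I f ((L ^ s) f) with hM
  let t : Fin n → E := fun p => D p (f + β • L f)
  let a : Fin n → Fin k → ℝ := fun p j => I (X p f) (L (u j))
  let d : Fin n → Fin k → ℝ := fun p j => I (t p) (L (u j))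
  let c : Fin n → Fin k → ℝ := fun p j => I f (D p (u j))
  let φ : Fin n → E := fun p => X p f - ∑ j, a p j • u j
  let τ : Fin n → E := fun p => t p - ∑ j, d p j • u j
  let v : Fin n → E := fun p => (-(1 / (2 * w.s))) • (w.q • τ p + w.h • φ p)
  have hX : ∀ p, X p f = ∑ j, a p j • u j + φ p := fun p => by simp [φ]
  have ht : ∀ p, t p = ∑ j, d p j • u j + τ p := fun p => by simp [τ]
  have hφ : ∀ p j, I (u j) (L (φ p)) = 0 := fun p j => h.inner_sub_proj hu _ _
  have hτ : ∀ p j, I (u j) (L (τ p)) = 0 := fun p j => h.inner_sub_proj hu _ _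
  have hv : ∀ p j, I (u j) (L (v p)) = 0 := fun p j => by simp [v, hφ, hτ]
  have hM1 : M 1 = 1 := by simp [hM, hf, hu]
  have hL : ∀ s, (L ^ s) (L f) = (L ^ (s + 1)) f := fun s => by
    rw [pow_succ, Module.End.mul_apply]
  have hL1 : ∀ s g, L ((L ^ s) g) = (L ^ (s + 1)) g := fun s g => by
    rw [pow_succ', Module.End.mul_apply]
  have hLL : L (L f) = (L ^ 2) f := by rw [← hL 1]; simp
  have eg : ∑ p, (∑ j, a p j * d p j + I (φ p) (L (τ p))) =
      -((n + 2) + (n + 4) * β * M 2) / 2 := by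
    have h1 : ∀ p, ∑ j, a p j * d p j + I (φ p) (L (τ p)) =
        I (X p f) (D p ((L ^ 1) f)) + β * I (X p f) (D p ((L ^ 2) f)) := by
      intro p
      rw [← h.inner_decomp hu _ _ (hφ p) (hτ p), ← hX, ← ht]
      simp only [t, map_add, map_smul, smul_eq_mul, ← h.D_lap, hLL, pow_one]
    simp only [h1, Finset.sum_add_distrib, ← Finset.mul_sum, h.sum_X_D]
    change -((n + 2 * (1 : ℕ)) / 2) * M 1 + β * (-((n + 2 * (2 : ℕ)) / 2) * M 2) = _
    rw [hM1]
    push_cast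
    ring
  have ep : ∑ p, (∑ j, d p j * d p j + I (τ p) (L (τ p))) =
      M 2 + 2 * β * M 3 + β ^ 2 * M 4 := by
    have h1 : ∀ p, ∑ j, d p j * d p j + I (τ p) (L (τ p)) =
        I (D p (f + β • L f)) ((L ^ 1) (D p (f + β • L f))) := by
      intro p
      rw [← h.inner_decomp hu _ _ (hτ p) (hτ p), ← ht, pow_one]
    simp only [h1]
    rw [← h.pow_succ_eq]
    simp only [map_add, map_smul, LinearMap.add_apply, LinearMap.smul_apply, smul_eq_mul,
      h.lap_symm, hL, hL1]
    change M 2 + β * M 3 + β * (M 3 + β * M 4) = _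
    ring
  have eq : ∑ p, (∑ j, d p j * c p j + I f (D p (τ p))) = -(1 + β * M 2) := by
    have h1 : ∀ p, ∑ j, d p j * c p j + I f (D p (τ p)) = I f (D p (t p)) := by
      intro p
      conv_rhs => rw [ht]
      simp [c]
    simp only [h1, t]
    rw [← map_sum, ← neg_neg (∑ p, _), ← weylLap_apply]
    simp only [map_add, map_smul, map_neg, smul_eq_mul, hLL]
    change -(I f (L f) + β * M 2) = _
    rw [← hM1]
    simp [hM]
  have eh : ∑ p, (∑ j, a p j * c p j + I f (D p (φ p))) = n / 2 * M 0 := by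
    have h1 : ∀ p, ∑ j, a p j * c p j + I f (D p (φ p)) = -I (X p f) (D p ((L ^ 0) f)) := by
      intro p
      have : I f (D p (X p f)) = -I (X p f) (D p f) := by
        rw [← neg_eq_iff_eq_neg, ← h.D_skew, h.symm]
      rw [pow_zero, Module.End.one_apply, ← this]
      conv_rhs => rw [hX]
      simp [c]
    simp only [h1, Finset.sum_neg_distrib, h.sum_X_D]
    change -(-((n + 2 * (0 : ℕ)) / 2) * M 0) = _
    push_cast
    ring
  have es : ∑ p, (∑ j, c p j * c p j + 2 * I f (D p (v p)) - I (v p) (L (v p))) ≤ M 0 := by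
    have h0 := h.two_mul_sum_le f fun p => ∑ j, c p j • u j + v p
    simp only [h.inner_decomp hu _ _ (hv _) (hv _)] at h0
    have h1 : ∀ p, I f (D p (∑ j, c p j • u j + v p)) = ∑ j, c p j * c p j + I f (D p (v p)) := by
      intro p
      simp [c]
    simp only [h1, Finset.sum_add_distrib, Finset.sum_sub_distrib, ← Finset.mul_sum] at h0 ⊢
    have : M 0 = I f f := by simp [hM]
    linarith
  have hr : ∀ p, 0 ≤ w.k * (x * I (φ p) (L (φ p))) + 2 * w.g * I (φ p) (L (τ p)) +
      w.p * I (τ p) (L (τ p)) + w.q * I f (D p (τ p)) + w.h * I f (D p (φ p)) +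
      w.s * (2 * I f (D p (v p)) - I (v p) (L (v p))) := by
    intro p
    refine (h.form_vector_nonneg hs hrem (φ p) (τ p)).trans_eq ?_
    have hsymm : I (τ p) (L (φ p)) = I (φ p) (L (τ p)) := by rw [← h.lap_symm, h.symm]
    simp only [v, map_smul, map_add, LinearMap.add_apply, LinearMap.smul_apply, smul_eq_mul, hsymm]
    field_simp
    ring
  have hr' := Finset.sum_nonneg fun p (_ : p ∈ Finset.univ) => hr p
  have hen := mul_le_mul_of_nonneg_left henergy hk
  have hes := mul_le_mul_of_nonneg_left es hs.le
  have hform : ∀ p j, w.form (ν j - ν i) (I (X p f) (L (u j)))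
      (I (D p (f + β • L f)) (L (u j))) (I f (D p (u j))) =
      w.k * ((ν j - ν i) * a p j ^ 2) + 2 * w.g * (a p j * d p j) + w.p * (d p j * d p j) +
        w.q * (d p j * c p j) + w.h * (a p j * c p j) + w.s * (c p j * c p j) := by
    intro p j
    simp only [Weights.form, a, d, c, t]
    ring
  have hM0 : I f f = M 0 := by simp [hM]
  simp only [hform]
  change _ ≤ w.total n (m + 1) β (ν i) M
  rw [Weights.total, ← ep, show (n + 2 : ℝ) + (n + 4) * β * M 2 =
    -2 * ∑ p, (∑ j, a p j * d p j + I (φ p) (L (τ p))) by rw [eg]; ring,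
    show n / 2 * w.h * M 0 = w.h * ∑ p, (∑ j, a p j * c p j + I f (D p (φ p))) by rw [eh]; ring,
    ← neg_neg (1 + β * M 2), ← eq]
  change w.k * (∑ p, (∑ j, (ν j - ν i) * a p j ^ 2 + x * I (φ p) (L (φ p))) - err) ≤
    w.k * ((m + 1) * (n + 2 * m) * M m - n * ν i * I f f) at hen
  rw [hM0] at hen
  simp only [Finset.sum_add_distrib, Finset.sum_sub_distrib, ← Finset.mul_sum] at hr' hen hes ⊢
  rw [Nat.add_sub_cancel]
  push_cast
  linarith

end IsWeyl

end Weyl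

/-- Approximate eigenvectors of the pencil of `L ^ (m + 1)` and `L`, with accuracy `ε`. -/
structure IsWeyl.IsApprox {E : Type*} [AddCommGroup E] [Module ℝ E] {n : ℕ}
    (I : E →ₗ[ℝ] E →ₗ[ℝ] ℝ) (D : Fin n → E →ₗ[ℝ] E) (m : ℕ) (z ε : ℝ) {k : ℕ}
    (u : Fin k → E) (ν : Fin k → ℝ) : Prop where
  ortho : ∀ i j, I (u i) (weylLap D (u j)) = if i = j then 1 else 0
  diag : ∀ i j, I (u i) ((weylLap D ^ (m + 1)) (u j)) = if i = j then ν i else 0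
  lower : ∀ ψ, (∀ i, I (u i) (weylLap D ψ) = 0) →
    (z - ε) * I ψ (weylLap D ψ) ≤ I ψ ((weylLap D ^ (m + 1)) ψ)
  cross : ∀ ψ, (∀ i, I (u i) (weylLap D ψ) = 0) → ∀ i, 2 * |I (u i) ((weylLap D ^ (m + 1)) ψ)| ≤
    √ε * (I ψ ((weylLap D ^ (m + 1)) ψ) + ε * I ψ (weylLap D ψ) + 1)

section Weyl

variable {E : Type*} [AddCommGroup E] [Module ℝ E] {n : ℕ} {I : E →ₗ[ℝ] E →ₗ[ℝ] ℝ}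
  {D X : Fin n → E →ₗ[ℝ] E} {R : ℝ}

local notation "L" => weylLap D

namespace IsWeyl

lemma proj_energy (h : IsWeyl I D X R) {m k : ℕ} {z ε Z Q : ℝ} {u : Fin k → E} {ν : Fin k → ℝ}
    (hap : IsApprox I D m z ε u ν) (hε : 0 < ε) (hε1 : ε ≤ 1) (hZ : ∀ i, ν i ≤ Z)
    (hZ0 : 0 ≤ Z) {f : E} (hB : I f (L f) ≤ Q) (hA : I f ((L ^ (m + 1)) f) ≤ Q) :
    (∀ i, |I (u i) ((L ^ (m + 1)) f) - ν i * I f (L (u i))| ≤ √ε * (3 * Q + 2 * Z * Q + 1)) ∧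
    ∑ j, ν j * I f (L (u j)) ^ 2 + z * I (f - ∑ j, I f (L (u j)) • u j)
      (L (f - ∑ j, I f (L (u j)) • u j)) -
      √ε * (Q + k * (2 * (Q + 1) * (3 * Q + 2 * Z * Q + 1))) ≤ I f ((L ^ (m + 1)) f) := by
  have hBn : ∀ f, 0 ≤ I f (L f) := fun f => by simpa using h.pow_nonneg 1 f
  have hQ : 0 ≤ Q := (hBn f).trans hB
  set b : Fin k → ℝ := fun j => I f (L (u j)) with hb
  set φ := f - ∑ j, b j • u j with hφd
  have hφ : ∀ j, I (u j) (L φ) = 0 := fun j => h.inner_sub_proj hap.ortho _ _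
  have hf : f = ∑ j, b j • u j + φ := by simp [φ]
  have hBf : I f (L f) = ∑ j, b j * b j + I φ (L φ) := by
    conv_lhs => rw [hf]
    exact h.inner_decomp hap.ortho b b hφ hφ
  have hb2 : ∑ j, b j * b j ≤ Q := by linarith [hBn φ]
  have hBφ : I φ (L φ) ≤ Q := by
    linarith [Finset.sum_nonneg fun j (_ : j ∈ Finset.univ) => mul_self_nonneg (b j)]
  have hν : ∀ j, 0 ≤ ν j := fun j => by
    have := h.pow_nonneg (m + 1) (u j)
    rwa [hap.diag, if_pos rfl] at this
  have hAu : ∀ i, I (u i) ((L ^ (m + 1)) (∑ j, b j • u j)) = ν i * b i := by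
    intro i
    simp [hap.diag, mul_comm]
  have hAP : I (∑ j, b j • u j) ((L ^ (m + 1)) (∑ j, b j • u j)) = ∑ j, ν j * b j ^ 2 := by
    rw [map_sum, LinearMap.sum_apply]
    refine Finset.sum_congr rfl fun j _ => ?_
    rw [map_smul, LinearMap.smul_apply, hAu, smul_eq_mul]
    ring
  have hAPle : ∑ j, ν j * b j ^ 2 ≤ Z * Q := by
    calc ∑ j, ν j * b j ^ 2 ≤ ∑ j, Z * (b j * b j) := Finset.sum_le_sum fun j _ => by
          have := mul_le_mul_of_nonneg_right (hZ j) (mul_self_nonneg (b j))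
          nlinarith
      _ ≤ Z * Q := by rw [← Finset.mul_sum]; exact mul_le_mul_of_nonneg_left hb2 hZ0
  have hAφ : I φ ((L ^ (m + 1)) φ) ≤ 2 * Q + 2 * Z * Q := by
    have h1 := h.pow_add_le (m + 1) f (-∑ j, b j • u j)
    rw [← sub_eq_add_neg, ← hφd] at h1
    simp only [map_neg, LinearMap.neg_apply, neg_neg, hAP] at h1
    linarith
  have hAφ0 := h.pow_nonneg (m + 1) φ
  have hsq : ε ≤ √ε := Real.le_sqrt_of_sq_le (by nlinarith)
  have hs0 := Real.sqrt_nonneg ε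
  have hcross : ∀ i, |I (u i) ((L ^ (m + 1)) φ)| ≤ √ε * (3 * Q + 2 * Z * Q + 1) := by
    intro i
    have h1 := hap.cross φ hφ i
    have h2 : I φ ((L ^ (m + 1)) φ) + ε * I φ (L φ) + 1 ≤ 3 * Q + 2 * Z * Q + 1 := by
      have : ε * I φ (L φ) ≤ 1 * Q := mul_le_mul hε1 hBφ (hBn φ) (by norm_num)
      linarith
    have h3 := mul_le_mul_of_nonneg_left h2 hs0
    have h4 := abs_nonneg (I (u i) ((L ^ (m + 1)) φ))
    linarith
  refine ⟨fun i => ?_, ?_⟩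
  · have : I (u i) ((L ^ (m + 1)) f) - ν i * b i = I (u i) ((L ^ (m + 1)) φ) := by
      conv_lhs => rw [hf]
      rw [map_add, map_add, hAu]
      ring
    rw [this]
    exact hcross i
  · have hAf : I f ((L ^ (m + 1)) f) =
        ∑ j, ν j * b j ^ 2 + ∑ j, 2 * (b j * I (u j) ((L ^ (m + 1)) φ)) +
          I φ ((L ^ (m + 1)) φ) := by
      conv_lhs => rw [hf]
      have h1 : I φ ((L ^ (m + 1)) (∑ j, b j • u j)) = I (∑ j, b j • u j) ((L ^ (m + 1)) φ) := by
        rw [← h.pow_symm, h.symm]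
      rw [map_add, map_add, map_add, LinearMap.add_apply, LinearMap.add_apply, hAP, h1,
        ← Finset.mul_sum]
      simp only [map_sum, map_smul, LinearMap.sum_apply, LinearMap.smul_apply, smul_eq_mul]
      ring
    have h2 : -(k * (√ε * (2 * (Q + 1) * (3 * Q + 2 * Z * Q + 1)))) ≤
        ∑ j, 2 * (b j * I (u j) ((L ^ (m + 1)) φ)) := by
      have h3 : ∀ j ∈ Finset.univ, -(√ε * (2 * (Q + 1) * (3 * Q + 2 * Z * Q + 1))) ≤
          2 * (b j * I (u j) ((L ^ (m + 1)) φ)) := by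
        intro j _
        have h4 : |b j| ≤ Q + 1 := by
          have h5 : b j * b j ≤ Q := (Finset.single_le_sum (f := fun j => b j * b j)
            (fun j _ => mul_self_nonneg _) (Finset.mem_univ j)).trans hb2
          rw [abs_le]
          constructor <;> nlinarith
        have h6 : |b j * I (u j) ((L ^ (m + 1)) φ)| ≤
            (Q + 1) * (√ε * (3 * Q + 2 * Z * Q + 1)) := by
          rw [abs_mul]
          exact mul_le_mul h4 (hcross j) (abs_nonneg _) (by linarith)
        have := (abs_le.1 h6).1
        linarith
      have := Finset.sum_le_sum h3
      rw [Finset.sum_const, Finset.card_univ, Fintype.card_fin, nsmul_eq_mul] at this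
      linarith
    have h3 := hap.lower φ hφ
    have h4 : ε * I φ (L φ) ≤ √ε * Q := mul_le_mul hsq hBφ (hBn φ) hs0
    rw [hAf]
    linarith

/-- Moments of an approximate eigenvector. -/
lemma IsApprox.isMoment (h : IsWeyl I D X R) {m k : ℕ} {z ε : ℝ} {u : Fin k → E} {ν : Fin k → ℝ}
    (hap : IsApprox I D m z ε u ν) (i : Fin k) :
    IsMoment (m + 1) (ν i) fun s => I (u i) ((L ^ s) (u i)) where
  nonneg s := h.pow_nonneg s _
  one := by simp [hap.ortho]
  top := by simp [hap.diag]
  convex s ρ := h.convex s ρ _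

lemma exists_energy_ge (h : IsWeyl I D X R) (hR : 0 ≤ R) (hn : 0 < n) (m k : ℕ) {Z : ℝ}
    (hZ0 : 0 ≤ Z) : ∃ C : ℝ, ∀ (z ε : ℝ) (u : Fin k → E) (ν : Fin k → ℝ),
    IsApprox I D m z ε u ν → 0 < ε → ε ≤ 1 → (∀ i, ν i ≤ Z) → ∀ i,
    ∑ p, (∑ j, (ν j - ν i) * I (X p (u i)) (L (u j)) ^ 2 +
      (z - ν i) * I (X p (u i) - ∑ j, I (X p (u i)) (L (u j)) • u j)
        (L (X p (u i) - ∑ j, I (X p (u i)) (L (u j)) • u j))) - √ε * C ≤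
      (m + 1) * (n + 2 * m) * I (u i) ((L ^ m) (u i)) - n * ν i * I (u i) (u i) := by
  obtain ⟨C₁, hC₁, hX⟩ := h.exists_sum_X_le hR (m + 2)
  set S : ℝ := (m + 2) * (4 * R + Z) with hS
  have hS0 : 0 ≤ S := by positivity
  set Q : ℝ := (C₁ + C₁ * C₁) * S with hQ
  refine ⟨n * (3 * Q + 2 * Z * Q + 1 + (Q + k * (2 * (Q + 1) * (3 * Q + 2 * Z * Q + 1)))), ?_⟩
  intro z ε u ν hap hε hε1 hνZ i
  set f := u i with hf
  have hmom := hap.isMoment h i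
  have hM0 : I f f ≤ 4 * R := by
    have := h.le_lap hR hn f
    rwa [hap.ortho, if_pos rfl, mul_one] at this
  have hνi : 0 ≤ ν i := by
    have := h.pow_nonneg (m + 1) (u i)
    rwa [hap.diag, if_pos rfl] at this
  have hSf : ∑ t ∈ Finset.range (m + 2), I f ((L ^ t) f) ≤ S := by
    have h1 : ∀ t ∈ Finset.range (m + 2), I f ((L ^ t) f) ≤ 4 * R + Z := by
      intro t ht
      have ht' : t ≤ m + 1 := by have := Finset.mem_range.1 ht; omega
      have h2 := convex_seq_le (f := fun s => I f ((L ^ s) f))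
        (fun s => by have := hmom.convex s 1; linarith) ht'
      simp only [pow_zero, Module.End.one_apply] at h2
      rw [hap.diag, if_pos rfl] at h2
      have ht0 : (0 : ℝ) ≤ t := Nat.cast_nonneg t
      have ht1 : (t : ℝ) ≤ (m + 1 : ℕ) := by exact_mod_cast ht'
      have hm0 : (0 : ℝ) < (m + 1 : ℕ) := by positivity
      refine le_of_mul_le_mul_left (h2.trans ?_) hm0
      have h3 := hνZ i
      have h4 : (0 : ℝ) ≤ (m + 1 : ℕ) - t := by linarith
      have h5 := mul_le_mul_of_nonneg_left hM0 h4
      have h6 := mul_le_mul_of_nonneg_left h3 ht0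
      have h7 := mul_nonneg ht0 hR
      have h8 := mul_nonneg h4 hZ0
      nlinarith
    refine (Finset.sum_le_sum h1).trans_eq ?_
    rw [Finset.sum_const, Finset.card_range, nsmul_eq_mul]
    push_cast
    rfl
  have hterm : ∀ t g, t < m + 2 →
      I g ((L ^ t) g) ≤ ∑ t ∈ Finset.range (m + 2), I g ((L ^ t) g) := fun t g ht =>
    Finset.single_le_sum (f := fun t => I g ((L ^ t) g)) (fun t _ => h.pow_nonneg t g)
      (Finset.mem_range.2 ht)
  have hXS : ∀ p, ∑ t ∈ Finset.range (m + 2), I (X p f) ((L ^ t) (X p f)) ≤ C₁ * S :=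
    fun p => (hX p f).trans (mul_le_mul_of_nonneg_left hSf hC₁)
  have hXXS : ∀ p, ∑ t ∈ Finset.range (m + 2), I (X p (X p f)) ((L ^ t) (X p (X p f))) ≤
      C₁ * (C₁ * S) := fun p => (hX p _).trans (mul_le_mul_of_nonneg_left (hXS p) hC₁)
  have hQ1 : C₁ * S ≤ Q := by
    rw [hQ]; nlinarith [mul_nonneg (mul_nonneg hC₁ hC₁) hS0]
  have hQ2 : C₁ * (C₁ * S) ≤ Q := by
    rw [hQ]; nlinarith [mul_nonneg hC₁ hS0]
  have p1 : ∀ p, _ := fun p => h.proj_energy (f := X p f) (Q := Q) hap hε hε1 hνZ hZ0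
    (by simpa using (hterm 1 (X p f) (by omega)).trans ((hXS p).trans hQ1))
    ((hterm (m + 1) (X p f) (by omega)).trans ((hXS p).trans hQ1))
  have p2 : ∀ p, _ := fun p => h.proj_energy (f := X p (X p f)) (Q := Q) hap hε hε1 hνZ hZ0
    (by simpa using (hterm 1 (X p (X p f)) (by omega)).trans ((hXXS p).trans hQ2))
    ((hterm (m + 1) (X p (X p f)) (by omega)).trans ((hXXS p).trans hQ2))
  have q1 := h.X_pow_X m f
  have q2 := h.X_pow_X 0 f
  have hper : ∀ p, ∑ j, (ν j - ν i) * I (X p f) (L (u j)) ^ 2 +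
      (z - ν i) * I (X p f - ∑ j, I (X p f) (L (u j)) • u j)
        (L (X p f - ∑ j, I (X p f) (L (u j)) • u j)) -
      √ε * (3 * Q + 2 * Z * Q + 1 + (Q + k * (2 * (Q + 1) * (3 * Q + 2 * Z * Q + 1)))) ≤
      I (X p f) ((L ^ (m + 1)) (X p f)) - I (X p (X p f)) ((L ^ (m + 1)) f) -
        ν i * (I (X p f) (L (X p f)) - I (X p (X p f)) (L f)) := by
    intro p
    have r1 := (p1 p).2
    have r2 := (abs_le.1 ((p2 p).1 i)).2
    have r3 : I (u i) ((L ^ (m + 1)) (X p (X p f))) = I (X p (X p f)) ((L ^ (m + 1)) f) := by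
      rw [← h.pow_symm, h.symm]
    rw [r3, ← hf] at r2
    have r4 : I (X p f) (L (X p f)) = ∑ j, I (X p f) (L (u j)) * I (X p f) (L (u j)) +
        I (X p f - ∑ j, I (X p f) (L (u j)) • u j)
        (L (X p f - ∑ j, I (X p f) (L (u j)) • u j)) := by
      rw [← h.inner_decomp hap.ortho _ _ (h.inner_sub_proj hap.ortho _)
        (h.inner_sub_proj hap.ortho _), add_sub_cancel]
    have r5 : ∑ j, (ν j - ν i) * I (X p f) (L (u j)) ^ 2 =
        ∑ j, ν j * I (X p f) (L (u j)) ^ 2 -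
          ν i * ∑ j, I (X p f) (L (u j)) * I (X p f) (L (u j)) := by
      rw [Finset.mul_sum, ← Finset.sum_sub_distrib]
      exact Finset.sum_congr rfl fun j _ => by ring
    rw [r5, r4]
    linarith
  have hsum := Finset.sum_le_sum fun p (_ : p ∈ Finset.univ) => hper p
  simp only [Finset.sum_sub_distrib, ← Finset.mul_sum, q1] at hsum
  simp only [zero_add, pow_one, pow_zero, Module.End.one_apply, Nat.cast_zero, mul_zero,
    add_zero, one_mul] at q2
  rw [q2] at hsum
  simp only [Finset.sum_const, Finset.card_univ, Fintype.card_fin, nsmul_eq_mul] at hsum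
  linarith

/-- The combination of all trial function inequalities for a family of approximate
eigenvectors. -/
lemma exists_sum_total_ge (h : IsWeyl I D X R) (hR : 0 ≤ R) (hn : 0 < n) (m k : ℕ) {Z : ℝ}
    (hZ0 : 0 ≤ Z) : ∃ C : ℝ, ∀ (z ε : ℝ) (u : Fin k → E) (ν : Fin k → ℝ),
    IsApprox I D m z ε u ν → 0 < ε → ε ≤ 1 → (∀ i, ν i ≤ Z) →
    ∀ (w : Fin k → Weights) (β : ℝ), (∀ i, 0 ≤ (w i).k) → (∀ i, 0 < (w i).s) →
    (∀ i α d c, 0 ≤ (w i).form (z - ν i) α d c) →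
    (∀ i j a b d, 0 ≤ (w i).form (ν j - ν i) a d ((a - b) / 2) +
      (w j).form (ν i - ν j) b (-d) (-((a - b) / 2))) →
    -(√ε * C) * ∑ i, (w i).k ≤
      ∑ i, (w i).total n (m + 1) β (ν i) fun s => I (u i) ((L ^ s) (u i)) := by
  obtain ⟨C, hC⟩ := h.exists_energy_ge hR hn m k hZ0
  refine ⟨C, fun z ε u ν hap hε hε1 hνZ w β hk hs hrem hpair => ?_⟩
  have h1 := Finset.sum_le_sum fun i (_ : i ∈ Finset.univ) =>
    h.total_ge (β := β) hap.ortho (hk i) (hs i) (hrem i) i (hC z ε u ν hap hε hε1 hνZ i)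
  refine le_trans ?_ h1
  rw [Finset.sum_sub_distrib, ← Finset.sum_mul]
  suffices H : 0 ≤ ∑ i, ∑ p, ∑ j, (w i).form (ν j - ν i) (I (X p (u i)) (L (u j)))
      (I (D p (u i + β • L (u i))) (L (u j))) (I (u i) (D p (u j))) by linarith
  rw [Finset.sum_comm]
  refine Finset.sum_nonneg fun p _ => ?_
  set F : Fin k → Fin k → ℝ := fun i j => (w i).form (ν j - ν i) (I (X p (u i)) (L (u j)))
      (I (D p (u i + β • L (u i))) (L (u j))) (I (u i) (D p (u j))) with hF
  change 0 ≤ ∑ i, ∑ j, F i j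
  have h2 : ∑ i, ∑ j, F i j + ∑ i, ∑ j, F j i = 2 * ∑ i, ∑ j, F i j := by
    rw [Finset.sum_comm (f := fun i j => F j i)]
    ring
  have h3 : 0 ≤ ∑ i, ∑ j, F i j + ∑ i, ∑ j, F j i := by
    simp only [← Finset.sum_add_distrib]
    refine Finset.sum_nonneg fun i _ => Finset.sum_nonneg fun j _ => ?_
    have hc : I (u i) (D p (u j)) = (I (X p (u i)) (L (u j)) - I (X p (u j)) (L (u i))) / 2 := by
      have e1 : I (X p (u j)) (L (u i)) = I (u i) (L (X p (u j))) := by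
        rw [← h.lap_symm, h.symm]
      rw [e1, h.lap_X, map_sub, map_smul, smul_eq_mul, h.X_symm]
      ring
    have hc' : I (u j) (D p (u i)) =
        -((I (X p (u i)) (L (u j)) - I (X p (u j)) (L (u i))) / 2) := by
      rw [← hc, h.symm, h.D_skew]
    have hd : I (D p (u j + β • L (u j))) (L (u i)) = -I (D p (u i + β • L (u i))) (L (u j)) := by
      rw [h.symm, h.D_skew, neg_neg]
      simp only [map_add, map_smul, LinearMap.add_apply, LinearMap.smul_apply, smul_eq_mul,
        h.D_lap]
      rw [h.lap_symm, h.lap_symm]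
    simp only [hF, hc', hd]
    rw [hc]
    exact hpair i j _ _ _
  linarith

end IsWeyl

end Weyl

open Filter Topology in
lemma sum_le_zero_of_approx {k : ℕ} {Λ : Fin k → ℝ} {ν : ℝ → Fin k → ℝ} {φ : ℝ → ℝ}
    (hφ : Continuous φ) (hν : ∀ ε, 0 < ε → ∀ i, Λ i ≤ ν ε i ∧ ν ε i ≤ Λ i + ε) {C : ℝ}
    (h : ∀ᶠ ε in 𝓝[>] (0 : ℝ), ∑ i, φ (ν ε i) ≤ √ε * C) : ∑ i, φ (Λ i) ≤ 0 := by
  have h1 : ∀ i, Tendsto (fun ε => ν ε i) (𝓝[>] (0 : ℝ)) (𝓝 (Λ i)) := by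
    intro i
    have h2 : Tendsto (fun ε => Λ i + ε) (𝓝[>] (0 : ℝ)) (𝓝 (Λ i)) := by
      have : Tendsto (fun ε => Λ i + ε) (𝓝 (0 : ℝ)) (𝓝 (Λ i + 0)) :=
        (continuous_const.add continuous_id).tendsto 0
      rw [add_zero] at this
      exact this.mono_left nhdsWithin_le_nhds
    refine tendsto_of_tendsto_of_tendsto_of_le_of_le' tendsto_const_nhds h2 ?_ ?_
    · filter_upwards [self_mem_nhdsWithin] with ε hε using (hν ε hε i).1
    · filter_upwards [self_mem_nhdsWithin] with ε hε using (hν ε hε i).2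
  have h3 : Tendsto (fun ε => ∑ i, φ (ν ε i)) (𝓝[>] (0 : ℝ)) (𝓝 (∑ i, φ (Λ i))) :=
    tendsto_finsetSum _ fun i _ => (hφ.tendsto _).comp (h1 i)
  have h4 : Tendsto (fun ε => √ε * C) (𝓝[>] (0 : ℝ)) (𝓝 0) := by
    have : Tendsto (fun ε => √ε * C) (𝓝 (0 : ℝ)) (𝓝 (√0 * C)) :=
      (Real.continuous_sqrt.mul continuous_const).tendsto 0
    rw [Real.sqrt_zero, zero_mul] at this
    exact this.mono_left nhdsWithin_le_nhds
  exact le_of_tendsto_of_tendsto h3 h4 h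

lemma IsMoment.sq_le {l : ℕ} {μ : ℝ} {M : ℕ → ℝ} (h : IsMoment l μ M) (s : ℕ) :
    M (s + 1) ^ 2 ≤ M s * M (s + 2) := by
  have := discrim_le_zero (a := M s) (b := -2 * M (s + 1)) (c := M (s + 2)) fun ρ => by
    have := h.convex s ρ
    nlinarith
  rw [discrim] at this
  nlinarith

lemma IsMoment.pos {l : ℕ} {μ : ℝ} {M : ℕ → ℝ} (h : IsMoment l μ M) (s : ℕ) : 0 < M s := by
  have h1 : ∀ s, 0 < M (s + 1) := by
    intro s
    induction s with
    | zero => rw [zero_add, h.one]; norm_num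
    | succ s ih =>
      have h2 := h.sq_le s
      rcases (h.nonneg (s + 2)).lt_or_eq with h3 | h3
      · exact h3
      · rw [← h3] at h2
        nlinarith
  rcases s with - | s
  · have h2 := h.sq_le 0
    rcases (h.nonneg 0).lt_or_eq with h3 | h3
    · exact h3
    · rw [← h3, zero_mul, zero_add, h.one] at h2
      norm_num at h2
  · exact h1 s

/-- Weights that yield the universal inequality for all eigenvalues below `z`. -/
structure IsCertificate (n l : ℕ) (z K κ β : ℝ) (w : ℝ → Weights) : Prop where
  pos : 0 < K
  nonneg_k : ∀ μ, 0 < μ → μ < z → 0 ≤ (w μ).k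
  le_k : ∀ μ, 0 < μ → μ < z → (w μ).k ≤ κ
  pos_s : ∀ μ, 0 < μ → μ < z → 0 < (w μ).s
  pair : ∀ μ ν, 0 < μ → μ < z → 0 < ν → ν < z → ∀ a b d,
    0 ≤ (w μ).form (ν - μ) a d ((a - b) / 2) + (w ν).form (μ - ν) b (-d) (-((a - b) / 2))
  rem : ∀ μ, 0 < μ → μ < z → ∀ α d c, 0 ≤ (w μ).form (z - μ) α d c
  bound : ∀ μ, 0 < μ → μ < z → ∀ M, IsMoment l μ M → (w μ).total n l β μ M ≤
    -(K * ((n : ℝ) ^ 2 * (z - μ) ^ 2 - 4 * ((l - 1) * (2 * l + n - 2)) * ((z - μ) * μ)))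

section Weyl

variable {E : Type*} [AddCommGroup E] [Module ℝ E] {n : ℕ} {I : E →ₗ[ℝ] E →ₗ[ℝ] ℝ}
  {D X : Fin n → E →ₗ[ℝ] E} {R : ℝ}

local notation "L" => weylLap D

namespace IsWeyl

variable (I D) in
/-- The variational eigenvalues of the pencil of `L ^ (m + 1)` and `L`. -/
noncomputable def eigenvalue (m j : ℕ) : ℝ := formMinMax (I.compl₂ L) (L ^ m) j

lemma lap_definite (h : IsWeyl I D X R) (hR : 0 ≤ R) (hn : 0 < n) {f : E} (hf : I f (L f) = 0) :
    f = 0 :=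
  h.definite f <| le_antisymm (by simpa [hf] using h.le_lap hR hn f) (h.nonneg f)

lemma eigenvalue_mono [Nontrivial E] (h : IsWeyl I D X R) (hR : 0 ≤ R) (hn : 0 < n) (m : ℕ)
    {i j : ℕ} (hij : i ≤ j) : eigenvalue I D m (i + 1) ≤ eigenvalue I D m (j + 1) := by
  have hB : ∀ f, 0 ≤ I f (L f) := fun f => by simpa using h.pow_nonneg 1 f
  refine formMinMax_mono (fun x y => ?_) hB (fun x hx => h.lap_definite hR hn hx)
    (fun x y => ?_) (fun x => ?_) (h.infinite hn) hij
  · simp only [LinearMap.compl₂_apply]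
    rw [← h.lap_symm, h.symm]
  · simp only [LinearMap.compl₂_apply]
    rw [h.pow_symm, ← Module.End.mul_apply, ← Module.End.mul_apply, ← pow_succ, pow_succ']
  · simp only [LinearMap.compl₂_apply]
    rw [← Module.End.mul_apply, ← pow_succ']
    exact h.pow_nonneg _ _

lemma exists_isApprox [Nontrivial E] (h : IsWeyl I D X R) (hR : 0 ≤ R) (hn : 0 < n) (m k : ℕ)
    {ε : ℝ} (hε : 0 < ε) : ∃ (u : Fin k → E) (ν : Fin k → ℝ),
    IsApprox I D m (eigenvalue I D m (k + 1)) ε u ν ∧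
    ∀ i : Fin k, eigenvalue I D m (i + 1) ≤ ν i ∧ ν i ≤ eigenvalue I D m (i + 1) + ε := by
  have hB : ∀ f, 0 ≤ I f (L f) := fun f => by simpa using h.pow_nonneg 1 f
  have hL : ∀ f, L ((L ^ m) f) = (L ^ (m + 1)) f := fun f => by
    rw [pow_succ', Module.End.mul_apply]
  obtain ⟨u, ν, -, h1, h2, h3, h4⟩ := exists_approx_eigen_form (B := I.compl₂ L) (T := L ^ m)
    (fun x y => by
      simp only [LinearMap.compl₂_apply]
      rw [← h.lap_symm, h.symm])
    hB (fun x hx => h.lap_definite hR hn hx)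
    (fun x y => by
      simp only [LinearMap.compl₂_apply]
      rw [h.pow_symm, ← Module.End.mul_apply, ← Module.End.mul_apply, ← pow_succ, pow_succ'])
    (fun x => by
      simp only [LinearMap.compl₂_apply, hL]
      exact h.pow_nonneg _ _) (h.infinite hn) k hε
  simp only [LinearMap.compl₂_apply, hL] at h1 h2 h4
  exact ⟨u, ν, ⟨h1, h2, fun ψ hψ => (h4 ψ hψ).1, fun ψ hψ => (h4 ψ hψ).2⟩, h3⟩

open Filter Topology in
/-- The universal inequality for the eigenvalues strictly below `z`. -/
lemma sum_le_of_isCertificate [Nontrivial E] (h : IsWeyl I D X R) (hR : 0 ≤ R) (hn : 0 < n)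
    {m k : ℕ} {K κ β : ℝ} {w : ℝ → Weights}
    (hlt : ∀ i < k, eigenvalue I D m (i + 1) < eigenvalue I D m (k + 1))
    (hc : IsCertificate n (m + 1) (eigenvalue I D m (k + 1)) K κ β w) :
    (n : ℝ) ^ 2 * ∑ i : Fin k, (eigenvalue I D m (k + 1) - eigenvalue I D m (i + 1)) ^ 2 ≤
      4 * (m * (2 * m + n)) * ∑ i : Fin k,
        (eigenvalue I D m (k + 1) - eigenvalue I D m (i + 1)) * eigenvalue I D m (i + 1) := by
  set z := eigenvalue I D m (k + 1)
  obtain ⟨C, hC⟩ := h.exists_sum_total_ge hR hn m k (abs_nonneg z)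
  have hex : ∀ ε : ℝ, ∃ (u : Fin k → E) (ν : Fin k → ℝ), 0 < ε → (IsApprox I D m z ε u ν ∧
      ∀ i : Fin k, eigenvalue I D m (i + 1) ≤ ν i ∧ ν i ≤ eigenvalue I D m (i + 1) + ε) := by
    intro ε
    by_cases hε : 0 < ε
    · obtain ⟨u, ν, h1⟩ := h.exists_isApprox hR hn m k hε
      exact ⟨u, ν, fun _ => h1⟩
    · exact ⟨0, 0, fun h1 => absurd h1 hε⟩
  choose u ν hν using hex
  have key : ∀ᶠ ε in 𝓝[>] (0 : ℝ), ∑ i, K * ((n : ℝ) ^ 2 * (z - ν ε i) ^ 2 -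
      4 * (m * (2 * m + n)) * ((z - ν ε i) * ν ε i)) ≤ √ε * (|C| * (k * κ)) := by
    have e1 : ∀ᶠ ε in 𝓝[>] (0 : ℝ), ε ≤ 1 :=
      nhdsWithin_le_nhds (Iic_mem_nhds one_pos)
    have e2 : ∀ᶠ ε in 𝓝[>] (0 : ℝ), ∀ i : Fin k, ε < z - eigenvalue I D m (i + 1) :=
      eventually_all.2 fun i => nhdsWithin_le_nhds (Iio_mem_nhds (sub_pos.2 (hlt i i.2)))
    filter_upwards [e1, e2, self_mem_nhdsWithin] with ε hε1 hε2 hε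
    obtain ⟨hap, hνΛ⟩ := hν ε hε
    have hνz : ∀ i, ν ε i < z := fun i => by linarith [(hνΛ i).2, hε2 i]
    have hν0 : ∀ i, 0 < ν ε i := fun i => by
      have := (hap.isMoment h i).pos (m + 1)
      rwa [(hap.isMoment h i).top] at this
    have h1 := hC z ε (u ε) (ν ε) hap hε hε1 (fun i => (hνz i).le.trans (le_abs_self z))
      (fun i => w (ν ε i)) β (fun i => hc.nonneg_k _ (hν0 i) (hνz i))
      (fun i => hc.pos_s _ (hν0 i) (hνz i)) (fun i => hc.rem _ (hν0 i) (hνz i))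
      (fun i j => hc.pair _ _ (hν0 i) (hνz i) (hν0 j) (hνz j))
    have h2 := Finset.sum_le_sum fun i (_ : i ∈ Finset.univ) =>
      hc.bound (ν ε i) (hν0 i) (hνz i) _ (hap.isMoment h i)
    have h3 : ∑ i, (w (ν ε i)).k ≤ k * κ := by
      have := Finset.sum_le_sum fun i (_ : i ∈ Finset.univ) => hc.le_k _ (hν0 i) (hνz i)
      simpa using this
    have h4 : 0 ≤ ∑ i, (w (ν ε i)).k :=
      Finset.sum_nonneg fun i _ => hc.nonneg_k _ (hν0 i) (hνz i)
    have h5 : √ε * C * ∑ i, (w (ν ε i)).k ≤ √ε * (|C| * (k * κ)) := by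
      rw [mul_assoc]
      refine mul_le_mul_of_nonneg_left ?_ (Real.sqrt_nonneg ε)
      exact mul_le_mul (le_abs_self C) h3 h4 (abs_nonneg C)
    rw [Finset.sum_neg_distrib] at h2
    have h6 : ∀ i, K * ((n : ℝ) ^ 2 * (z - ν ε i) ^ 2 -
        4 * (m * (2 * m + n)) * ((z - ν ε i) * ν ε i)) = K * ((n : ℝ) ^ 2 * (z - ν ε i) ^ 2 -
        4 * ((((m + 1 : ℕ) : ℝ) - 1) * (2 * ((m + 1 : ℕ) : ℝ) + n - 2)) *
          ((z - ν ε i) * ν ε i)) := by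
      intro i
      push_cast
      ring
    simp only [h6]
    linarith
  have h7 := sum_le_zero_of_approx (φ := fun t => K * ((n : ℝ) ^ 2 * (z - t) ^ 2 -
      4 * (m * (2 * m + n)) * ((z - t) * t))) (by fun_prop) (fun ε hε => (hν ε hε).2) key
  rw [← Finset.mul_sum] at h7
  have h8 := nonpos_of_mul_nonpos_right h7 hc.pos
  rw [Finset.sum_sub_distrib, ← Finset.mul_sum, ← Finset.mul_sum] at h8
  linarith

end IsWeyl

end Weyl

section Certificates

lemma quadratic_form_nonneg {A B C D E G : ℝ} (hG : 0 < G) (h1 : 0 ≤ A * G - D ^ 2)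
    (h2 : 0 ≤ C * G - E ^ 2)
    (h3 : (B * G - D * E) ^ 2 ≤ (A * G - D ^ 2) * (C * G - E ^ 2)) (a c d : ℝ) :
    0 ≤ A * a ^ 2 + 2 * B * a * c + C * c ^ 2 + 2 * D * a * d + 2 * E * c * d + G * d ^ 2 := by
  have key : 0 ≤ (A * G - D ^ 2) * a ^ 2 + 2 * (B * G - D * E) * a * c +
      (C * G - E ^ 2) * c ^ 2 := by
    set p := A * G - D ^ 2
    set q := B * G - D * E
    set r := C * G - E ^ 2
    rcases h1.lt_or_eq with hp | hp
    · refine nonneg_of_mul_nonneg_right (a := p) ?_ hp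
      nlinarith [sq_nonneg (p * a + q * c), mul_nonneg (sub_nonneg.2 h3) (sq_nonneg c)]
    · rw [← hp, zero_mul] at h3
      have hq : q = 0 := by nlinarith
      rw [← hp, hq]
      nlinarith [mul_nonneg h2 (sq_nonneg c)]
  refine nonneg_of_mul_nonneg_right (a := G) ?_ hG
  nlinarith [sq_nonneg (G * d + D * a + E * c)]

namespace IsMoment

variable {l : ℕ} {μ : ℝ} {M : ℕ → ℝ}

lemma le_zero_mul (h : IsMoment l μ M) (s : ℕ) : M s ≤ M 0 * M (s + 1) := by
  induction s with
  | zero => simp [h.one]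
  | succ s ih =>
    refine le_of_mul_le_mul_left ?_ (h.pos (s + 1))
    nlinarith [h.sq_le s, mul_le_mul_of_nonneg_right ih (h.nonneg (s + 2))]

lemma interp (h : IsMoment l μ M) {r j N : ℕ} (hN : r + N = l) (hj : j ≤ N) :
    (N : ℝ) * M (r + j) ≤ (N - j) * M r + j * μ := by
  have := convex_seq_le (f := fun s => M (r + s)) (fun s => by
    have := h.convex (r + s) 1
    rw [← add_assoc, ← add_assoc]
    linarith) hj
  simpa [hN, h.top] using this

lemma scale (h : IsMoment (l + 1) μ M) {ρ : ℝ} (hρ : 0 < ρ) :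
    IsMoment (l + 1) (μ / ρ ^ l) fun s => M s * ρ / ρ ^ s where
  nonneg s := by have := h.nonneg s; positivity
  one := by simp [h.one, hρ.ne']
  top := by
    rw [h.top, pow_succ]
    field_simp
  convex s t := by
    have h1 := h.convex s (t * ρ)
    have h2 : M (s + 2) * ρ / ρ ^ (s + 2) - 2 * t * (M (s + 1) * ρ / ρ ^ (s + 1)) +
        t ^ 2 * (M s * ρ / ρ ^ s) =
        (M (s + 2) - 2 * (t * ρ) * M (s + 1) + (t * ρ) ^ 2 * M s) * (ρ / ρ ^ (s + 2)) := by
      simp only [pow_succ]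
      field_simp
    rw [h2]
    positivity

end IsMoment

namespace IsCertificate

lemma of_weights {n l : ℕ} {z K κ β : ℝ} {W : ℝ → Weights} (hK : 0 < K)
    (hk : ∀ x, 0 < x → x < z → 0 ≤ (W x).k ∧ (W x).k ≤ κ) (hs : ∀ x, 0 < x → x < z → 0 < (W x).s)
    (h0 : ∀ τ a d c, (W 0).form τ a d c = 0)
    (hpair : ∀ x y, 0 < x → x ≤ z → 0 ≤ y → y ≤ z → ∀ m c d,
      0 ≤ (W x).form (x - y) (m + c) d c + (W y).form (y - x) (m - c) (-d) (-c))
    (hbound : ∀ μ x, 0 < μ → 0 < x → μ + x = z → ∀ M, IsMoment l μ M → (W x).total n l β μ M ≤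
      -(K * ((n : ℝ) ^ 2 * x ^ 2 - 4 * ((l - 1) * (2 * l + n - 2)) * (x * μ)))) :
    IsCertificate n l z K κ β fun μ => W (z - μ) where
  pos := hK
  nonneg_k μ h1 h2 := (hk _ (by linarith) (by linarith)).1
  le_k μ h1 h2 := (hk _ (by linarith) (by linarith)).2
  pos_s μ h1 h2 := hs _ (by linarith) (by linarith)
  pair μ ν h1 h2 h3 h4 a b d := by
    have h := hpair (z - μ) (z - ν) (by linarith) (by linarith) (by linarith) (by linarith)
      ((a + b) / 2) ((a - b) / 2) d
    rwa [show z - μ - (z - ν) = ν - μ by ring, show z - ν - (z - μ) = μ - ν by ring,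
      show (a + b) / 2 + (a - b) / 2 = a by ring, show (a + b) / 2 - (a - b) / 2 = b by ring] at h
  rem μ h1 h2 α d c := by
    have h := hpair (z - μ) 0 (by linarith) (by linarith) le_rfl (by linarith) (α - c) c d
    rwa [h0, add_zero, sub_zero, sub_add_cancel] at h
  bound μ h1 h2 M hM := hbound μ (z - μ) h1 (by linarith) (by ring) M hM

lemma scale {n l : ℕ} {z K κ β ρ : ℝ} {w : ℝ → Weights} (hl : 1 ≤ l)
    (h : IsCertificate n (l + 1) z K κ β w) (hρ : 0 < ρ) :
    IsCertificate n (l + 1) (ρ ^ l * z) K (ρ ^ l * ρ * κ) (β / ρ) fun μ =>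
      { k := ρ ^ l * ρ * (w (μ / ρ ^ l)).k
        g := (ρ ^ l) ^ 2 * (w (μ / ρ ^ l)).g
        p := (ρ ^ l) ^ 2 / ρ * (w (μ / ρ ^ l)).p
        q := (ρ ^ l) ^ 2 * (w (μ / ρ ^ l)).q
        h := (ρ ^ l) ^ 2 * ρ * (w (μ / ρ ^ l)).h
        s := (ρ ^ l) ^ 2 * ρ * (w (μ / ρ ^ l)).s } := by
  have hζ : 0 < ρ ^ l := by positivity
  have hdiv : ∀ μ, 0 < μ → μ < ρ ^ l * z → 0 < μ / ρ ^ l ∧ μ / ρ ^ l < z := fun μ h1 h2 =>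
    ⟨by positivity, by rwa [div_lt_iff₀ hζ, mul_comm]⟩
  have hform : ∀ (v : Weights) (τ a d c : ℝ), Weights.form
      { k := ρ ^ l * ρ * v.k
        g := (ρ ^ l) ^ 2 * v.g
        p := (ρ ^ l) ^ 2 / ρ * v.p
        q := (ρ ^ l) ^ 2 * v.q
        h := (ρ ^ l) ^ 2 * ρ * v.h
        s := (ρ ^ l) ^ 2 * ρ * v.s } τ a d c =
      (ρ ^ l) ^ 2 * ρ * v.form (τ / ρ ^ l) a (d / ρ) c := by
    intro v τ a d c
    simp only [Weights.form]
    field_simp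
  refine ⟨h.pos, fun μ h1 h2 => ?_, fun μ h1 h2 => ?_, fun μ h1 h2 => ?_,
    fun μ ν h1 h2 h3 h4 a b d => ?_, fun μ h1 h2 a d c => ?_, fun μ h1 h2 M hM => ?_⟩
  · have := h.nonneg_k _ (hdiv μ h1 h2).1 (hdiv μ h1 h2).2
    simp only
    positivity
  · have := h.le_k _ (hdiv μ h1 h2).1 (hdiv μ h1 h2).2
    simp only
    gcongr
  · have := h.pos_s _ (hdiv μ h1 h2).1 (hdiv μ h1 h2).2
    simp only
    positivity
  · have := h.pair _ _ (hdiv μ h1 h2).1 (hdiv μ h1 h2).2 (hdiv ν h3 h4).1 (hdiv ν h3 h4).2 a b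
      (d / ρ)
    rw [hform, hform, ← mul_add, sub_div ν, sub_div μ, neg_div]
    exact mul_nonneg (by positivity) this
  · have := h.rem _ (hdiv μ h1 h2).1 (hdiv μ h1 h2).2 a (d / ρ) c
    rw [hform, sub_div, mul_div_cancel_left₀ _ hζ.ne']
    positivity
  · have h3 := h.bound _ (hdiv μ h1 h2).1 (hdiv μ h1 h2).2 _ (hM.scale hρ)
    have h4 := mul_le_mul_of_nonneg_left h3 (sq_nonneg (ρ ^ l))
    refine (le_of_eq ?_).trans (h4.trans_eq ?_)
    · obtain ⟨r, rfl⟩ : ∃ r, l = r + 1 := ⟨l - 1, by omega⟩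
      simp only [Weights.total, Nat.add_sub_cancel]
      field_simp
    · field_simp

lemma exists_of_exists {n l : ℕ} (hl : 1 ≤ l)
    (h : ∃ z K κ β w, 0 < z ∧ IsCertificate n (l + 1) z K κ β w) {z : ℝ} (hz : 0 < z) :
    ∃ K κ β w, IsCertificate n (l + 1) z K κ β w := by
  obtain ⟨z₀, K, κ, β, w, hz₀, h⟩ := h
  have h1 : ((z / z₀) ^ ((l : ℝ)⁻¹)) ^ l = z / z₀ :=
    Real.rpow_inv_natCast_pow (by positivity) (by omega)
  have h2 := h.scale hl (ρ := (z / z₀) ^ ((l : ℝ)⁻¹)) (by positivity)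
  rw [h1, div_mul_cancel₀ _ hz₀.ne'] at h2
  exact ⟨_, _, _, _, h2⟩

end IsCertificate

end Certificates

section HighDimension

/-- Weights for dimension at least three, as a function of the spectral gap `x`. -/
noncomputable def highWeights (n κ x : ℝ) : Weights where
  k := κ * x ^ 2
  g := x ^ 2
  p := (1 + 1 / (2 * n)) * x / κ
  q := -(3 / n) * x ^ 2
  h := -(2 * κ / n) * x ^ 3
  s := κ * x ^ 3

lemma form_nonneg_aux_top {x y : ℝ} (hx : 0 < x) (hy : 0 ≤ y) (m c d : ℝ) :
    0 ≤ (x - y) * (x ^ 2 * (m + c) ^ 2 - y ^ 2 * (m - c) ^ 2) +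
      2 * (x ^ 2 * (m + c) - y ^ 2 * (m - c)) * d + (x + y) * d ^ 2 + (x ^ 3 + y ^ 3) * c ^ 2 := by
  have hσ : 0 < x + y := by linarith
  have h1 : 0 ≤ (x + y) ^ 2 * (x ^ 2 - x * y + y ^ 2) - 4 * x ^ 2 * y ^ 2 := by
    have : (x + y) ^ 2 * (x ^ 2 - x * y + y ^ 2) - 4 * x ^ 2 * y ^ 2 =
        (x - y) ^ 2 * (x ^ 2 + 3 * (x * y) + y ^ 2) := by ring
    rw [this]
    positivity
  refine nonneg_of_mul_nonneg_right (a := x + y) ?_ hσ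
  have h2 := mul_nonneg h1 (sq_nonneg c)
  have h3 := sq_nonneg ((x + y) * d + (x ^ 2 * (m + c) - y ^ 2 * (m - c)))
  linarith

lemma form_nonneg_aux_three {x y : ℝ} (hx : 0 < x) (hy : 0 ≤ y) (m c d : ℝ) :
    0 ≤ (x - y) * (x ^ 2 * (m + c) ^ 2 - y ^ 2 * (m - c) ^ 2) +
      2 * (x ^ 2 * (m + c) - y ^ 2 * (m - c)) * d + 7 / 6 * (x + y) * d ^ 2 -
      (x ^ 2 + y ^ 2) * d * c - 2 / 3 * (x ^ 3 * (m + c) - y ^ 3 * (m - c)) * c +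
      (x ^ 3 + y ^ 3) * c ^ 2 := by
  have hσ : 0 < x + y := by linarith
  have hxy : 0 ≤ x * y := by positivity
  have e1 : 0 ≤ (x + y) ^ 2 * (7 / 6) * ((4 * x ^ 2 - 7 * x * y + 4 * y ^ 2) / 3) -
      ((x ^ 2 + y ^ 2) / 2) ^ 2 := by
    nlinarith [sq_nonneg (x ^ 2 - y ^ 2), mul_nonneg hxy (sq_nonneg (x - y)), sq_nonneg (x * y),
      sq_nonneg ((x - y) ^ 2)]
  have h := quadratic_form_nonneg (A := (x - y) ^ 2 * (x + y))
    (B := (x - y) * ((2 * x ^ 2 - x * y + 2 * y ^ 2) / 3))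
    (C := (x + y) * ((4 * x ^ 2 - 7 * x * y + 4 * y ^ 2) / 3)) (D := (x - y) * (x + y))
    (E := (x ^ 2 + y ^ 2) / 2) (G := 7 / 6 * (x + y)) (by positivity)
    (by
      have : (x - y) ^ 2 * (x + y) * (7 / 6 * (x + y)) - ((x - y) * (x + y)) ^ 2 =
        (x - y) ^ 2 * (x + y) ^ 2 / 6 := by ring
      rw [this]; positivity)
    (by linarith)
    (by
      have h2 : 0 ≤ 1 / 6 * ((x + y) ^ 2 * (7 / 6) * ((4 * x ^ 2 - 7 * x * y + 4 * y ^ 2) / 3) -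
          ((x ^ 2 + y ^ 2) / 2) ^ 2) -
          (7 / 6 * ((2 * x ^ 2 - x * y + 2 * y ^ 2) / 3) - (x ^ 2 + y ^ 2) / 2) ^ 2 := by
        nlinarith [sq_nonneg (x ^ 2 - y ^ 2), mul_nonneg hxy (sq_nonneg (x - y)),
          sq_nonneg (x * y), sq_nonneg ((x - y) ^ 2)]
      have h3 := mul_nonneg h2 (sq_nonneg ((x - y) * (x + y)))
      linarith) m c d
  linarith

lemma highWeights_pair {n κ x y : ℝ} (hn : 3 ≤ n) (hκ : 0 < κ) (hx : 0 < x) (hy : 0 ≤ y)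
    (m c d : ℝ) : 0 ≤ (highWeights n κ x).form (x - y) (m + c) d c +
      (highWeights n κ y).form (y - x) (m - c) (-d) (-c) := by
  have h1 := form_nonneg_aux_top hx hy m c (d / κ)
  have h2 := form_nonneg_aux_three hx hy m c (d / κ)
  have h3 : 0 ≤ 1 - 3 / n := sub_nonneg.2 ((div_le_one (by linarith)).2 hn)
  have h4 : 0 ≤ 3 / n := by positivity
  have h5 := mul_nonneg hκ.le (add_nonneg (mul_nonneg h3 h1) (mul_nonneg h4 h2))
  refine h5.trans_eq ?_
  have hn0 : n ≠ 0 := by linarith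
  simp only [highWeights, Weights.form]
  field_simp
  ring

lemma highWeights_bound {n m μ x : ℝ} {M₀ M₁ M₂ : ℝ} (hn : 3 ≤ n) (hm : 1 ≤ m)
    (hx : 0 < x) (hz : μ + x = 1 + 4 * (m * (2 * m + n)) / n ^ 2) (h0 : M₁ ≤ M₀ * μ)
    (h1 : m * M₁ ≤ 1 + (m - 1) * μ) (h2 : m * M₂ ≤ (m - 1) + μ) (a b N R : ℝ)
    (ha : a = m * (2 * m + n + 2)) (hN : N = n + 2 - 3 / n) (hb : b = 1 + 1 / (2 * n))
    (hR : R = 4 * (m * (2 * m + n)) / n ^ 2) :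
    N / (2 * a) * x ^ 2 * ((m + 1) * (2 * (m + 1) + n - 2) * M₁ - n * μ * M₀) - N * x ^ 2 +
      b * x / (N / (2 * a)) * M₂ ≤
      -((N / 2 + N * R * (m - 1) / (2 * m) + 2 * a * b / (N * m)) / (n ^ 2 * (1 + R)) *
        (n ^ 2 * x ^ 2 - 4 * (m * (2 * m + n)) * (x * μ))) := by
  have hn0 : 0 < n := by linarith
  have hm0 : 0 < m := by linarith
  have ha0 : 0 < a := by rw [ha]; positivity
  have hN0 : 0 < N := by
    have : 3 / n ≤ 1 := (div_le_one (by linarith)).2 hn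
    rw [hN]; linarith
  have hb0 : 0 < b := by rw [hb]; positivity
  have hR0 : 0 < R := by rw [hR]; positivity
  have e1 : (m + 1) * (2 * (m + 1) + n - 2) * M₁ - n * μ * M₀ ≤ a * M₁ := by
    rw [ha]; nlinarith
  have e2 : N / (2 * a) * x ^ 2 * ((m + 1) * (2 * (m + 1) + n - 2) * M₁ - n * μ * M₀) ≤
      x * (N / 2 * x * ((1 + (m - 1) * μ) / m)) := by
    calc _ ≤ N / (2 * a) * x ^ 2 * (a * M₁) := by gcongr
      _ = x * (N / 2 * x * M₁) := by field_simp
      _ ≤ _ := by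
        gcongr
        rwa [le_div_iff₀ hm0, mul_comm]
  have e3 : b * x / (N / (2 * a)) * M₂ ≤ x * (2 * a * b / N * ((m - 1 + μ) / m)) := by
    calc _ = x * (2 * a * b / N * M₂) := by field_simp
      _ ≤ _ := by
        gcongr
        rwa [le_div_iff₀ hm0, mul_comm]
  have hRn : 4 * (m * (2 * m + n)) = R * n ^ 2 := by rw [hR]; field_simp
  have hx' : x = R + (1 - μ) := by rw [← hR] at hz; linarith
  have e4 : n ^ 2 * x ^ 2 - 4 * (m * (2 * m + n)) * (x * μ) = x * (n ^ 2 * (1 + R) * (1 - μ)) := by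
    rw [hRn, hx']; ring
  have val : 0 ≤ N * R / 2 - 2 * a * b / N := by
    have hpoly : 0 ≤ 2 * ((n + 3) * (n - 1)) ^ 2 * (2 * m + n) -
        n ^ 3 * (2 * n + 1) * (2 * m + n + 2) := by
      obtain ⟨t, ht, rfl⟩ : ∃ t, 0 ≤ t ∧ n = 3 + t := ⟨n - 3, by linarith, by ring⟩
      obtain ⟨s, hs, rfl⟩ : ∃ s, 0 ≤ s ∧ m = 1 + s := ⟨m - 1, by linarith, by ring⟩
      ring_nf
      positivity
    have : N * R / 2 - 2 * a * b / N = (2 * ((n + 3) * (n - 1)) ^ 2 * (2 * m + n) -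
        n ^ 3 * (2 * n + 1) * (2 * m + n + 2)) * (m / (n ^ 4 * N)) := by
      have hN1 : N = (n + 3) * (n - 1) / n := by
        rw [hN]; field_simp; ring
      have hN2 : (n + 3) * (n - 1) ≠ 0 := by
        intro h; rw [h, zero_div] at hN1; linarith
      rw [hN1, hR, ha, hb]
      field_simp
      ring
    rw [this]
    positivity
  have key : 0 ≤ N * x - N / 2 * x * ((1 + (m - 1) * μ) / m) - 2 * a * b / N * ((m - 1 + μ) / m) -
      (N / 2 + N * R * (m - 1) / (2 * m) + 2 * a * b / (N * m)) * (1 - μ) := by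
    have : N * x - N / 2 * x * ((1 + (m - 1) * μ) / m) - 2 * a * b / N * ((m - 1 + μ) / m) -
      (N / 2 + N * R * (m - 1) / (2 * m) + 2 * a * b / (N * m)) * (1 - μ) =
      (N * R / 2 - 2 * a * b / N) + N * (m - 1) / (2 * m) * (1 - μ) ^ 2 := by
      rw [hx']
      field_simp
      ring
    rw [this]
    have : 0 ≤ m - 1 := by linarith
    positivity
  rw [e4]
  have e5 := mul_nonneg hx.le key
  have e6 : (N / 2 + N * R * (m - 1) / (2 * m) + 2 * a * b / (N * m)) / (n ^ 2 * (1 + R)) *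
      (x * (n ^ 2 * (1 + R) * (1 - μ))) =
      x * ((N / 2 + N * R * (m - 1) / (2 * m) + 2 * a * b / (N * m)) * (1 - μ)) := by
    field_simp
  rw [e6]
  linarith

lemma exists_isCertificate_of_three_le {n m : ℕ} (hn : 3 ≤ n) (hm : 1 ≤ m) :
    ∃ z K κ β w, 0 < z ∧ IsCertificate n (m + 1) z K κ β w := by
  have hn' : (3 : ℝ) ≤ n := by exact_mod_cast hn
  have hm' : (1 : ℝ) ≤ m := by exact_mod_cast hm
  have hn0 : (0 : ℝ) < n := by linarith
  have hm0 : (0 : ℝ) ≤ (m : ℝ) - 1 := by linarith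
  set a : ℝ := m * (2 * m + n + 2) with ha
  set N : ℝ := n + 2 - 3 / n with hN
  set b : ℝ := 1 + 1 / (2 * n) with hb
  set R : ℝ := 4 * (m * (2 * m + n)) / n ^ 2 with hR
  have ha0 : 0 < a := by positivity
  have hN0 : 0 < N := by
    have : 3 / (n : ℝ) ≤ 1 := (div_le_one (by linarith)).2 hn'
    rw [hN]; linarith
  have hb0 : 0 < b := by positivity
  have hR0 : 0 < R := by positivity
  refine ⟨1 + R, _, N / (2 * a) * (1 + R) ^ 2, 0, _, by positivity,
    IsCertificate.of_weights (W := highWeights n (N / (2 * a)))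
    (K := (N / 2 + N * R * (m - 1) / (2 * m) + 2 * a * b / (N * m)) / (n ^ 2 * (1 + R)))
    (by positivity) (fun x hx hxz => ?_) (fun x hx hxz => ?_) (fun τ a d c => ?_)
    (fun x y hx hxz hy hyz c d m => ?_) (fun μ x hμ hx hz M hM => ?_)⟩
  · simp only [highWeights]
    exact ⟨by positivity, by gcongr⟩
  · simp only [highWeights]
    positivity
  · simp [highWeights, Weights.form]
  · exact highWeights_pair hn' (by positivity) hx hy _ _ _
  · have h0 := hM.le_zero_mul m
    rw [hM.top] at h0
    have h1 := hM.interp (r := 1) (j := m - 1) (N := m) (by omega) (by omega)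
    have h2 := hM.interp (r := 1) (j := 1) (N := m) (by omega) (by omega)
    rw [Nat.add_sub_cancel' hm, hM.one, Nat.cast_sub hm] at h1
    rw [hM.one] at h2
    push_cast at h1 h2
    have h3 := highWeights_bound hn' hm' hx hz h0 (by linarith) (by linarith) a b N R ha hN hb hR
    refine (le_of_eq ?_).trans (h3.trans_eq ?_)
    · simp only [highWeights, Weights.total, Nat.add_sub_cancel]
      rw [← hb]
      push_cast
      have : N * x ^ 2 = (n + 2) * x ^ 2 - 3 / n * x ^ 2 := by rw [hN]; ring
      rw [this]
      field_simp
      ring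
    · push_cast
      ring

end HighDimension

section PlaneHighOrder

/-- Weights in dimension two and order at least four, as a function of the spectral gap `x`. -/
noncomputable def planeWeights (κ x : ℝ) : Weights where
  k := κ * x ^ 2
  g := x ^ 2
  p := 9 / 8 * x / κ
  q := -2 * x ^ 2
  h := -(4 / 3 * κ) * x ^ 3
  s := 4 / 3 * κ * x ^ 3

lemma planeWeights_pair {κ x y : ℝ} (hκ : 0 < κ) (hx : 0 < x) (hy : 0 ≤ y) (m c d : ℝ) :
    0 ≤ (planeWeights κ x).form (x - y) (m + c) d c +
      (planeWeights κ y).form (y - x) (m - c) (-d) (-c) := by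
  have hσ : 0 < x + y := by linarith
  have h := quadratic_form_nonneg (A := (x - y) ^ 2 * (x + y)) (B := (x - y) ^ 2 * ((x - y) / 3))
    (C := (x - y) ^ 2 * (x + y)) (D := (x - y) * (x + y)) (E := 0) (G := 9 / 8 * (x + y))
    (by positivity)
    (by
      have : (x - y) ^ 2 * (x + y) * (9 / 8 * (x + y)) - ((x - y) * (x + y)) ^ 2 =
        (x - y) ^ 2 * (x + y) ^ 2 / 8 := by ring
      rw [this]; positivity)
    (by
      have : (x - y) ^ 2 * (x + y) * (9 / 8 * (x + y)) - 0 ^ 2 =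
        9 / 8 * ((x - y) ^ 2 * (x + y) ^ 2) := by ring
      rw [this]; positivity)
    (by
      have h1 : 0 ≤ 9 / 64 * ((x - y) ^ 4 * (x + y) ^ 2 * (4 * (x * y))) := by positivity
      linarith) m c (d / κ)
  refine (mul_nonneg hκ.le h).trans_eq ?_
  simp only [planeWeights, Weights.form]
  field_simp
  ring

lemma planeWeights_bound_aux {l μ ξ y : ℝ} (hl : 4 ≤ l) (hμ : 0 < μ) (hy : 0 ≤ y)
    (hξ : (2 * l * (l - 1)) * (1 - ξ) = μ - 1) (hξ0 : 0 < ξ) (hyμ : (l - 1) * y ≤ l - 2 + μ) :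
    0 ≤ 2 * l * (l - 2) * μ + 14 / 5 * ξ * y * (l * (l - 2)) -
      3 / 2 * (l + 1) * ξ * (y + (l - 3) * μ) -
      3 / 4 * l * ((l - 2) * y + 7 / 5 * ((l - 3) * y + μ) +
        49 / 100 * ((l - 4) * y + 2 * μ)) := by
  have hC : 24 ≤ 2 * l * (l - 1) := by nlinarith
  have hξ1 : ξ ≤ 25 / 24 := by
    by_contra! hc
    nlinarith
  have p0 : 0 ≤ 2 * l * (l - 2) - 3 / 2 * (l + 1) * (l - 3) * ξ - 357 / 200 * l := by
    have : 3 / 2 * (l + 1) * (l - 3) * ξ ≤ 3 / 2 * (l + 1) * (l - 3) * (25 / 24) := by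
      refine mul_le_mul_of_nonneg_left hξ1 ?_
      nlinarith
    nlinarith
  rcases le_or_gt y (μ / 2) with hym | hym
  · have p1 : 0 ≤ (2 * l * (l - 2) - 3 / 2 * (l + 1) * (l - 3) * ξ - 357 / 200 * l) +
        1 / 2 * (ξ * (14 / 5 * l * (l - 2) - 3 / 2 * (l + 1)) -
          3 / 4 * l * (289 / 100 * l - 204 / 25)) := by
      have : (1 / 10 * l ^ 2 + 11 / 20 * l - 15 / 4) * ξ ≤
          (1 / 10 * l ^ 2 + 11 / 20 * l - 15 / 4) * (25 / 24) := by
        refine mul_le_mul_of_nonneg_left hξ1 ?_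
        nlinarith
      nlinarith
    have h1 := mul_nonneg p0 (by linarith : 0 ≤ μ - 2 * y)
    have h2 := mul_nonneg p1 (by linarith : 0 ≤ 2 * y)
    linarith
  · have hμ4 : μ < 4 := by nlinarith
    have hξ2 : 7 / 8 ≤ ξ := by
      by_contra! hc
      nlinarith
    have p1 : 0 ≤ ξ * (14 / 5 * l * (l - 2) - 3 / 2 * (l + 1)) -
          3 / 4 * l * (289 / 100 * l - 204 / 25) := by
      have : (7 / 8) * (14 / 5 * l * (l - 2) - 3 / 2 * (l + 1)) ≤
          ξ * (14 / 5 * l * (l - 2) - 3 / 2 * (l + 1)) := by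
        refine mul_le_mul_of_nonneg_right hξ2 ?_
        nlinarith
      nlinarith
    have h1 := mul_nonneg p0 hμ.le
    have h2 := mul_nonneg p1 hy
    linarith

lemma planeWeights_bound {l μ x C κ A M₀ y M₃ M₄ : ℝ} (hl : 4 ≤ l) (hμ : 0 < μ) (hx : 0 < x)
    (hC : C = 2 * l * (l - 1)) (hκ : κ = 3 / (2 * C)) (hz : μ + x = 1 + C) (hy : 0 ≤ y)
    (h0 : A ≤ M₀ * μ) (hA : (l - 2) * A ≤ y + (l - 3) * μ) (h3 : (l - 2) * M₃ ≤ (l - 3) * y + μ)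
    (h4 : (l - 2) * M₄ ≤ (l - 4) * y + 2 * μ) (hyμ : (l - 1) * y ≤ l - 2 + μ) :
    κ * x ^ 2 * (2 * l ^ 2 * A - 2 * μ * M₀) - x ^ 2 * (2 + 14 / 5 * y) +
      9 / 8 * x / κ * (y + 7 / 5 * M₃ + 49 / 100 * M₄) ≤
      -(1 / 2 * (4 * x ^ 2 - 4 * C * (x * μ))) := by
  have hC0 : 0 < C := by rw [hC]; nlinarith
  have hl0 : 0 < l := by linarith
  have hl2 : 0 < l - 2 := by linarith
  obtain ⟨ξ, rfl⟩ : ∃ ξ, x = C * ξ := ⟨x / C, by field_simp⟩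
  have hξ0 : 0 < ξ := pos_of_mul_pos_right hx hC0.le
  have h := planeWeights_bound_aux hl hμ hy (ξ := ξ) (by rw [← hC]; linarith) hξ0 hyμ
  have e1 : κ * (C * ξ) ^ 2 * (2 * l ^ 2 * A - 2 * μ * M₀) ≤
      C ^ 2 * ξ * (3 / 2 * (l + 1) * ξ * (y + (l - 3) * μ) / (l * (l - 2))) := by
    have h5 : 2 * l ^ 2 * A - 2 * μ * M₀ ≤ 2 * (l ^ 2 - 1) * A := by linarith
    have hκ0 : 0 ≤ κ := by rw [hκ]; positivity
    have h6 : 0 ≤ (l ^ 2 - 1) := by nlinarith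
    have h7 : A ≤ (y + (l - 3) * μ) / (l - 2) := by rwa [le_div_iff₀ hl2, mul_comm]
    calc _ ≤ κ * (C * ξ) ^ 2 * (2 * (l ^ 2 - 1) * ((y + (l - 3) * μ) / (l - 2))) := by
          refine mul_le_mul_of_nonneg_left (h5.trans ?_) (by positivity)
          gcongr
      _ = _ := by
          have : l - 1 ≠ 0 := by linarith
          rw [hκ, hC]
          field_simp
          ring
  have e2 : 9 / 8 * (C * ξ) / κ * (y + 7 / 5 * M₃ + 49 / 100 * M₄) ≤
      C ^ 2 * ξ * (3 / 4 * l * ((l - 2) * y + 7 / 5 * ((l - 3) * y + μ) +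
        49 / 100 * ((l - 4) * y + 2 * μ)) / (l * (l - 2))) := by
    have h5 : y + 7 / 5 * M₃ + 49 / 100 * M₄ ≤ ((l - 2) * y + 7 / 5 * ((l - 3) * y + μ) +
        49 / 100 * ((l - 4) * y + 2 * μ)) / (l - 2) := by
      rw [le_div_iff₀ hl2]
      linarith
    have h6 : 9 / 8 * (C * ξ) / κ = 3 / 4 * (C ^ 2 * ξ) := by
      rw [hκ]; field_simp; ring
    rw [h6]
    refine (mul_le_mul_of_nonneg_left h5 (by positivity)).trans_eq ?_
    field_simp
  have e3 : 0 ≤ C ^ 2 * ξ * ((2 * l * (l - 2) * μ + 14 / 5 * ξ * y * (l * (l - 2)) -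
      3 / 2 * (l + 1) * ξ * (y + (l - 3) * μ) -
      3 / 4 * l * ((l - 2) * y + 7 / 5 * ((l - 3) * y + μ) +
        49 / 100 * ((l - 4) * y + 2 * μ))) / (l * (l - 2))) := by positivity
  rw [sub_div, sub_div, add_div] at e3
  have e4 : 2 * l * (l - 2) * μ / (l * (l - 2)) = 2 * μ := by field_simp
  have e5 : 14 / 5 * ξ * y * (l * (l - 2)) / (l * (l - 2)) = 14 / 5 * ξ * y := by field_simp
  rw [e4, e5] at e3
  linarith

lemma exists_isCertificate_of_four_le {m : ℕ} (hm : 3 ≤ m) :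
    ∃ z K κ β w, 0 < z ∧ IsCertificate 2 (m + 1) z K κ β w := by
  have hm' : (3 : ℝ) ≤ m := by exact_mod_cast hm
  set l : ℝ := m + 1 with hl
  set C : ℝ := 2 * l * (l - 1) with hC
  have hC0 : 0 < C := by rw [hC, hl]; ring_nf; positivity
  set κ : ℝ := 3 / (2 * C) with hκ
  have hκ0 : 0 < κ := by positivity
  refine ⟨1 + C, _, κ * (1 + C) ^ 2, 7 / 10, _, by positivity,
    IsCertificate.of_weights (W := planeWeights κ) (K := 1 / 2)
    (by positivity) (fun x hx hxz => ?_) (fun x hx hxz => ?_) (fun τ a d c => ?_)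
    (fun x y hx hxz hy hyz c d m => ?_) (fun μ x hμ hx hz M hM => ?_)⟩
  · simp only [planeWeights]
    exact ⟨by positivity, by gcongr⟩
  · simp only [planeWeights]
    positivity
  · simp [planeWeights, Weights.form]
  · exact planeWeights_pair hκ0 hx hy _ _ _
  · have h0 := hM.le_zero_mul m
    rw [hM.top] at h0
    have h1 := hM.interp (r := 2) (j := m - 2) (N := m - 1) (by omega) (by omega)
    have h2 := hM.interp (r := 2) (j := 1) (N := m - 1) (by omega) (by omega)
    have h3 := hM.interp (r := 2) (j := 2) (N := m - 1) (by omega) (by omega)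
    have h4 := hM.interp (r := 1) (j := 1) (N := m) (by omega) (by omega)
    rw [Nat.add_sub_cancel' (by omega), Nat.cast_sub (by omega), Nat.cast_sub (by omega)] at h1
    rw [Nat.cast_sub (by omega)] at h2 h3
    rw [hM.one] at h4
    push_cast at h1 h2 h3 h4
    have h5 := planeWeights_bound (l := l) (M₃ := M 3) (M₄ := M 4) (by linarith) hμ hx hC hκ hz
      (hM.nonneg 2) h0
      (by linarith) (by linarith) (by linarith) (by linarith)
    refine (le_of_eq ?_).trans (h5.trans_eq ?_)
    · simp only [planeWeights, Weights.total, Nat.add_sub_cancel]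
      push_cast
      rw [← hl]
      ring
    · rw [hC]
      push_cast
      ring

end PlaneHighOrder

section PlaneLowOrder

lemma Weights.pair_nonneg {w v : Weights} {τ A B C D E G : ℝ} (hG0 : 0 < G)
    (hA : w.k - v.k = τ * A) (hB : w.h - v.h = 2 * τ * (B - (w.k + v.k)))
    (hC : w.h + v.h + (w.s + v.s) = C - τ * (w.k - v.k)) (hD : w.g - v.g = τ * D)
    (hE : w.q + v.q = 2 * (E - (w.g + v.g))) (hG : w.p + v.p = G) (h1 : 0 ≤ A * G - D ^ 2)
    (h2 : 0 ≤ C * G - E ^ 2)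
    (h3 : 0 ≤ A * C * G + 2 * (B * D * E) - A * E ^ 2 - C * D ^ 2 - G * B ^ 2) (m c d : ℝ) :
    0 ≤ w.form τ (m + c) d c + v.form (-τ) (m - c) (-d) (-c) := by
  have h := quadratic_form_nonneg (A := A) (B := B) (C := C) (D := D) (E := E) hG0 h1 h2
    (by nlinarith) (τ * m) c d
  refine h.trans_eq ?_
  simp only [Weights.form]
  linear_combination (-τ * m ^ 2) * hA - m * c * hB - c ^ 2 * hC - 2 * m * d * hD - c * d * hE -
    d ^ 2 * hG

/-- Weights in dimension two and order two, as a function of the spectral gap `x`. -/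
noncomputable def biharmonicWeights (x : ℝ) : Weights where
  k := x ^ 2 * (2120 * (1 - x) ^ 2 + 2410 * (1 - x) * x + 720 * x ^ 2)
  g := x ^ 2 * (3790 * (1 - x) ^ 2 + 8540 * (1 - x) * x + 3450 * x ^ 2)
  p := x * (9925 * (1 - x) ^ 2 + 28340 * (1 - x) * x + 31710 * x ^ 2)
  q := x ^ 2 * (8600 * (1 - x) ^ 2 + 16960 * (1 - x) * x - 6900 * x ^ 2)
  h := x ^ 3 * (1895 * (1 - x) ^ 2 + 40 * (1 - x) * x - 568 * x ^ 2)
  s := x ^ 3 * ((1 - x) * (9735 * (1 - x) + 15 * x) - (1895 * (1 - x) ^ 2 + 40 * (1 - x) * x -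
    568 * x ^ 2))

lemma biharmonicWeights_det {u v w : ℝ} (hu : 0 ≤ u) (hv : 0 ≤ v) (hw : 0 ≤ w) :
    0 ≤ 32097000 * u ^ 10 * v + 64194000 * u ^ 10 * w + 11833976125 * u ^ 9 * v ^ 2 +
      1586980500 * u ^ 9 * v * w + 1266010500 * u ^ 9 * w ^ 2 + 224444516125/2 * u ^ 8 * v ^ 3 +
      155908533500 * u ^ 8 * v ^ 2 * w + 98182218000 * u ^ 8 * v * w ^ 2 +
      61656780500 * u ^ 8 * w ^ 3 + 1619216962625/4 * u ^ 7 * v ^ 4 +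
      1799231947125/2 * u ^ 7 * v ^ 3 * w + 1211018067875/2 * u ^ 7 * v ^ 2 * w ^ 2 +
      116372126750 * u ^ 7 * v * w ^ 3 - 65127497625 * u ^ 7 * w ^ 4 +
      1355421736225/2 * u ^ 6 * v ^ 5 + 2417073732475 * u ^ 6 * v ^ 4 * w +
      11557672297625/4 * u ^ 6 * v ^ 3 * w ^ 2 + 764939481875 * u ^ 6 * v ^ 2 * w ^ 3 -
      976426720875/2 * u ^ 6 * v * w ^ 4 - 104106847500 * u ^ 6 * w ^ 5 +
      451778630600 * u ^ 5 * v ^ 6 + 3126319652750 * u ^ 5 * v ^ 5 * w +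
      13024573923525/2 * u ^ 5 * v ^ 4 * w ^ 2 + 3920875407000 * u ^ 5 * v ^ 3 * w ^ 3 +
      635376130875/4 * u ^ 5 * v ^ 2 * w ^ 4 + 284618522625/2 * u ^ 5 * v * w ^ 5 +
      303086535875/2 * u ^ 5 * w ^ 6 - 9138572000 * u ^ 4 * v ^ 7 +
      2106780695550 * u ^ 4 * v ^ 6 * w + 14538046749425/2 * u ^ 4 * v ^ 5 * w ^ 2 +
      6142751450350 * u ^ 4 * v ^ 4 * w ^ 3 + 798452893125 * u ^ 4 * v ^ 3 * w ^ 4 +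
      288364036125 * u ^ 4 * v ^ 2 * w ^ 5 + 1515432679375/4 * u ^ 4 * v * w ^ 6 -
      50752393020 * u ^ 3 * v ^ 8 + 1538805564900 * u ^ 3 * v ^ 7 * w +
      6635597244025 * u ^ 3 * v ^ 6 * w ^ 2 + 7612340271050 * u ^ 3 * v ^ 5 * w ^ 3 +
      10573721573325/4 * u ^ 3 * v ^ 4 * w ^ 4 + 1937449440375/2 * u ^ 3 * v ^ 3 * w ^ 5 +
      714870476500 * u ^ 3 * v ^ 2 * w ^ 6 + 41600981280 * u ^ 2 * v ^ 9 +
      1066529786120 * u ^ 2 * v ^ 8 * w + 4327628060550 * u ^ 2 * v ^ 7 * w ^ 2 +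
      5959094718000 * u ^ 2 * v ^ 6 * w ^ 3 + 6343080968775/2 * u ^ 2 * v ^ 5 * w ^ 4 +
      1212251407500 * u ^ 2 * v ^ 4 * w ^ 5 + 2773790179625/4 * u ^ 2 * v ^ 3 * w ^ 6 +
      22789453520 * u * v ^ 10 + 341128535320 * u * v ^ 9 * w +
      1374134771950 * u * v ^ 8 * w ^ 2 + 2115981044600 * u * v ^ 7 * w ^ 3 +
      5355198796325/4 * u * v ^ 6 * w ^ 4 + 992397391875/2 * u * v ^ 5 * w ^ 5 +
      276133330750 * u * v ^ 4 * w ^ 6 + 1840719840 * v ^ 11 + 32413451260 * v ^ 10 * w +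
      146736442800 * v ^ 9 * w ^ 2 + 254340348400 * v ^ 8 * w ^ 3 +
      352567436525/2 * v ^ 7 * w ^ 4 + 57042205875 * v ^ 6 * w ^ 5 +
      140482720875/4 * v ^ 5 * w ^ 6 := by
  rcases le_total u w with h | h
  · obtain ⟨t, ht, rfl⟩ : ∃ t, 0 ≤ t ∧ w = u + t := ⟨w - u, by linarith, by ring⟩
    ring_nf
    positivity
  · obtain ⟨t, ht, rfl⟩ : ∃ t, 0 ≤ t ∧ u = w + t := ⟨u - w, by linarith, by ring⟩
    rcases le_total t v with h | h
    · obtain ⟨v, hv, rfl⟩ : ∃ y, 0 ≤ y ∧ v = t + y := ⟨v - t, by linarith, by ring⟩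
      ring_nf
      positivity
    · obtain ⟨t, ht, rfl⟩ : ∃ y, 0 ≤ y ∧ t = v + y := ⟨t - v, by linarith, by ring⟩
      ring_nf
      positivity

lemma biharmonicWeights_first_minor {u v w : ℝ} (hu : 0 ≤ u) (hv : 0 ≤ v) (hw : 0 ≤ w) :
    0 ≤ 2139800 * u ^ 6 + 19661700 * u ^ 5 * v + 26484600 * u ^ 5 * w + 72535350 * u ^ 4 * v ^ 2 +
      108731800 * u ^ 4 * v * w + 42520300 * u ^ 4 * w ^ 2 + 144270700 * u ^ 3 * v ^ 3 +
      250355750 * u ^ 3 * v ^ 2 * w + 124323050 * u ^ 3 * v * w ^ 2 + 26188300 * u ^ 3 * w ^ 3 +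
      154099800 * u ^ 2 * v ^ 4 + 355076450 * u ^ 2 * v ^ 3 * w +
      258946500 * u ^ 2 * v ^ 2 * w ^ 2 + 92697650 * u ^ 2 * v * w ^ 3 +
      26707600 * u ^ 2 * w ^ 4 + 71744400 * u * v ^ 5 + 206684650 * u * v ^ 4 * w +
      194882900 * u * v ^ 3 * w ^ 2 + 78335450 * u * v ^ 2 * w ^ 3 + 26707600 * u * v * w ^ 4 +
      10928700 * v ^ 6 + 37899900 * v ^ 5 * w + 43588000 * v ^ 4 * w ^ 2 +
      19266850 * v ^ 3 * w ^ 3 + 6676900 * v ^ 2 * w ^ 4 := by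
  positivity

lemma biharmonicWeights_second_minor {u v w : ℝ} (hu : 0 ≤ u) (hv : 0 ≤ v) (hw : 0 ≤ w) :
    0 ≤ 951300 * u ^ 7 * v + 1902600 * u ^ 7 * w + 359372750 * u ^ 6 * v ^ 2 +
      84425300 * u ^ 6 * v * w + 77766200 * u ^ 6 * w ^ 2 + 1125727575 * u ^ 5 * v ^ 3 +
      349804900 * u ^ 5 * v ^ 2 * w + 237229650 * u ^ 5 * v * w ^ 2 + 2620700 * u ^ 5 * w ^ 3 +
      1461397425 * u ^ 4 * v ^ 4 + 975379000 * u ^ 4 * v ^ 3 * w +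
      835275725 * u ^ 4 * v ^ 2 * w ^ 2 + 255925950 * u ^ 4 * v * w ^ 3 +
      124687100 * u ^ 4 * w ^ 4 + 955977550 * u ^ 3 * v ^ 5 + 1212058000 * u ^ 3 * v ^ 4 * w +
      1351721250 * u ^ 3 * v ^ 3 * w ^ 2 + 558519100 * u ^ 3 * v ^ 2 * w ^ 3 +
      249374200 * u ^ 3 * v * w ^ 4 + 461218800 * u ^ 2 * v ^ 6 + 1211112900 * u ^ 2 * v ^ 5 * w +
      1738165375 * u ^ 2 * v ^ 4 * w ^ 2 + 943420450 * u ^ 2 * v ^ 3 * w ^ 3 +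
      430158075 * u ^ 2 * v ^ 2 * w ^ 4 + 166964400 * u * v ^ 7 + 622645075 * u * v ^ 6 * w +
      1002945425 * u * v ^ 5 * w ^ 2 + 598665950 * u * v ^ 4 * w ^ 3 +
      305470975 * u * v ^ 3 * w ^ 4 + 22831200 * v ^ 8 + 97301550 * v ^ 7 * w +
      162112150 * v ^ 6 * w ^ 2 + 84655225 * v ^ 5 * w ^ 3 + 52212775 * v ^ 4 * w ^ 4 := by
  positivity

lemma biharmonicWeights_pair {u v : ℝ} (hu : 0 ≤ u) (hv : 0 ≤ v) (huv : 0 < u + v) (h1 : u + v ≤ 1)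
    (m c d : ℝ) : 0 ≤ (biharmonicWeights (u + v)).form v (m + c) d c +
      (biharmonicWeights u).form (-v) (m - c) (-d) (-c) := by
  obtain ⟨w, hw, hw0⟩ : ∃ w, 1 - (u + v) = w ∧ 0 ≤ w := ⟨_, rfl, by linarith⟩
  have hwu : 1 - u = v + w := by linarith
  have hG : 0 < 63420 * u ^ 3 + 123470 * u ^ 2 * v + 56680 * u ^ 2 * w + 105055 * u * v ^ 2 +
      76530 * u * v * w + 19850 * u * w ^ 2 + 31710 * v ^ 3 + 28340 * v ^ 2 * w +
      9925 * v * w ^ 2 := by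
    have : 0 < 31710 * (u + v) ^ 3 := by positivity
    refine this.trans_le (sub_nonneg.1 ?_)
    ring_nf
    positivity
  refine Weights.pair_nonneg
    (A := 470 * u ^ 3 + 2200 * u ^ 2 * v + 2990 * u ^ 2 * w + 2880 * u * v ^ 2 + 7230 * u * v * w +
      4240 * u * w ^ 2 + 720 * v ^ 3 + 2410 * v ^ 2 * w + 2120 * v * w ^ 2)
    (B := 3005/2 * u ^ 3 * v + 3005 * u ^ 3 * w + 3600 * u ^ 2 * v ^ 2 + 11590 * u ^ 2 * v * w +
      14165/2 * u ^ 2 * w ^ 2 + 1460 * u * v ^ 3 + 7310 * u * v ^ 2 * w +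
      14165/2 * u * v * w ^ 2 + 436 * v ^ 4 + 2430 * v ^ 3 * w + 6135/2 * v ^ 2 * w ^ 2)
    (C := 15 * u ^ 4 * v + 30 * u ^ 4 * w + 10205 * u ^ 3 * v ^ 2 + 19530 * u ^ 3 * v * w +
      19470 * u ^ 3 * w ^ 2 + 2200 * u ^ 2 * v ^ 3 + 3080 * u ^ 2 * v ^ 2 * w +
      29205 * u ^ 2 * v * w ^ 2 + 2880 * u * v ^ 4 + 7290 * u * v ^ 3 * w +
      33445 * u * v ^ 2 * w ^ 2 + 720 * v ^ 5 + 2425 * v ^ 4 * w + 11855 * v ^ 3 * w ^ 2)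
    (D := 5260 * u ^ 3 + 16910 * u ^ 2 * v + 18040 * u ^ 2 * w + 13800 * u * v ^ 2 +
      25620 * u * v * w + 7580 * u * w ^ 2 + 3450 * v ^ 3 + 8540 * v ^ 2 * w + 3790 * v * w ^ 2)
    (E := 17020 * u ^ 3 * v + 34040 * u ^ 3 * w + 8090 * u ^ 2 * v ^ 2 + 67240 * u ^ 2 * v * w +
      16180 * u ^ 2 * w ^ 2 + 51060 * u * v ^ 2 * w + 16180 * u * v * w ^ 2 + 17020 * v ^ 3 * w +
      8090 * v ^ 2 * w ^ 2)
    (G := 63420 * u ^ 3 + 123470 * u ^ 2 * v + 56680 * u ^ 2 * w + 105055 * u * v ^ 2 +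
      76530 * u * v * w + 19850 * u * w ^ 2 + 31710 * v ^ 3 + 28340 * v ^ 2 * w +
      9925 * v * w ^ 2)
    hG ?_ ?_ ?_ ?_ ?_ ?_ ?_ ?_ ?_ m c d
  · simp only [biharmonicWeights, hwu, hw]
    ring
  · simp only [biharmonicWeights, hwu, hw]
    ring
  · simp only [biharmonicWeights, hwu, hw]
    ring
  · simp only [biharmonicWeights, hwu, hw]
    ring
  · simp only [biharmonicWeights, hwu, hw]
    ring
  · simp only [biharmonicWeights, hwu, hw]
    ring
  · exact (biharmonicWeights_first_minor hu hv hw0).trans_eq (by ring)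
  · exact (biharmonicWeights_second_minor hu hv hw0).trans_eq (by ring)
  · exact (biharmonicWeights_det hu hv hw0).trans_eq (by ring)

/-- Weights in dimension two and order three, as a function of the spectral gap `x`. -/
noncomputable def triharmonicWeights (x : ℝ) : Weights where
  k := x ^ 2 * (1432 * (1 - x) ^ 2 + 1944 * (1 - x) * x + 512 * x ^ 2)
  g := x ^ 2 * (2136 * (1 - x) ^ 2 + 6048 * (1 - x) * x + 1464 * x ^ 2)
  p := x * (12552 * (1 - x) ^ 2 + 17576 * (1 - x) * x + 5024 * x ^ 2)
  q := x ^ 2 * (848 * (1 - x) ^ 2 + 3728 * (1 - x) * x - 2928 * x ^ 2)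
  h := x ^ 3 * (-632 * (1 - x) ^ 2 - 1302 * (1 - x) * x - 670 * x ^ 2)
  s := x ^ 3 * ((1 - x) * (6376 * (1 - x) + 480 * x) - (-632 * (1 - x) ^ 2 - 1302 * (1 - x) * x -
    670 * x ^ 2))

lemma triharmonicWeights_det {u v w : ℝ} (hu : 0 ≤ u) (hv : 0 ≤ v) (hw : 0 ≤ w) :
    0 ≤ 483901440 * u ^ 10 * v + 967802880 * u ^ 10 * w - 1345066752 * u ^ 9 * v ^ 2 -
      19623099392 * u ^ 9 * v * w - 24462113792 * u ^ 9 * w ^ 2 + 101077654240 * u ^ 8 * v ^ 3 +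
      278393766976 * u ^ 8 * v ^ 2 * w + 347230902912 * u ^ 8 * v * w ^ 2 +
      304873609984 * u ^ 8 * w ^ 3 + 212493863328 * u ^ 7 * v ^ 4 +
      350179432896 * u ^ 7 * v ^ 3 * w - 212651916352 * u ^ 7 * v ^ 2 * w ^ 2 -
      514933518848 * u ^ 7 * v * w ^ 3 - 867213979392 * u ^ 7 * w ^ 4 +
      345062631872 * u ^ 6 * v ^ 5 + 842811243424 * u ^ 6 * v ^ 4 * w +
      213108520896 * u ^ 6 * v ^ 3 * w ^ 2 - 616751203904 * u ^ 6 * v ^ 2 * w ^ 3 -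
      1700660598272 * u ^ 6 * v * w ^ 4 + 533835331840 * u ^ 6 * w ^ 5 +
      320928138048 * u ^ 5 * v ^ 6 + 1226276179136 * u ^ 5 * v ^ 5 * w +
      1465034331616 * u ^ 5 * v ^ 4 * w ^ 2 + 909272009408 * u ^ 5 * v ^ 3 * w ^ 3 -
      86360242368 * u ^ 5 * v ^ 2 * w ^ 4 + 3403598161920 * u ^ 5 * v * w ^ 5 +
      600697388800 * u ^ 5 * w ^ 6 + 178832724248 * u ^ 4 * v ^ 7 +
      989777872048 * u ^ 4 * v ^ 6 * w + 1514187186720 * u ^ 4 * v ^ 5 * w ^ 2 +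
      1074219882464 * u ^ 4 * v ^ 4 * w ^ 3 + 1283268808800 * u ^ 4 * v ^ 3 * w ^ 4 +
      6073414242816 * u ^ 4 * v ^ 2 * w ^ 5 + 1501743472000 * u ^ 4 * v * w ^ 6 +
      78778503336 * u ^ 3 * v ^ 8 + 636614742128 * u ^ 3 * v ^ 7 * w +
      1274951861936 * u ^ 3 * v ^ 6 * w ^ 2 + 1417202068992 * u ^ 3 * v ^ 5 * w ^ 3 +
      2681599537856 * u ^ 3 * v ^ 4 * w ^ 4 + 6822635418112 * u ^ 3 * v ^ 3 * w ^ 5 +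
      2118481474560 * u ^ 3 * v ^ 2 * w ^ 6 + 23749597512 * u ^ 2 * v ^ 9 +
      257047255304 * u ^ 2 * v ^ 8 * w + 622747802000 * u ^ 2 * v ^ 7 * w ^ 2 +
      962154063600 * u ^ 2 * v ^ 6 * w ^ 3 + 2172653271648 * u ^ 2 * v ^ 5 * w ^ 4 +
      4540997779392 * u ^ 2 * v ^ 4 * w ^ 5 + 1675978739840 * u ^ 2 * v ^ 3 * w ^ 6 +
      3080335576 * u * v ^ 10 + 46311343424 * u * v ^ 9 * w + 114012617576 * u * v ^ 8 * w ^ 2 +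
      194470935088 * u * v ^ 7 * w ^ 3 + 627533039088 * u * v ^ 6 * w ^ 4 +
      1473460936128 * u * v ^ 5 * w ^ 5 + 642359069184 * u * v ^ 4 * w ^ 6 + 62247008 * v ^ 11 +
      2831280536 * v ^ 10 * w + 5796315592 * v ^ 9 * w ^ 2 + 4164877064 * v ^ 8 * w ^ 3 +
      49268263864 * v ^ 7 * w ^ 4 + 175371512000 * v ^ 6 * w ^ 5 + 91907860352 * v ^ 5 * w ^ 6
      := by
  rcases le_total (1/3 * u) w with h | h
  · obtain ⟨t, ht, rfl⟩ : ∃ t, 0 ≤ t ∧ w = 1/3 * u + t := ⟨w - 1/3 * u, by linarith, by ring⟩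
    ring_nf
    positivity
  · obtain ⟨t, ht, rfl⟩ : ∃ t, 0 ≤ t ∧ u = 3 * w + t := ⟨u - 3 * w, by linarith, by ring⟩
    rcases le_total t v with h | h
    · obtain ⟨v, hv, rfl⟩ : ∃ y, 0 ≤ y ∧ v = t + y := ⟨v - t, by linarith, by ring⟩
      ring_nf
      positivity
    · obtain ⟨t, ht, rfl⟩ : ∃ y, 0 ≤ y ∧ t = v + y := ⟨t - v, by linarith, by ring⟩
      ring_nf
      positivity

lemma triharmonicWeights_first_minor {u v w : ℝ} (hu : 0 ≤ u) (hv : 0 ≤ v) (hw : 0 ≤ w) :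
    0 ≤ 1008128 * u ^ 6 + 22426944 * u ^ 5 * v + 38805120 * u ^ 5 * w + 35046720 * u ^ 4 * v ^ 2 +
      41940288 * u ^ 4 * v * w - 55072512 * u ^ 4 * w ^ 2 + 40534336 * u ^ 3 * v ^ 3 +
      63174464 * u ^ 3 * v ^ 2 * w - 25152576 * u ^ 3 * v * w ^ 2 + 56661632 * u ^ 3 * w ^ 3 +
      27771008 * u ^ 2 * v ^ 4 + 76174912 * u ^ 2 * v ^ 3 * w + 94345024 * u ^ 2 * v ^ 2 * w ^ 2 +
      192288192 * u ^ 2 * v * w ^ 3 + 53647872 * u ^ 2 * w ^ 4 + 7286272 * u * v ^ 5 +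
      25887936 * u * v ^ 4 * w + 55151872 * u * v ^ 3 * w ^ 2 + 129444416 * u * v ^ 2 * w ^ 3 +
      53647872 * u * v * w ^ 4 + 428992 * v ^ 6 + 1057024 * v ^ 5 * w + 4956224 * v ^ 4 * w ^ 2 +
      23732864 * v ^ 3 * w ^ 3 + 13411968 * v ^ 2 * w ^ 4 := by
  rcases le_total (1/3 * u) w with h | h
  · obtain ⟨t, ht, rfl⟩ : ∃ t, 0 ≤ t ∧ w = 1/3 * u + t := ⟨w - 1/3 * u, by linarith, by ring⟩
    ring_nf
    positivity
  · obtain ⟨t, ht, rfl⟩ : ∃ t, 0 ≤ t ∧ u = 3 * w + t := ⟨u - 3 * w, by linarith, by ring⟩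
    ring_nf
    positivity

lemma triharmonicWeights_second_minor {u v w : ℝ} (hu : 0 ≤ u) (hv : 0 ≤ v) (hw : 0 ≤ w) :
    0 ≤ 4823040 * u ^ 7 * v + 9646080 * u ^ 7 * w + 18182336 * u ^ 6 * v ^ 2 -
      54759680 * u ^ 6 * v * w - 88520960 * u ^ 6 * w ^ 2 + 200787840 * u ^ 5 * v ^ 3 +
      283362816 * u ^ 5 * v ^ 2 * w + 199917696 * u ^ 5 * v * w ^ 2 + 310320384 * u ^ 5 * w ^ 3 +
      248982464 * u ^ 4 * v ^ 4 + 612143424 * u ^ 4 * v ^ 3 * w +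
      781845632 * u ^ 4 * v ^ 2 * w ^ 2 + 1363624576 * u ^ 4 * v * w ^ 3 +
      293911808 * u ^ 4 * w ^ 4 + 149866560 * u ^ 3 * v ^ 5 + 550676736 * u ^ 3 * v ^ 4 * w +
      707190656 * u ^ 3 * v ^ 3 * w ^ 2 + 1861178880 * u ^ 3 * v ^ 2 * w ^ 3 +
      587823616 * u ^ 3 * v * w ^ 4 + 81529088 * u ^ 2 * v ^ 6 + 452377664 * u ^ 2 * v ^ 5 * w +
      652495104 * u ^ 2 * v ^ 4 * w ^ 2 + 1732002560 * u ^ 2 * v ^ 3 * w ^ 3 +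
      739753024 * u ^ 2 * v ^ 2 * w ^ 4 + 24432640 * u * v ^ 7 + 172753344 * u * v ^ 6 * w +
      271446976 * u * v ^ 5 * w ^ 2 + 812618240 * u * v ^ 4 * w ^ 3 +
      445841216 * u * v ^ 3 * w ^ 4 + 2572288 * v ^ 8 + 21177088 * v ^ 7 * w +
      25658496 * v ^ 6 * w ^ 2 + 127150016 * v ^ 5 * w ^ 3 + 91452416 * v ^ 4 * w ^ 4 := by
  rcases le_total (1/3 * u) w with h | h
  · obtain ⟨t, ht, rfl⟩ : ∃ t, 0 ≤ t ∧ w = 1/3 * u + t := ⟨w - 1/3 * u, by linarith, by ring⟩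
    ring_nf
    positivity
  · obtain ⟨t, ht, rfl⟩ : ∃ t, 0 ≤ t ∧ u = 3 * w + t := ⟨u - 3 * w, by linarith, by ring⟩
    ring_nf
    positivity

lemma triharmonicWeights_pair {u v : ℝ} (hu : 0 ≤ u) (hv : 0 ≤ v) (huv : 0 < u + v) (h1 : u + v ≤ 1)
    (m c d : ℝ) : 0 ≤ (triharmonicWeights (u + v)).form v (m + c) d c +
      (triharmonicWeights u).form (-v) (m - c) (-d) (-c) := by
  obtain ⟨w, hw, hw0⟩ : ∃ w, 1 - (u + v) = w ∧ 0 ≤ w := ⟨_, rfl, by linarith⟩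
  have hwu : 1 - u = v + w := by linarith
  have hG : 0 < 10048 * u ^ 3 + 32648 * u ^ 2 * v + 35152 * u ^ 2 * w + 27624 * u * v ^ 2 +
      60256 * u * v * w + 25104 * u * w ^ 2 + 5024 * v ^ 3 + 17576 * v ^ 2 * w +
      12552 * v * w ^ 2 := by
    have : 0 < 5024 * (u + v) ^ 3 := by positivity
    refine this.trans_le (sub_nonneg.1 ?_)
    ring_nf
    positivity
  refine Weights.pair_nonneg
    (A := 104 * u ^ 3 + 1640 * u ^ 2 * v + 2968 * u ^ 2 * w + 2048 * u * v ^ 2 + 5832 * u * v * w +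
      2864 * u * w ^ 2 + 512 * v ^ 3 + 1944 * v ^ 2 * w + 1432 * v * w ^ 2)
    (B := 958 * u ^ 3 * v + 1916 * u ^ 3 * w + 1154 * u ^ 2 * v ^ 2 + 4790 * u ^ 2 * v * w +
      1916 * u ^ 2 * w ^ 2 + 373 * u * v ^ 3 + 3228 * u * v ^ 2 * w + 1916 * u * v * w ^ 2 +
      177 * v ^ 4 + 1293 * v ^ 3 * w + 1116 * v ^ 2 * w ^ 2)
    (C := 480 * u ^ 4 * v + 960 * u ^ 4 * w + 6480 * u ^ 3 * v ^ 2 + 14672 * u ^ 3 * v * w +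
      12752 * u ^ 3 * w ^ 2 + 1640 * u ^ 2 * v ^ 3 + 5848 * u ^ 2 * v ^ 2 * w +
      19128 * u ^ 2 * v * w ^ 2 + 2048 * u * v ^ 4 + 7752 * u * v ^ 3 * w +
      21992 * u * v ^ 2 * w ^ 2 + 512 * v ^ 5 + 2424 * v ^ 4 * w + 7808 * v ^ 3 * w ^ 2)
    (D := -192 * u ^ 3 + 6648 * u ^ 2 * v + 13872 * u ^ 2 * w + 5856 * u * v ^ 2 +
      18144 * u * v * w + 4272 * u * w ^ 2 + 1464 * v ^ 3 + 6048 * v ^ 2 * w + 2136 * v * w ^ 2)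
    (E := 7912 * u ^ 3 * v + 15824 * u ^ 3 * w + 2560 * u ^ 2 * v ^ 2 + 28856 * u ^ 2 * v * w +
      5120 * u ^ 2 * w ^ 2 + 23736 * u * v ^ 2 * w + 5120 * u * v * w ^ 2 + 7912 * v ^ 3 * w +
      2560 * v ^ 2 * w ^ 2)
    (G := 10048 * u ^ 3 + 32648 * u ^ 2 * v + 35152 * u ^ 2 * w + 27624 * u * v ^ 2 +
      60256 * u * v * w + 25104 * u * w ^ 2 + 5024 * v ^ 3 + 17576 * v ^ 2 * w +
      12552 * v * w ^ 2)
    hG ?_ ?_ ?_ ?_ ?_ ?_ ?_ ?_ ?_ m c d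
  · simp only [triharmonicWeights, hwu, hw]
    ring
  · simp only [triharmonicWeights, hwu, hw]
    ring
  · simp only [triharmonicWeights, hwu, hw]
    ring
  · simp only [triharmonicWeights, hwu, hw]
    ring
  · simp only [triharmonicWeights, hwu, hw]
    ring
  · simp only [triharmonicWeights, hwu, hw]
    ring
  · exact (triharmonicWeights_first_minor hu hv hw0).trans_eq (by ring)
  · exact (triharmonicWeights_second_minor hu hv hw0).trans_eq (by ring)
  · exact (triharmonicWeights_det hu hv hw0).trans_eq (by ring)

lemma Weights.pair_nonneg_of_le {W : ℝ → Weights}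
    (hW : ∀ u v, 0 ≤ u → 0 ≤ v → 0 < u + v → u + v ≤ 1 → ∀ m c d,
      0 ≤ (W (u + v)).form v (m + c) d c + (W u).form (-v) (m - c) (-d) (-c))
    {x y : ℝ} (hx : 0 < x) (hx1 : x ≤ 1) (hy : 0 ≤ y) (hy1 : y ≤ 1) (m c d : ℝ) :
    0 ≤ (W x).form (x - y) (m + c) d c + (W y).form (y - x) (m - c) (-d) (-c) := by
  rcases le_total y x with h | h
  · have := hW y (x - y) hy (by linarith) (by linarith) (by linarith) m c d
    rwa [add_sub_cancel, neg_sub] at this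
  · have := hW x (y - x) hx.le (by linarith) (by linarith) (by linarith) m (-c) (-d)
    rwa [add_sub_cancel, neg_sub, sub_neg_eq_add, neg_neg, neg_neg, ← sub_eq_add_neg,
      add_comm] at this

lemma exists_isCertificate_two : ∃ z K κ β w, 0 < z ∧ IsCertificate 2 2 z K κ β w := by
  refine ⟨1, _, 2120, 0, _, one_pos, IsCertificate.of_weights (W := biharmonicWeights) (K := 625)
    (by norm_num) (fun x hx hx1 => ?_) (fun x hx hx1 => ?_) (fun τ a d c => ?_)
    (fun x y hx hx1 hy hy1 m c d => Weights.pair_nonneg_of_le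
      (fun u v hu hv h h1 m c d => biharmonicWeights_pair hu hv h h1 m c d) hx hx1 hy hy1 m c d)
    (fun μ x hμ hx hz M hM => ?_)⟩
  · have h1 : 0 < 1 - x := by linarith
    have h2 : 2120 * (1 - x) ^ 2 + 2410 * (1 - x) * x + 720 * x ^ 2 ≤ 2120 := by nlinarith
    simp only [biharmonicWeights]
    refine ⟨by positivity, (mul_le_mul (pow_le_one₀ hx.le hx1.le) h2 (by positivity)
      zero_le_one).trans_eq (one_mul _)⟩
  · simp only [biharmonicWeights]
    have : 0 < (1 - x) ^ 2 := by nlinarith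
    exact mul_pos (by positivity) (by nlinarith)
  · simp [biharmonicWeights, Weights.form]
  · obtain rfl : μ = 1 - x := by linarith
    have h0 := hM.le_zero_mul 1
    rw [hM.one, hM.top] at h0
    have hb : 0 ≤ 2 * (2120 * (1 - x) ^ 2 + 2410 * (1 - x) * x + 720 * x ^ 2) -
        x * (9735 * (1 - x) + 15 * x) := by
      nlinarith [sq_nonneg (8480 * (1 - x) - 4915 * x)]
    have h1 := mul_nonneg (mul_nonneg (sq_nonneg x) hb) (sub_nonneg.2 h0)
    have h2 : 0 ≤ x * (75 - 25 * x + 40 * x ^ 2 - 25 * x ^ 3) := by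
      refine mul_nonneg hx.le ?_
      nlinarith [pow_le_one₀ (n := 3) hx.le (by linarith : x ≤ 1)]
    simp only [biharmonicWeights, Weights.total, hM.one, hM.top, Nat.add_one_sub_one]
    push_cast
    linarith

lemma triharmonicWeights_bound_aux {r : ℝ} (h0 : 0 ≤ r) (h1 : r ≤ 1) :
    0 ≤ 4784 - 41088 * r + 109408 * r ^ 2 - 56976 * r ^ 3 - 112992 * r ^ 4 +
      78096 * r ^ 5 + 46800 * r ^ 6 - 17688 * r ^ 7 := by
  rcases le_total r (3/10) with ha | ha
  · have hb : 0 ≤ 3/10 - r := sub_nonneg.2 ha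
    have : 0 ≤ 47840000000/2187 * (3/10 - r) ^ 7 + 211616000000/2187 * r * (3/10 - r) ^ 6 +
        121174400000/729 * r ^ 2 * (3/10 - r) ^ 5 +
        302392480000/2187 * r ^ 3 * (3/10 - r) ^ 4 +
        123105568000/2187 * r ^ 4 * (3/10 - r) ^ 3 + 7497185600/729 * r ^ 5 * (3/10 - r) ^ 2 +
        2777501600/2187 * r ^ 6 * (3/10 - r) + 707549144/2187 * r ^ 7 := by
      positivity
    linarith
  rcases le_total r (7/10) with hb | hb
  · have ha : 0 ≤ r - 3/10 := sub_nonneg.2 ha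
    have hb : 0 ≤ 7/10 - r := sub_nonneg.2 hb
    have : 0 ≤ 88443643/2048 * (7/10 - r) ^ 7 + 981662569/2048 * (r - 3/10) * (7/10 - r) ^ 6 +
        8629343183/2048 * (r - 3/10) ^ 2 * (7/10 - r) ^ 5 +
        23355501045/2048 * (r - 3/10) ^ 3 * (7/10 - r) ^ 4 +
        25286035105/2048 * (r - 3/10) ^ 4 * (7/10 - r) ^ 3 +
        10800901547/2048 * (r - 3/10) ^ 5 * (7/10 - r) ^ 2 +
        1339290581/2048 * (r - 3/10) ^ 6 * (7/10 - r) + 168822327/2048 * (r - 3/10) ^ 7 := by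
      positivity
    linarith
  · have ha : 0 ≤ r - 7/10 := sub_nonneg.2 hb
    have hb : 0 ≤ 1 - r := sub_nonneg.2 h1
    have : 0 ≤ 450192872/729 * (1 - r) ^ 7 + 2836281520/729 * (r - 7/10) * (1 - r) ^ 6 +
        5676426400/243 * (r - 7/10) ^ 2 * (1 - r) ^ 5 +
        74714056000/729 * (r - 7/10) ^ 3 * (1 - r) ^ 4 +
        177415760000/729 * (r - 7/10) ^ 4 * (1 - r) ^ 3 +
        73972000000/243 * (r - 7/10) ^ 5 * (1 - r) ^ 2 +
        139064000000/729 * (r - 7/10) ^ 6 * (1 - r) + 34480000000/729 * (r - 7/10) ^ 7 := by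
      positivity
    linarith

lemma exists_isCertificate_three : ∃ z K κ β w, 0 < z ∧ IsCertificate 2 3 z K κ β w := by
  refine ⟨1, _, 1432, 0, _, one_pos,
    IsCertificate.of_weights (W := triharmonicWeights) (K := 1000 / 3)
    (by norm_num) (fun x hx hx1 => ?_) (fun x hx hx1 => ?_) (fun τ a d c => ?_)
    (fun x y hx hx1 hy hy1 m c d => Weights.pair_nonneg_of_le
      (fun u v hu hv h h1 m c d => triharmonicWeights_pair hu hv h h1 m c d) hx hx1 hy hy1 m c d)
    (fun μ x hμ hx hz M hM => ?_)⟩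
  · have h1 : 0 < 1 - x := by linarith
    have h2 : 1432 * (1 - x) ^ 2 + 1944 * (1 - x) * x + 512 * x ^ 2 ≤ 1432 := by nlinarith
    simp only [triharmonicWeights]
    refine ⟨by positivity, (mul_le_mul (pow_le_one₀ hx.le hx1.le) h2 (by positivity)
      zero_le_one).trans_eq (one_mul _)⟩
  · simp only [triharmonicWeights]
    have : 0 < (1 - x) ^ 2 := by nlinarith
    exact mul_pos (by positivity) (by nlinarith)
  · simp [triharmonicWeights, Weights.form]
  · obtain ⟨r, hr, rfl⟩ : ∃ r, 0 < r ∧ μ = r ^ 2 :=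
      ⟨√μ, Real.sqrt_pos.2 hμ, (Real.sq_sqrt hμ.le).symm⟩
    obtain rfl : x = 1 - r ^ 2 := by linarith
    have hr1 : r ≤ 1 := by nlinarith
    have h0 := hM.le_zero_mul 1
    have h3 := hM.sq_le 1
    rw [hM.one] at h0 h3
    rw [hM.top, one_mul] at h3
    have h2 : M 2 ≤ r := le_of_sq_le_sq h3 hr.le
    have h4 : 1 ≤ M 0 * r := h0.trans (mul_le_mul_of_nonneg_left h2 (hM.nonneg 0))
    have hb : 0 ≤ 2 * (1432 * (r ^ 2) ^ 2 + 1944 * r ^ 2 * (1 - r ^ 2) + 512 * (1 - r ^ 2) ^ 2) -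
        (1 - r ^ 2) * (6376 * r ^ 2 + 480 * (1 - r ^ 2)) := by
      nlinarith [sq_nonneg (5728 * r ^ 2 - 2488 * (1 - r ^ 2))]
    have h5 := mul_nonneg (mul_nonneg hr.le (mul_nonneg (sq_nonneg (1 - r ^ 2)) hb))
      (sub_nonneg.2 h4)
    have h6 : 0 ≤ (18 * ((1 - r ^ 2) ^ 2 * (1432 * (r ^ 2) ^ 2 + 1944 * r ^ 2 * (1 - r ^ 2) +
        512 * (1 - r ^ 2) ^ 2)) + (1 - r ^ 2) * (12552 * (r ^ 2) ^ 2 +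
        17576 * r ^ 2 * (1 - r ^ 2) + 5024 * (1 - r ^ 2) ^ 2)) * (r - M 2) :=
      mul_nonneg (by positivity) (sub_nonneg.2 h2)
    have h7 := mul_nonneg hx.le (triharmonicWeights_bound_aux hr.le hr1)
    simp only [triharmonicWeights, Weights.total, hM.top, Nat.add_one_sub_one]
    push_cast
    linarith

end PlaneLowOrder

lemma IsCertificate.exists_pos {n m : ℕ} (hn : 2 ≤ n) (hm : 1 ≤ m) {z : ℝ} (hz : 0 < z) :
    ∃ K κ β w, IsCertificate n (m + 1) z K κ β w := by
  refine exists_of_exists hm ?_ hz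
  rcases hn.eq_or_lt with rfl | hn
  · rcases le_or_gt 3 m with h3 | h3
    · exact exists_isCertificate_of_four_le h3
    · interval_cases m
      · exact exists_isCertificate_two
      · exact exists_isCertificate_three
  · exact exists_isCertificate_of_three_le hn hm

namespace IsWeyl

variable {E : Type*} [AddCommGroup E] [Module ℝ E] [Nontrivial E] {n : ℕ}
  {I : E →ₗ[ℝ] E →ₗ[ℝ] ℝ} {D X : Fin n → E →ₗ[ℝ] E} {R : ℝ}

lemma eigenvalue_nonneg (h : IsWeyl I D X R) (hR : 0 ≤ R) (hn : 0 < n) (m k : ℕ) :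
    0 ≤ eigenvalue I D m (k + 1) := by
  refine le_of_forall_pos_le_add fun ε hε => ?_
  obtain ⟨u, ν, hap, hν⟩ := h.exists_isApprox hR hn m (k + 1) hε
  have h1 := (hap.isMoment h (Fin.last k)).pos (m + 1)
  rw [(hap.isMoment h _).top] at h1
  exact h1.le.trans (hν (Fin.last k)).2

/-- The universal inequality for the variational eigenvalues of a Weyl system. -/
lemma sum_eigenvalue_le (h : IsWeyl I D X R) (hR : 0 ≤ R) (hn : 2 ≤ n) {m : ℕ} (hm : 1 ≤ m)
    (k : ℕ) :
    (n : ℝ) ^ 2 * ∑ i ∈ Finset.Icc 1 k, (eigenvalue I D m (k + 1) - eigenvalue I D m i) ^ 2 ≤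
      4 * (m * (2 * m + n)) * ∑ i ∈ Finset.Icc 1 k,
        (eigenvalue I D m (k + 1) - eigenvalue I D m i) * eigenvalue I D m i := by
  set Λ := eigenvalue I D m
  have hn0 : 0 < n := by omega
  have hmono : ∀ {i j}, i ≤ j → Λ (i + 1) ≤ Λ (j + 1) := h.eigenvalue_mono hR hn0 m
  classical
  have hex : ∃ j, Λ (k + 1) ≤ Λ (j + 1) := ⟨k, le_rfl⟩
  obtain ⟨j, hj, hlt⟩ : ∃ j, Λ (k + 1) ≤ Λ (j + 1) ∧ ∀ i < j, Λ (i + 1) < Λ (k + 1) :=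
    ⟨Nat.find hex, Nat.find_spec hex, fun i hi => not_le.1 (Nat.find_min hex hi)⟩
  have hjk : j ≤ k := by
    by_contra! hc
    exact lt_irrefl _ (hlt k hc)
  have hz : Λ (j + 1) = Λ (k + 1) := le_antisymm (hmono hjk) hj
  have hsum : ∀ f : ℝ → ℝ, f (Λ (k + 1)) = 0 →
      ∑ i ∈ Finset.Icc 1 k, f (Λ i) = ∑ i : Fin j, f (Λ (i + 1)) := by
    intro f hf
    rw [Fin.sum_univ_eq_sum_range fun i => f (Λ (i + 1)), ← Finset.Ico_add_one_right_eq_Icc,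
      Finset.sum_Ico_eq_sum_range]
    simp only [add_comm 1, Nat.add_sub_cancel]
    refine (Finset.sum_subset (Finset.range_subset_range.2 hjk) fun i hi hij => ?_).symm
    rw [Finset.mem_range] at hi
    rw [Finset.mem_range, not_lt] at hij
    rw [le_antisymm (hmono hi.le) (hz.symm.trans_le (hmono hij)), hf]
  rw [hsum (fun t => (Λ (k + 1) - t) ^ 2) (by simp),
    hsum (fun t => (Λ (k + 1) - t) * t) (by simp)]
  rcases j.eq_zero_or_pos with rfl | hj0
  · simp
  have hpos : 0 < Λ (j + 1) := by
    rw [hz]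
    exact (h.eigenvalue_nonneg hR hn0 m 0).trans_lt (hlt 0 hj0)
  obtain ⟨K, κ, β, w, hc⟩ := IsCertificate.exists_pos hn hm hpos
  rw [← hz] at hlt ⊢
  exact h.sum_le_of_isCertificate hR hn0 hlt hc

end IsWeyl

section TestSpace

variable {n : ℕ} {Ω : Set (EuclideanSpace ℝ (Fin n))}

/-- The space of smooth functions with compact support in `Ω`. -/
def testSpace (Ω : Set (EuclideanSpace ℝ (Fin n))) :
    Submodule ℝ (EuclideanSpace ℝ (Fin n) → ℝ) where
  carrier := {f | ContDiff ℝ (⊤ : ℕ∞) f ∧ HasCompactSupport f ∧ tsupport f ⊆ Ω}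
  add_mem' := fun ⟨h1, h2, h3⟩ ⟨h4, h5, h6⟩ =>
    ⟨h1.add h4, h2.add h5, (tsupport_add _ _).trans (Set.union_subset h3 h6)⟩
  zero_mem' := ⟨contDiff_const, HasCompactSupport.zero, by simp [tsupport]⟩
  smul_mem' := fun c f ⟨h1, h2, h3⟩ =>
    ⟨contDiff_const.smul h1, h2.smul_left (f := fun _ => c),
      (tsupport_smul_subset_right (fun _ => c) f).trans h3⟩

namespace testSpace

lemma contDiff (f : testSpace Ω) : ContDiff ℝ (⊤ : ℕ∞) (f : EuclideanSpace ℝ (Fin n) → ℝ) :=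
  f.2.1

lemma hasCompactSupport (f : testSpace Ω) :
    HasCompactSupport (f : EuclideanSpace ℝ (Fin n) → ℝ) :=
  f.2.2.1

lemma differentiable (f : testSpace Ω) :
    Differentiable ℝ (f : EuclideanSpace ℝ (Fin n) → ℝ) :=
  (contDiff f).differentiable (by simp)

lemma eq_zero_of_notMem (f : testSpace Ω) {x : EuclideanSpace ℝ (Fin n)} (hx : x ∉ Ω) :
    (f : EuclideanSpace ℝ (Fin n) → ℝ) x = 0 :=
  image_eq_zero_of_notMem_tsupport fun h => hx (f.2.2.2 h)

lemma integrable_mul (f g : testSpace Ω) :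
    Integrable fun x => (f : EuclideanSpace ℝ (Fin n) → ℝ) x * g.1 x :=
  ((contDiff f).continuous.mul (contDiff g).continuous).integrable_of_hasCompactSupport
    (hasCompactSupport f).mul_right

/-- The partial derivatives of test functions. -/
noncomputable def partialDeriv (p : Fin n) : testSpace Ω →ₗ[ℝ] testSpace Ω where
  toFun f := ⟨fun x => fderiv ℝ f.1 x (EuclideanSpace.single p 1),
    ((contDiff f).fderiv_right (by simp)).clm_apply contDiff_const,
    (hasCompactSupport f).fderiv_apply ℝ _, (tsupport_fderiv_apply_subset ℝ _).trans f.2.2.2⟩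
  map_add' f g := by
    ext x
    simp [fderiv_add (differentiable f).differentiableAt (differentiable g).differentiableAt]
  map_smul' c f := by
    ext x
    simp [fderiv_const_smul (differentiable f).differentiableAt]

/-- The multiplication of test functions by coordinates. -/
def coordMul (p : Fin n) : testSpace Ω →ₗ[ℝ] testSpace Ω where
  toFun f := ⟨fun x => x p * f.1 x, (by fun_prop : ContDiff ℝ _ _).mul (contDiff f),
    (hasCompactSupport f).mul_left, (tsupport_mul_subset_right).trans f.2.2.2⟩
  map_add' f g := by
    ext x
    simp [mul_add]
  map_smul' c f := by
    ext x
    simp [mul_left_comm]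

variable (Ω) in
/-- The `L²` inner product of test functions. -/
noncomputable def integralForm : testSpace Ω →ₗ[ℝ] testSpace Ω →ₗ[ℝ] ℝ :=
  LinearMap.mk₂ ℝ (fun f g => ∫ x, f.1 x * g.1 x)
    (fun f₁ f₂ g => by
      simp only [Submodule.coe_add, Pi.add_apply, add_mul]
      exact integral_add (integrable_mul f₁ g) (integrable_mul f₂ g))
    (fun c f g => by simp [mul_assoc, integral_const_mul])
    (fun f g₁ g₂ => by
      simp only [Submodule.coe_add, Pi.add_apply, mul_add]
      exact integral_add (integrable_mul f g₁) (integrable_mul f g₂))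
    (fun c f g => by simp [mul_left_comm, integral_const_mul])

lemma integralForm_apply (f g : testSpace Ω) : integralForm Ω f g = ∫ x, f.1 x * g.1 x :=
  rfl

lemma partialDeriv_apply (p : Fin n) (f : testSpace Ω) (x : EuclideanSpace ℝ (Fin n)) :
    (partialDeriv p f).1 x = fderiv ℝ f.1 x (EuclideanSpace.single p 1) :=
  rfl

lemma coordMul_apply (p : Fin n) (f : testSpace Ω) (x : EuclideanSpace ℝ (Fin n)) :
    (coordMul p f).1 x = x p * f.1 x :=
  rfl

lemma isWeyl {r : ℝ} (hr : ∀ x ∈ Ω, ‖x‖ ≤ r) :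
    IsWeyl (integralForm Ω) partialDeriv coordMul (r ^ 2) where
  symm f g := by simp only [integralForm_apply, mul_comm]
  nonneg f := integral_nonneg fun x => mul_self_nonneg _
  definite f hf := by
    ext x
    by_contra hx
    refine (Continuous.integral_pos_of_hasCompactSupport_nonneg_nonzero (μ := volume)
      ((contDiff f).continuous.mul (contDiff f).continuous) (hasCompactSupport f).mul_right
      (fun x => mul_self_nonneg _) (x := x) (mul_self_ne_zero.2 hx)).ne' hf
  D_skew p f g := by
    simp only [integralForm_apply, partialDeriv_apply]
    rw [integral_mul_fderiv_eq_neg_fderiv_mul_of_integrable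
      (integrable_mul (partialDeriv p f) g) (integrable_mul f (partialDeriv p g))
      (integrable_mul f g) (fun x _ => differentiable f x) (fun x _ => differentiable g x),
      neg_neg]
  X_symm p f g := by
    simp only [integralForm_apply, coordMul_apply, mul_left_comm, mul_assoc]
  comm p q f := by
    ext x
    have h1 : HasFDerivAt (fun y : EuclideanSpace ℝ (Fin n) => y q)
        (EuclideanSpace.proj q : EuclideanSpace ℝ (Fin n) →L[ℝ] ℝ) x :=
      (EuclideanSpace.proj q : EuclideanSpace ℝ (Fin n) →L[ℝ] ℝ).hasFDerivAt
    have h2 := h1.mul ((differentiable f) x).hasFDerivAt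
    simp only [Submodule.coe_add, Pi.add_apply, partialDeriv_apply, coordMul_apply]
    have h3 : fderiv ℝ (coordMul q f).1 x = _ := h2.fderiv
    rw [h3]
    split_ifs with hpq
    · subst hpq
      simp [mul_comm]
    · simp [hpq, eq_comm]
  D_comm p q f := by
    ext x
    have h1 : ∀ v w : EuclideanSpace ℝ (Fin n),
        fderiv ℝ (fun y => fderiv ℝ f.1 y v) x w = fderiv ℝ (fderiv ℝ f.1) x w v := by
      intro v w
      have : DifferentiableAt ℝ (fderiv ℝ f.1) x :=
        ((contDiff f).fderiv_right (m := 1) (by norm_cast)).differentiable (by simp) x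
      rw [fderiv_clm_apply this (differentiableAt_const v)]
      simp
    exact (h1 _ _).trans ((((contDiff f).contDiffAt.isSymmSndFDerivAt
      (by simpa using WithTop.coe_le_coe.2 (le_top : (2 : ℕ∞) ≤ ⊤))).eq _ _).trans
      (h1 _ _).symm)
  X_bdd p f := by
    simp only [integralForm_apply, coordMul_apply]
    rw [← integral_const_mul]
    refine integral_mono (integrable_mul (coordMul p f) (coordMul p f))
      ((integrable_mul f f).const_mul _) fun x => ?_
    by_cases hx : x ∈ Ω
    · have h1 : x p ^ 2 ≤ r ^ 2 := by
        rw [← sq_abs]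
        exact pow_le_pow_left₀ (abs_nonneg _)
          ((PiLp.norm_apply_le x p).trans (hr x hx)) 2
      have := mul_le_mul_of_nonneg_right h1 (mul_self_nonneg (f.1 x))
      simp only
      linarith
    · simp [eq_zero_of_notMem f hx]

lemma nontrivial (hΩ : IsOpen Ω) (hne : Ω.Nonempty) : Nontrivial (testSpace Ω) := by
  obtain ⟨x, hx⟩ := hne
  obtain ⟨f, h1, h2, h3, -, h4⟩ := exists_contDiff_tsupport_subset (n := ⊤) (hΩ.mem_nhds hx)
  refine ⟨⟨f, h3, h2, h1⟩, 0, fun h => ?_⟩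
  have : f x = 0 := congrFun (congrArg Subtype.val h) x
  rw [h4] at this
  exact one_ne_zero this

lemma coe_weylLap (f : testSpace Ω) : (weylLap partialDeriv f).1 = negLap f.1 := by
  ext x
  simp [weylLap_apply, negLap, lap, partialDeriv_apply]
  rfl

lemma coe_weylLap_pow (s : ℕ) (f : testSpace Ω) :
    ((weylLap partialDeriv ^ s) f).1 = negLap^[s] f.1 := by
  induction s with
  | zero => rfl
  | succ s ih =>
    rw [pow_succ', Module.End.mul_apply, coe_weylLap, ih, Function.iterate_succ_apply']

lemma integral_norm_gradient_sq {r : ℝ} (hr : ∀ x ∈ Ω, ‖x‖ ≤ r) (f : testSpace Ω) :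
    ∫ x, ‖gradient f.1 x‖ ^ 2 = integralForm Ω f (weylLap partialDeriv f) := by
  rw [(isWeyl hr).inner_lap]
  simp only [integralForm_apply]
  rw [← integral_finsetSum _ fun p _ => integrable_mul (partialDeriv p f) (partialDeriv p f)]
  congr 1 with x
  rw [EuclideanSpace.real_norm_sq_eq]
  refine Finset.sum_congr rfl fun p _ => ?_
  rw [partialDeriv_apply, ← toDual_gradient, InnerProductSpace.toDual_apply_apply,
    real_inner_comm, EuclideanSpace.inner_single_left]
  simp [sq]

lemma bucklingEigenvalue_eq {r : ℝ} (hr : ∀ x ∈ Ω, ‖x‖ ≤ r) (m j : ℕ) :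
    bucklingEigenvalue n (m + 1) Ω j =
      IsWeyl.eigenvalue (integralForm Ω) partialDeriv m j := by
  have hset : ∀ V : Submodule ℝ (testSpace Ω),
      {s : ℝ | ∃ φ ∈ V.map (testSpace Ω).subtype, φ ≠ 0 ∧
        s = (∫ x, φ x * (negLap^[m + 1] φ) x) / (∫ x, ‖gradient φ x‖ ^ 2)} =
      {s : ℝ | ∃ φ ∈ V, φ ≠ 0 ∧
        s = ((integralForm Ω).compl₂ (weylLap partialDeriv)) φ ((weylLap partialDeriv ^ m) φ) /
          ((integralForm Ω).compl₂ (weylLap partialDeriv)) φ φ} := by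
    intro V
    ext s
    simp only [Set.mem_ofPred_eq, Submodule.mem_map, exists_exists_and_eq_and,
      Submodule.coe_subtype, LinearMap.compl₂_apply, ne_eq, ZeroMemClass.coe_eq_zero,
      integral_norm_gradient_sq hr, ← Module.End.mul_apply, ← pow_succ', ← coe_weylLap_pow]
    rfl
  unfold bucklingEigenvalue IsWeyl.eigenvalue formMinMax
  congr 1
  ext s
  constructor
  · rintro ⟨V, hV, hVΩ, rfl⟩
    have hle : V ≤ testSpace Ω := hVΩ
    refine ⟨V.comap (testSpace Ω).subtype, ?_, ?_⟩
    · rw [(Submodule.comapSubtypeEquivOfLe hle).finrank_eq, hV]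
    · rw [← hset, Submodule.map_comap_subtype, inf_eq_right.2 hle]
  · rintro ⟨V, hV, rfl⟩
    refine ⟨V.map (testSpace Ω).subtype, ?_, ?_, ?_⟩
    · rw [Submodule.finrank_map_subtype_eq, hV]
    · exact Submodule.map_subtype_le (testSpace Ω) V
    · rw [hset]

end testSpace

end TestSpace

theorem buckling_yang_type_inequality (n l : ℕ) (hn : 2 ≤ n) (hl : 2 ≤ l)
    (Ω : Set (EuclideanSpace ℝ (Fin n))) (hΩo : IsOpen Ω) (hΩc : IsConnected Ω)
    (hΩb : Bornology.IsBounded Ω)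
    (Λ : ℕ → ℝ) (hΛ : ∀ m, Λ m = bucklingEigenvalue n l Ω m)
    (k : ℕ) (hk : 1 ≤ k) :
    ∑ i ∈ Finset.Icc 1 k, (Λ (k + 1) - Λ i) ^ 2 ≤
      (4 * (2 * (l : ℝ) ^ 2 + ((n : ℝ) - 4) * l + 2 - n) / (n : ℝ) ^ 2) *
        ∑ i ∈ Finset.Icc 1 k, (Λ (k + 1) - Λ i) * Λ i := by
  obtain ⟨m, rfl⟩ : ∃ m, l = m + 1 := ⟨l - 1, by omega⟩
  obtain ⟨r, hr⟩ := hΩb.exists_norm_le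
  have := testSpace.nontrivial hΩo hΩc.nonempty
  have h := (testSpace.isWeyl hr).sum_eigenvalue_le (sq_nonneg r) hn (m := m) (by omega) k
  simp only [← testSpace.bucklingEigenvalue_eq hr, ← hΛ] at h
  rw [div_mul_eq_mul_div, le_div_iff₀ (by positivity)]
  push_cast
  linarith
end

section
/- Let u : ℝ^n → ℝ be a smooth (C^∞) function with compact support. Then for every integer k ≥ 1, ∫_{ℝ^n} u·(−Δ)^k u ≤ (∫_{ℝ^n} u·(−Δ)^{k−1} u)^{1/2} · (∫_{ℝ^n} u·(−Δ)^{k+1} u)^{1/2}, where (−Δ)^k denotes the k-th iterate of the negative Euclidean Laplacian. -/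
open MeasureTheory

section NegLap

variable {n : ℕ} {f g : EuclideanSpace ℝ (Fin n) → ℝ}

lemma ContDiff.fderiv_apply_const_of_top (hf : ContDiff ℝ (⊤ : ℕ∞) f)
    (v : EuclideanSpace ℝ (Fin n)) : ContDiff ℝ (⊤ : ℕ∞) (fun x => fderiv ℝ f x v) :=
  (hf.fderiv_right (m := (⊤ : ℕ∞)) (by simp)).clm_apply contDiff_const

lemma ContDiff.negLap (hf : ContDiff ℝ (⊤ : ℕ∞) f) : ContDiff ℝ (⊤ : ℕ∞) (negLap f) :=
  (ContDiff.sum fun _ _ =>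
    (hf.fderiv_apply_const_of_top _).fderiv_apply_const_of_top _).neg

lemma HasCompactSupport.negLap (hf : HasCompactSupport f) : HasCompactSupport (negLap f) := by
  refine hf.mono' fun x hx => ?_
  contrapose! hx
  have h : ∀ i : Fin n, fderiv ℝ (fun y => fderiv ℝ f y (EuclideanSpace.single i 1)) x = 0 := by
    intro i
    refine image_eq_zero_of_notMem_tsupport fun h => hx ?_
    exact tsupport_fderiv_apply_subset ℝ _ (tsupport_fderiv_subset ℝ h)
  simp [_root_.negLap, lap, h]

lemma ContDiff.negLap_iterate (hf : ContDiff ℝ (⊤ : ℕ∞) f) (j : ℕ) :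
    ContDiff ℝ (⊤ : ℕ∞) (_root_.negLap^[j] f) := by
  induction j with
  | zero => exact hf
  | succ j ih => rw [Function.iterate_succ_apply']; exact ih.negLap

lemma HasCompactSupport.negLap_iterate (hf : HasCompactSupport f) (j : ℕ) :
    HasCompactSupport (_root_.negLap^[j] f) := by
  induction j with
  | zero => exact hf
  | succ j ih => rw [Function.iterate_succ_apply']; exact ih.negLap

lemma negLap_add_const_mul (hf : ContDiff ℝ (⊤ : ℕ∞) f) (hg : ContDiff ℝ (⊤ : ℕ∞) g) (t : ℝ) :
    negLap (fun x => f x + t * g x) = fun x => negLap f x + t * negLap g x := by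
  have h : ∀ {f g : EuclideanSpace ℝ (Fin n) → ℝ}, ContDiff ℝ (⊤ : ℕ∞) f →
      ContDiff ℝ (⊤ : ℕ∞) g → ∀ x v, fderiv ℝ (fun x => f x + t * g x) x v =
        fderiv ℝ f x v + t * fderiv ℝ g x v := by
    intro f g hf hg x v
    have hf' : DifferentiableAt ℝ f x := hf.differentiable (by simp) x
    have hg' : DifferentiableAt ℝ g x := hg.differentiable (by simp) x
    rw [fderiv_fun_add hf' (hg'.const_mul t), fderiv_const_mul hg']
    simp
  ext x
  simp only [negLap, lap, h hf hg,
    h (hf.fderiv_apply_const_of_top _) (hg.fderiv_apply_const_of_top _),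
    Finset.sum_add_distrib, ← Finset.mul_sum]
  ring

lemma negLap_iterate_add_const_mul (hf : ContDiff ℝ (⊤ : ℕ∞) f) (hg : ContDiff ℝ (⊤ : ℕ∞) g)
    (t : ℝ) (j : ℕ) :
    negLap^[j] (fun x => f x + t * g x) = fun x => (negLap^[j] f) x + t * (negLap^[j] g) x := by
  induction j with
  | zero => rfl
  | succ j ih =>
    simp only [Function.iterate_succ_apply', ih]
    exact negLap_add_const_mul (hf.negLap_iterate j) (hg.negLap_iterate j) t

lemma integrable_mul_of_hasCompactSupport_left (hf : ContDiff ℝ (⊤ : ℕ∞) f)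
    (hfs : HasCompactSupport f) (hg : ContDiff ℝ (⊤ : ℕ∞) g) :
    Integrable (fun x => f x * g x) :=
  (hf.continuous.mul hg.continuous).integrable_of_hasCompactSupport hfs.mul_right

/-- Green's first identity for a compactly supported factor. -/
lemma integral_mul_negLap (hf : ContDiff ℝ (⊤ : ℕ∞) f) (hfs : HasCompactSupport f)
    (hg : ContDiff ℝ (⊤ : ℕ∞) g) :
    ∫ x, f x * negLap g x = ∑ i : Fin n, ∫ x,
      fderiv ℝ f x (EuclideanSpace.single i 1) * fderiv ℝ g x (EuclideanSpace.single i 1) := by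
  simp only [negLap, lap, mul_neg, Finset.mul_sum]
  rw [integral_neg, integral_finsetSum _ fun i _ =>
    integrable_mul_of_hasCompactSupport_left hf hfs
      ((hg.fderiv_apply_const_of_top _).fderiv_apply_const_of_top _), ← Finset.sum_neg_distrib]
  refine Finset.sum_congr rfl fun i _ => ?_
  have hg' := hg.fderiv_apply_const_of_top (EuclideanSpace.single i 1)
  rw [integral_mul_fderiv_eq_neg_fderiv_mul_of_integrable
    (integrable_mul_of_hasCompactSupport_left (hf.fderiv_apply_const_of_top _)
      (hfs.fderiv_apply ℝ _) hg')
    (integrable_mul_of_hasCompactSupport_left hf hfs (hg'.fderiv_apply_const_of_top _))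
    (integrable_mul_of_hasCompactSupport_left hf hfs hg')
    (fun x _ => hf.differentiable (by simp) x) (fun x _ => hg'.differentiable (by simp) x), neg_neg]

lemma integral_mul_negLap_comm (hf : ContDiff ℝ (⊤ : ℕ∞) f) (hfs : HasCompactSupport f)
    (hg : ContDiff ℝ (⊤ : ℕ∞) g) (hgs : HasCompactSupport g) :
    ∫ x, f x * negLap g x = ∫ x, negLap f x * g x := by
  simp_rw [mul_comm (negLap f _)]
  rw [integral_mul_negLap hf hfs hg, integral_mul_negLap hg hgs hf]
  simp_rw [mul_comm]

lemma integral_mul_negLap_iterate_succ (hf : ContDiff ℝ (⊤ : ℕ∞) f) (hfs : HasCompactSupport f)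
    (hg : ContDiff ℝ (⊤ : ℕ∞) g) (hgs : HasCompactSupport g) (j : ℕ) :
    ∫ x, f x * (negLap^[j + 1] g) x = ∫ x, negLap f x * (negLap^[j] g) x := by
  rw [Function.iterate_succ_apply']
  exact integral_mul_negLap_comm hf hfs (hg.negLap_iterate j) (hgs.negLap_iterate j)

lemma integral_mul_negLap_iterate_nonneg (j : ℕ) (hf : ContDiff ℝ (⊤ : ℕ∞) f)
    (hfs : HasCompactSupport f) : 0 ≤ ∫ x, f x * (negLap^[j] f) x := by
  induction j using Nat.twoStepInduction generalizing f with
  | zero => exact integral_nonneg fun x => mul_self_nonneg (f x)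
  | one =>
    rw [Function.iterate_one, integral_mul_negLap hf hfs hf]
    exact Finset.sum_nonneg fun i _ => integral_nonneg fun x => mul_self_nonneg _
  | more j ih _ =>
    rw [integral_mul_negLap_iterate_succ hf hfs hf hfs]
    exact ih hf.negLap hfs.negLap

end NegLap

theorem integral_mul_negLap_iterate_log_convex {n : ℕ} (u : EuclideanSpace ℝ (Fin n) → ℝ)
    (hu : ContDiff ℝ (⊤ : ℕ∞) u) (hsupp : HasCompactSupport u) (k : ℕ) (hk : 1 ≤ k) :
    ∫ x, u x * (negLap^[k] u) x ≤
      Real.sqrt (∫ x, u x * (negLap^[k - 1] u) x) *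
        Real.sqrt (∫ x, u x * (negLap^[k + 1] u) x) := by
  obtain ⟨j, rfl⟩ := Nat.exists_eq_add_of_le' hk
  rw [Nat.add_sub_cancel, ← Real.sqrt_mul (integral_mul_negLap_iterate_nonneg j hu hsupp)]
  apply Real.le_sqrt_of_sq_le
  have hint : ∀ {f : EuclideanSpace ℝ (Fin n) → ℝ}, ContDiff ℝ (⊤ : ℕ∞) f →
      HasCompactSupport f → ∀ i, Integrable fun x => f x * (negLap^[i] u) x :=
    fun hf hfs i => integrable_mul_of_hasCompactSupport_left hf hfs (hu.negLap_iterate i)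
  have key : ∀ t : ℝ, 0 ≤ (∫ x, u x * (negLap^[j + 1 + 1] u) x) * (t * t) +
      (2 * ∫ x, u x * (negLap^[j + 1] u) x) * t + ∫ x, u x * (negLap^[j] u) x := by
    intro t
    have h := integral_mul_negLap_iterate_nonneg j
      (hu.add (contDiff_const.mul hu.negLap : ContDiff ℝ _ fun x => t * negLap u x))
      (hsupp.add hsupp.negLap.mul_left)
    have hexp : ∀ x, (u x + t * negLap u x) *
        (negLap^[j] (fun x => u x + t * negLap u x)) x =
          u x * (negLap^[j] u) x + t * (u x * (negLap^[j + 1] u) x) +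
          (t * (negLap u x * (negLap^[j] u) x) +
            t * t * (negLap u x * (negLap^[j + 1] u) x)) := by
      intro x
      rw [negLap_iterate_add_const_mul hu hu.negLap, ← Function.iterate_succ_apply]
      ring
    have hi₀ := hint hu hsupp j
    have hi₁ := (hint hu hsupp (j + 1)).const_mul t
    have hi₂ := (hint hu.negLap hsupp.negLap j).const_mul t
    have hi₃ := (hint hu.negLap hsupp.negLap (j + 1)).const_mul (t * t)
    change 0 ≤ ∫ x, (u x + t * negLap u x) *
      (negLap^[j] (fun x => u x + t * negLap u x)) x at h
    rw [integral_congr_ae (.of_forall hexp),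
      integral_add (by exact hi₀.add hi₁) (by exact hi₂.add hi₃),
      integral_add hi₀ hi₁, integral_add hi₂ hi₃, integral_const_mul, integral_const_mul,
      integral_const_mul, ← integral_mul_negLap_iterate_succ hu hsupp hu hsupp,
      ← integral_mul_negLap_iterate_succ hu hsupp hu hsupp] at h
    linarith
  have hd := discrim_le_zero key
  rw [discrim] at hd
  linarith
end

section
/- Let m ≥ 1 and let {a_i}_{i=1}^m, {b_i}_{i=1}^m, {c_i}_{i=1}^m be sequences of nonnegative real numbers such that {a_i} is nonincreasing (a_1 ≥ a_2 ≥ … ≥ a_m) and {b_i} and {c_i} are nondecreasing (b_1 ≤ … ≤ b_m and c_1 ≤ … ≤ c_m). Then (Σ_{i=1}^m a_i² b_i)·(Σ_{i=1}^m a_i c_i) ≤ (Σ_{i=1}^m a_i²)·(Σ_{i=1}^m a_i b_i c_i). -/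
theorem chebyshev_type_three_sequences (m : ℕ) (hm : 1 ≤ m)
    (a b c : Fin m → ℝ)
    (ha_nonneg : ∀ i, 0 ≤ a i) (hb_nonneg : ∀ i, 0 ≤ b i) (hc_nonneg : ∀ i, 0 ≤ c i)
    (ha : Antitone a) (hb : Monotone b) (hc : Monotone c) :
    (∑ i, a i ^ 2 * b i) * (∑ i, a i * c i) ≤
      (∑ i, a i ^ 2) * (∑ i, a i * b i * c i) := by
  have cross_le {i j : Fin m} (hij : i ≤ j) : a j * c i ≤ a i * c j :=
    mul_le_mul (ha hij) (hc hij) (hc_nonneg i) (ha_nonneg i)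
  have term_nonneg (i j : Fin m) :
      0 ≤ a i * a j * ((b j - b i) * (a i * c j - a j * c i)) := by
    refine mul_nonneg (mul_nonneg (ha_nonneg i) (ha_nonneg j)) ?_
    rcases le_total i j with hij | hji
    · exact mul_nonneg (sub_nonneg.2 (hb hij)) (sub_nonneg.2 (cross_le hij))
    · exact mul_nonneg_of_nonpos_of_nonpos (sub_nonpos.2 (hb hji))
        (sub_nonpos.2 (cross_le hji))
  have difference_eq :
      (∑ i, a i ^ 2) * (∑ i, a i * b i * c i) - (∑ i, a i ^ 2 * b i) * (∑ i, a i * c i) =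
        ∑ i, ∑ j, a i ^ 2 * (a j * c j) * (b j - b i) := by
    simp only [Finset.sum_mul_sum, ← Finset.sum_sub_distrib]
    refine Finset.sum_congr rfl fun i _ => Finset.sum_congr rfl fun j _ => ?_
    ring
  have symmetrized :
      (∑ i, ∑ j, a i ^ 2 * (a j * c j) * (b j - b i)) +
          ∑ i, ∑ j, a i ^ 2 * (a j * c j) * (b j - b i) =
        ∑ i, ∑ j, a i * a j * ((b j - b i) * (a i * c j - a j * c i)) := by
    conv_lhs => arg 2; rw [Finset.sum_comm]
    simp only [← Finset.sum_add_distrib]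
    refine Finset.sum_congr rfl fun i _ => Finset.sum_congr rfl fun j _ => ?_
    ring
  have sum_nonneg := Finset.sum_nonneg fun i (_ : i ∈ Finset.univ) =>
    Finset.sum_nonneg fun j (_ : j ∈ Finset.univ) => term_nonneg i j
  linarith
end

section
/- Let l ≥ 2 be an integer, let u : ℝ^n → ℝ be smooth (C^∞) with compact support, and let α ∈ {1, …, n}. Then ∫_{ℝ^n} x_α·u·∂(Δ^{l−1}u)/∂x_α = ∫_{ℝ^n} [ (l−1)·(∂(Δ^{l−2}u)/∂x_α)·(∂u/∂x_α) − (1/2)·u·Δ^{l−1}u ], where Δ is the Euclidean Laplacian and x_α the α-th coordinate function. -/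
open MeasureTheory

open scoped ContDiff

section DirectionalDerivative

variable {n : ℕ}

/-- The `i`-th partial derivative of a function on `ℝⁿ`. -/
noncomputable def partialDeriv (i : Fin n) (f : EuclideanSpace ℝ (Fin n) → ℝ) :
    EuclideanSpace ℝ (Fin n) → ℝ :=
  fun x => fderiv ℝ f x (EuclideanSpace.single i 1)

variable {f g : EuclideanSpace ℝ (Fin n) → ℝ}

lemma lap_eq_sum_partialDeriv (f : EuclideanSpace ℝ (Fin n) → ℝ) :
    lap f = ∑ i, partialDeriv i (partialDeriv i f) := by
  ext x
  simp only [lap, Finset.sum_apply]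
  rfl

lemma contDiff_partialDeriv (i : Fin n) (hf : ContDiff ℝ ∞ f) :
    ContDiff ℝ ∞ (partialDeriv i f) :=
  (hf.fderiv_right (m := ∞) (by simp)).clm_apply contDiff_const

lemma contDiff_lap (hf : ContDiff ℝ ∞ f) : ContDiff ℝ ∞ (lap f) :=
  ContDiff.sum fun i _ => contDiff_partialDeriv i (contDiff_partialDeriv i hf)

lemma contDiff_lap_iterate (hf : ContDiff ℝ ∞ f) (k : ℕ) : ContDiff ℝ ∞ (lap^[k] f) := by
  induction k with
  | zero => exact hf
  | succ k ih => rw [Function.iterate_succ_apply']; exact contDiff_lap ih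

lemma hasCompactSupport_partialDeriv (i : Fin n) (hf : HasCompactSupport f) :
    HasCompactSupport (partialDeriv i f) :=
  hf.fderiv_apply ℝ _

lemma contDiff_coord (a : Fin n) : ContDiff ℝ ∞ fun x : EuclideanSpace ℝ (Fin n) => x a :=
  (EuclideanSpace.proj a : EuclideanSpace ℝ (Fin n) →L[ℝ] ℝ).contDiff

lemma contDiff_coord_mul (a : Fin n) (hf : ContDiff ℝ ∞ f) :
    ContDiff ℝ ∞ fun x => x a * f x :=
  (contDiff_coord a).mul hf

lemma contDiff_real_smul (c : ℝ) (hf : ContDiff ℝ ∞ f) : ContDiff ℝ ∞ (c • f) :=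
  hf.const_smul c

lemma partialDeriv_add (i : Fin n) (hf : ContDiff ℝ ∞ f) (hg : ContDiff ℝ ∞ g) :
    partialDeriv i (f + g) = partialDeriv i f + partialDeriv i g := by
  ext x
  simp [partialDeriv, fderiv_add (hf.differentiable (by simp) x) (hg.differentiable (by simp) x)]

lemma partialDeriv_smul (i : Fin n) (c : ℝ) (hf : ContDiff ℝ ∞ f) :
    partialDeriv i (c • f) = c • partialDeriv i f := by
  ext x
  simp [partialDeriv, fderiv_const_smul (hf.differentiable (by simp) x)]

lemma partialDeriv_sum {ι : Type*} (s : Finset ι) (i : Fin n)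
    {F : ι → EuclideanSpace ℝ (Fin n) → ℝ} (hF : ∀ j ∈ s, ContDiff ℝ ∞ (F j)) :
    partialDeriv i (∑ j ∈ s, F j) = ∑ j ∈ s, partialDeriv i (F j) := by
  ext x
  simp [partialDeriv, fderiv_sum fun j hj => (hF j hj).differentiable (by simp) x]

lemma partialDeriv_comm (i j : Fin n) (hf : ContDiff ℝ ∞ f) :
    partialDeriv i (partialDeriv j f) = partialDeriv j (partialDeriv i f) := by
  ext x
  have hd : DifferentiableAt ℝ (fderiv ℝ f) x :=
    (hf.fderiv_right (m := ∞) (by simp)).differentiable (by simp) x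
  have key (p q : Fin n) : partialDeriv p (partialDeriv q f) x =
      fderiv ℝ (fderiv ℝ f) x (EuclideanSpace.single p 1) (EuclideanSpace.single q 1) := by
    unfold partialDeriv
    rw [fderiv_clm_apply hd (differentiableAt_const _)]
    simp
  rw [key, key]
  exact (hf.contDiffAt.isSymmSndFDerivAt
    (by simpa using WithTop.coe_le_coe.2 (le_top : (2 : ℕ∞) ≤ ⊤))).eq _ _

lemma partialDeriv_coord_mul (i a : Fin n) (hf : ContDiff ℝ ∞ f) :
    partialDeriv i (fun x => x a * f x) =
      (fun x => x a * partialDeriv i f x) + (if i = a then (1 : ℝ) else 0) • f := by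
  ext x
  have hc : HasFDerivAt (fun x : EuclideanSpace ℝ (Fin n) => x a)
      (EuclideanSpace.proj a : EuclideanSpace ℝ (Fin n) →L[ℝ] ℝ) x :=
    (EuclideanSpace.proj a : EuclideanSpace ℝ (Fin n) →L[ℝ] ℝ).hasFDerivAt
  have h := (hc.mul (hf.differentiable (by simp) x).hasFDerivAt).fderiv
  simp only [partialDeriv, Pi.add_apply, Pi.smul_apply, smul_eq_mul]
  erw [h]
  simp [mul_comm, eq_comm]

lemma lap_add (hf : ContDiff ℝ ∞ f) (hg : ContDiff ℝ ∞ g) : lap (f + g) = lap f + lap g := by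
  simp only [lap_eq_sum_partialDeriv, ← Finset.sum_add_distrib]
  refine Finset.sum_congr rfl fun i _ => ?_
  rw [partialDeriv_add i hf hg,
    partialDeriv_add i (contDiff_partialDeriv i hf) (contDiff_partialDeriv i hg)]

lemma lap_smul (c : ℝ) (hf : ContDiff ℝ ∞ f) : lap (c • f) = c • lap f := by
  simp only [lap_eq_sum_partialDeriv, Finset.smul_sum]
  refine Finset.sum_congr rfl fun i _ => ?_
  rw [partialDeriv_smul i c hf, partialDeriv_smul i c (contDiff_partialDeriv i hf)]

lemma lap_partialDeriv (a : Fin n) (hf : ContDiff ℝ ∞ f) :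
    lap (partialDeriv a f) = partialDeriv a (lap f) := by
  simp only [lap_eq_sum_partialDeriv]
  rw [partialDeriv_sum _ _ fun j _ => contDiff_partialDeriv j (contDiff_partialDeriv j hf)]
  refine Finset.sum_congr rfl fun i _ => ?_
  rw [partialDeriv_comm i a hf, partialDeriv_comm i a (contDiff_partialDeriv i hf)]

lemma lap_iterate_partialDeriv (a : Fin n) (hf : ContDiff ℝ ∞ f) (k : ℕ) :
    lap^[k] (partialDeriv a f) = partialDeriv a (lap^[k] f) := by
  induction k with
  | zero => rfl
  | succ k ih =>
    rw [Function.iterate_succ_apply', ih, lap_partialDeriv a (contDiff_lap_iterate hf k),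
      Function.iterate_succ_apply']

lemma lap_coord_mul (a : Fin n) (hf : ContDiff ℝ ∞ f) :
    lap (fun x => x a * f x) = (fun x => x a * lap f x) + (2 : ℝ) • partialDeriv a f := by
  have key (i : Fin n) : partialDeriv i (partialDeriv i fun x => x a * f x) =
      (fun x => x a * partialDeriv i (partialDeriv i f) x) +
        (if i = a then (2 : ℝ) else 0) • partialDeriv i f := by
    rw [partialDeriv_coord_mul i a hf,
      partialDeriv_add i (contDiff_coord_mul a (contDiff_partialDeriv i hf))
        (contDiff_real_smul _ hf),
      partialDeriv_coord_mul i a (contDiff_partialDeriv i hf), partialDeriv_smul i _ hf]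
    ext x
    by_cases h : i = a <;> simp [h] <;> ring
  ext x
  simp only [lap_eq_sum_partialDeriv, key]
  simp [Finset.sum_add_distrib, Finset.mul_sum, ite_apply]

lemma lap_iterate_coord_mul (a : Fin n) (hf : ContDiff ℝ ∞ f) (k : ℕ) :
    lap^[k + 1] (fun x => x a * f x) = (fun x => x a * lap^[k + 1] f x) +
      (2 * (k + 1) : ℝ) • partialDeriv a (lap^[k] f) := by
  induction k with
  | zero => simpa using lap_coord_mul a hf
  | succ k ih =>
    have hk := contDiff_lap_iterate hf k
    have hk' := contDiff_lap_iterate hf (k + 1)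
    rw [Function.iterate_succ_apply', ih, lap_add (contDiff_coord_mul a hk')
      (contDiff_real_smul _ (contDiff_partialDeriv a hk)), lap_coord_mul a hk',
      lap_smul _ (contDiff_partialDeriv a hk), lap_partialDeriv a hk,
      ← Function.iterate_succ_apply' lap k, ← Function.iterate_succ_apply' lap (k + 1)]
    ext x
    simp
    ring

lemma integrable_mul_of_contDiff (hf : ContDiff ℝ ∞ f) (hg : ContDiff ℝ ∞ g)
    (hfs : HasCompactSupport f) : Integrable fun x => f x * g x :=
  (hf.continuous.mul hg.continuous).integrable_of_hasCompactSupport hfs.mul_right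

lemma integral_mul_partialDeriv (i : Fin n) (hf : ContDiff ℝ ∞ f) (hg : ContDiff ℝ ∞ g)
    (hfs : HasCompactSupport f) :
    ∫ x, f x * partialDeriv i g x = -∫ x, partialDeriv i f x * g x :=
  integral_mul_fderiv_eq_neg_fderiv_mul_of_integrable
    (integrable_mul_of_contDiff (contDiff_partialDeriv i hf) hg
      (hasCompactSupport_partialDeriv i hfs))
    (integrable_mul_of_contDiff hf (contDiff_partialDeriv i hg) hfs)
    (integrable_mul_of_contDiff hf hg hfs)
    (fun x _ => hf.differentiable (by simp) x) (fun x _ => hg.differentiable (by simp) x)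

lemma hasCompactSupport_lap (hf : HasCompactSupport f) : HasCompactSupport (lap f) := by
  refine hf.mono' fun x hx => ?_
  by_contra h
  refine hx (Finset.sum_eq_zero fun i _ => ?_)
  exact image_eq_zero_of_notMem_tsupport (f := partialDeriv i (partialDeriv i f)) fun hx' => h <|
    tsupport_fderiv_apply_subset ℝ _ (tsupport_fderiv_apply_subset ℝ _ hx')

lemma integral_mul_lap (hf : ContDiff ℝ ∞ f) (hg : ContDiff ℝ ∞ g) (hfs : HasCompactSupport f) :
    ∫ x, f x * lap g x = ∫ x, lap f x * g x := by
  simp only [lap_eq_sum_partialDeriv, Finset.sum_apply, Finset.mul_sum, Finset.sum_mul]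
  have hp (i : Fin n) := contDiff_partialDeriv i hf
  have hq (i : Fin n) := contDiff_partialDeriv i hg
  have hs (i : Fin n) := hasCompactSupport_partialDeriv i hfs
  rw [integral_finsetSum _ fun i _ =>
      integrable_mul_of_contDiff hf (contDiff_partialDeriv i (hq i)) hfs,
    integral_finsetSum _ fun i _ => integrable_mul_of_contDiff (contDiff_partialDeriv i (hp i)) hg
      (hasCompactSupport_partialDeriv i (hs i))]
  refine Finset.sum_congr rfl fun i _ => ?_
  rw [integral_mul_partialDeriv i hf (hq i) hfs, integral_mul_partialDeriv i (hp i) hg (hs i),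
    neg_neg]

lemma integral_mul_lap_iterate (hf : ContDiff ℝ ∞ f) (hg : ContDiff ℝ ∞ g)
    (hfs : HasCompactSupport f) (k : ℕ) :
    ∫ x, f x * lap^[k] g x = ∫ x, lap^[k] f x * g x := by
  induction k generalizing f with
  | zero => rfl
  | succ k ih =>
    rw [Function.iterate_succ_apply', integral_mul_lap hf (contDiff_lap_iterate hg k) hfs,
      ih (contDiff_lap hf) (hasCompactSupport_lap hfs), Function.iterate_succ_apply]

end DirectionalDerivative

theorem integral_coord_mul_deriv_lap_iterate {n : ℕ} (l : ℕ) (hl : 2 ≤ l)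
    (u : EuclideanSpace ℝ (Fin n) → ℝ)
    (hu : ContDiff ℝ (⊤ : ℕ∞) u) (hsupp : HasCompactSupport u) (α : Fin n) :
    ∫ x, x α * u x * fderiv ℝ (lap^[l - 1] u) x (EuclideanSpace.single α 1) =
      ∫ x, (((l : ℝ) - 1) *
          (fderiv ℝ (lap^[l - 2] u) x (EuclideanSpace.single α 1) *
            fderiv ℝ u x (EuclideanSpace.single α 1)) -
        (1 / 2) * u x * (lap^[l - 1] u) x) := by
  obtain ⟨k, rfl⟩ := Nat.exists_eq_add_of_le' hl
  simp only [Nat.add_sub_cancel, show k + 2 - 1 = k + 1 by omega]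
  have hA := contDiff_lap_iterate hu (k + 1)
  have hB := contDiff_lap_iterate hu k
  have hdB := contDiff_partialDeriv α hB
  have hdA := contDiff_partialDeriv α hA
  have hdu := contDiff_partialDeriv α hu
  have hdus := hasCompactSupport_partialDeriv α hsupp
  have hparts : ∫ x, (x α * u x) * partialDeriv α (lap^[k + 1] u) x =
      -∫ x, (x α * partialDeriv α u x * lap^[k + 1] u x + u x * lap^[k + 1] u x) := by
    rw [integral_mul_partialDeriv α (contDiff_coord_mul α hu) hA hsupp.mul_left,
      partialDeriv_coord_mul α α hu]
    simp [add_mul]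
  have hsymm : ∫ x, x α * partialDeriv α u x * lap^[k + 1] u x =
      ∫ x, (x α * u x * partialDeriv α (lap^[k + 1] u) x +
        (2 * (k + 1) : ℝ) * (u x * partialDeriv α (partialDeriv α (lap^[k] u)) x)) := by
    rw [integral_mul_lap_iterate (contDiff_coord_mul α hdu) hu hdus.mul_left,
      lap_iterate_coord_mul α hdu, lap_iterate_partialDeriv α hu, lap_iterate_partialDeriv α hu]
    refine integral_congr_ae (.of_forall fun x => ?_)
    simp
    ring
  have hlast := integral_mul_partialDeriv α hu hdB hsupp
  rw [integral_add (integrable_mul_of_contDiff (contDiff_coord_mul α hdu) hA hdus.mul_left)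
    (integrable_mul_of_contDiff hu hA hsupp)] at hparts
  rw [integral_add (integrable_mul_of_contDiff (contDiff_coord_mul α hu) hdA hsupp.mul_left)
    ((integrable_mul_of_contDiff hu (contDiff_partialDeriv α hdB) hsupp).const_mul _),
    integral_const_mul, hlast] at hsymm
  have hrhs : ∫ x, ((((k + 2 : ℕ) : ℝ) - 1) * (partialDeriv α (lap^[k] u) x * partialDeriv α u x) -
      (1 / 2) * u x * (lap^[k + 1] u) x) =
      (k + 1 : ℝ) * (∫ x, partialDeriv α u x * partialDeriv α (lap^[k] u) x) -
        (1 / 2) * ∫ x, u x * lap^[k + 1] u x := by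
    rw [← integral_const_mul, ← integral_const_mul, ← integral_sub
      ((integrable_mul_of_contDiff hdu hdB hdus).const_mul _)
      ((integrable_mul_of_contDiff hu hA hsupp).const_mul _)]
    refine integral_congr_ae (.of_forall fun x => ?_)
    push_cast
    ring
  change ∫ x, (x α * u x) * partialDeriv α (lap^[k + 1] u) x = _
  refine Eq.trans ?_ hrhs.symm
  linarith
end
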